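/- Let G be an insoluble para-Nil-Hamiltonian group. If G has a finitely generated minimal non-nilpotent subgroup whose normal closure in G is locally graded, then G is isomorphic to A₅ or to SL(2,5). -/

import Mathlib

/-- A group is *minimal non-nilpotent* if it is not nilpotent but every proper
subgroup of it is nilpotent. -/
def MinimalNonNilpotent (G : Type*) [Group G] : Prop :=
  ¬ Group.IsNilpotent G ∧ ∀ H : Subgroup G, H ≠ ⊤ → Group.IsNilpotent H

/-- A group is *biminimal non-nilpotent* if it is neither nilpotent nor minimal
non-nilpotent, but every proper subgroup of it is nilpotent or minimal non-nilpotent. -/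
def BiminimalNonNilpotent (G : Type*) [Group G] : Prop :=
  ¬ Group.IsNilpotent G ∧ ¬ MinimalNonNilpotent G ∧
    ∀ H : Subgroup G, H ≠ ⊤ → (Group.IsNilpotent H ∨ MinimalNonNilpotent H)

/-- A group is *para-Nil-Hamiltonian* if it is not nilpotent and every non-normal
subgroup of it is either nilpotent or minimal non-nilpotent. -/
def ParaNilHamiltonian (G : Type*) [Group G] : Prop :=
  ¬ Group.IsNilpotent G ∧
    ∀ H : Subgroup G, ¬ H.Normal → (Group.IsNilpotent H ∨ MinimalNonNilpotent H)

/-- A group is *meta-Nil-Hamiltonian* if every non-nilpotent subgroup of it is normal. -/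
def MetaNilHamiltonian (G : Type*) [Group G] : Prop :=
  ∀ H : Subgroup G, ¬ Group.IsNilpotent H → H.Normal

/-- A group is *locally graded* if every non-trivial finitely generated subgroup of it
contains a proper subgroup of finite index. -/
def LocallyGraded (G : Type*) [Group G] : Prop :=
  ∀ H : Subgroup G, H ≠ ⊥ → Group.FG H → ∃ K : Subgroup H, K ≠ ⊤ ∧ K.FiniteIndex

/-- A group is abelian if its multiplication commutes. -/
def Abelian (G : Type*) [Group G] : Prop := ∀ a b : G, a * b = b * a

/-- A group is *minimal non-abelian* if it is not abelian but every proper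
subgroup of it is abelian. -/
def MinimalNonAbelian (G : Type*) [Group G] : Prop :=
  ¬ Abelian G ∧ ∀ H : Subgroup G, H ≠ ⊤ → Abelian H

/-- A group is *biminimal non-abelian* if it is neither abelian nor minimal non-abelian,
but every proper subgroup of it is abelian or minimal non-abelian. -/
def BiminimalNonAbelian (G : Type*) [Group G] : Prop :=
  ¬ Abelian G ∧ ¬ MinimalNonAbelian G ∧
    ∀ H : Subgroup G, H ≠ ⊤ → (Abelian H ∨ MinimalNonAbelian H)

/-- A group is *parahamiltonian* if it is not abelian and every non-normal subgroup
of it is either abelian or minimal non-abelian. -/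
def Parahamiltonian (G : Type*) [Group G] : Prop :=
  ¬ Abelian G ∧ ∀ H : Subgroup G, ¬ H.Normal → (Abelian H ∨ MinimalNonAbelian H)

/-- A group is *locally nilpotent* if every finitely generated subgroup of it is nilpotent. -/
def LocallyNilpotent (G : Type*) [Group G] : Prop :=
  ∀ H : Subgroup G, Group.FG H → Group.IsNilpotent H

namespace ParaNil

open Subgroup

variable {G : Type*} [Group G]

/-- A group that is nilpotent or minimal non-nilpotent. -/
def NilOrMinimal (G : Type*) [Group G] : Prop := Group.IsNilpotent G ∨ MinimalNonNilpotent G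

theorem isNilpotent_of_injective {H : Type*} [Group H] (f : G →* H) (hf : Function.Injective f)
    (hH : Group.IsNilpotent H) : Group.IsNilpotent G :=
  Subgroup.isNilpotent_of_ker_le_center f (by rw [(MonoidHom.ker_eq_bot_iff f).2 hf]; exact bot_le)

theorem isNilpotent_of_le {H K : Subgroup G} (h : H ≤ K) (hK : Group.IsNilpotent K) :
    Group.IsNilpotent H :=
  isNilpotent_of_injective (inclusion h) (inclusion_injective h) hK

theorem isNilpotent_subgroupOf {H K : Subgroup G} (h : H ≤ K) :
    Group.IsNilpotent (H.subgroupOf K) ↔ Group.IsNilpotent H :=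
  Group.isNilpotent_congr (subgroupOfEquivOfLe h)

theorem isNilpotent_map {G' : Type*} [Group G'] (f : G →* G') {H : Subgroup G}
    (hH : Group.IsNilpotent H) : Group.IsNilpotent (H.map f) :=
  Group.nilpotent_of_surjective (h := hH) (f.subgroupMap H) (f.subgroupMap_surjective H)

theorem minimalNonNilpotent_iff {Y : Subgroup G} :
    MinimalNonNilpotent Y ↔ ¬ Group.IsNilpotent Y ∧ ∀ H < Y, Group.IsNilpotent H := by
  refine and_congr Iff.rfl ⟨fun h H hH => ?_, fun h H hH => ?_⟩
  · rw [← isNilpotent_subgroupOf hH.le]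
    refine h _ fun h' => hH.not_ge ?_
    rwa [subgroupOf_eq_top] at h'
  · have h1 : H.map Y.subtype < Y := by
      refine lt_of_le_of_ne (map_subtype_le H) fun h' => hH ?_
      apply map_injective Y.subtype_injective
      rw [h', ← MonoidHom.range_eq_map, range_subtype]
    exact (Group.isNilpotent_congr (H.equivMapOfInjective _ Y.subtype_injective)).2 (h _ h1)

theorem NilOrMinimal.eq_of_le {H Y : Subgroup G} (hH : NilOrMinimal H) (hY : MinimalNonNilpotent Y)
    (h : Y ≤ H) : Y = H := by
  rw [minimalNonNilpotent_iff] at hY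
  by_contra hne
  rcases hH with hH | hH
  · exact hY.1 (isNilpotent_of_le h hH)
  · exact hY.1 ((minimalNonNilpotent_iff.1 hH).2 _ (lt_of_le_of_ne h hne))

theorem NilOrMinimal.of_surjective {G' : Type*} [Group G'] (hG : NilOrMinimal G) (f : G →* G')
    (hf : Function.Surjective f) : NilOrMinimal G' := by
  rcases hG with hG | hG
  · exact Or.inl (Group.nilpotent_of_surjective f hf)
  · by_cases h : Group.IsNilpotent G'
    · exact Or.inl h
    · refine Or.inr ⟨h, fun H hH => ?_⟩
      rw [← map_comap_eq_self_of_surjective hf H]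
      refine isNilpotent_map f (hG.2 _ fun h => hH ?_)
      rw [← map_comap_eq_self_of_surjective hf H, h, ← MonoidHom.range_eq_map,
        MonoidHom.range_eq_top.2 hf]

theorem NilOrMinimal.map {G' : Type*} [Group G'] {H : Subgroup G} (hH : NilOrMinimal H)
    (f : G →* G') : NilOrMinimal (H.map f) :=
  hH.of_surjective (f.subgroupMap H) (f.subgroupMap_surjective H)

theorem NilOrMinimal.congr {G' : Type*} [Group G'] (e : G ≃* G') (h : NilOrMinimal G) :
    NilOrMinimal G' := h.of_surjective e.toMonoidHom e.surjective

theorem exists_minimalNonNilpotent_le [Finite G] {H : Subgroup G} (hH : ¬ Group.IsNilpotent H) :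
    ∃ Y ≤ H, MinimalNonNilpotent Y := by
  obtain ⟨Y, hY, hmin⟩ := exists_minimal_le_of_wellFoundedLT
    (fun K : Subgroup G => ¬ Group.IsNilpotent K) H hH
  refine ⟨Y, hY, minimalNonNilpotent_iff.2 ⟨hmin.prop, fun K hK => ?_⟩⟩
  by_contra hK'
  exact hK.not_ge (hmin.le_of_le hK' hK.le)

/-- All proper subgroups are nilpotent or minimal non-nilpotent. -/
def ProperNilOrMinimal (G : Type*) [Group G] : Prop :=
  ∀ H : Subgroup G, H ≠ ⊤ → NilOrMinimal H

theorem ProperNilOrMinimal.of_surjective {G' : Type*} [Group G'] (hG : ProperNilOrMinimal G)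
    (f : G →* G') (hf : Function.Surjective f) : ProperNilOrMinimal G' := by
  intro H hH
  rw [← map_comap_eq_self_of_surjective hf H]
  refine (hG _ fun h => hH ?_).map f
  rw [← map_comap_eq_self_of_surjective hf H, h, ← MonoidHom.range_eq_map,
    MonoidHom.range_eq_top.2 hf]

end ParaNil

namespace ParaNil

open Subgroup

variable {G : Type*} [Group G]

/-- In a nilpotent group, elements of coprime orders commute. -/
theorem commute_of_coprime_pow (G : Type*) [Group G] (hG : Group.IsNilpotent G) :
    ∀ (a b : G) (m n : ℕ), a ^ m = 1 → b ^ n = 1 → m.Coprime n → Commute a b := by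
  refine Group.nilpotent_center_quotient_ind
    (P := fun G _ _ => ∀ (a b : G) (m n : ℕ), a ^ m = 1 → b ^ n = 1 → m.Coprime n → Commute a b)
    G ?_ ?_
  · intro G _ _ a b m n _ _ _
    exact Subsingleton.elim _ _
  · intro G _ _ ih a b m n ha hb hmn
    have h := ih (a : G ⧸ center G) (b : G ⧸ center G) m n
      (by rw [← QuotientGroup.mk_pow, ha, QuotientGroup.mk_one])
      (by rw [← QuotientGroup.mk_pow, hb, QuotientGroup.mk_one]) hmn
    obtain ⟨c, hc⟩ : ∃ c, c = a * b * a⁻¹ * b⁻¹ := ⟨_, rfl⟩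
    have hcZ : c ∈ center G := by
      rw [← QuotientGroup.eq_one_iff, hc]
      have : ((a * b * a⁻¹ * b⁻¹ : G) : G ⧸ center G) = a * b * (a : G ⧸ center G)⁻¹ *
        (b : G ⧸ center G)⁻¹ := rfl
      rw [this, h.eq]; group
    have hcc : ∀ y, Commute c y := fun y => (mem_center_iff.1 hcZ y).symm
    have h1 : a * b * a⁻¹ = c * b := by rw [hc]; group
    have h2 : b * a * b⁻¹ = c⁻¹ * a := by
      rw [hc]; group
    have hcn : c ^ n = 1 := by
      have : (a * b * a⁻¹) ^ n = 1 := by rw [conj_pow, hb]; simp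
      rwa [h1, (hcc b).mul_pow, hb, mul_one] at this
    have hcm : c ^ m = 1 := by
      have : (b * a * b⁻¹) ^ m = 1 := by rw [conj_pow, ha]; simp
      rw [h2, (hcc a).inv_left.mul_pow, ha, mul_one, inv_pow, inv_eq_one] at this
      exact this
    have hc1 : c = 1 := by
      have h1 := orderOf_dvd_of_pow_eq_one hcn
      have h2 := orderOf_dvd_of_pow_eq_one hcm
      exact orderOf_eq_one_iff.1 (Nat.eq_one_of_dvd_coprimes hmn h2 h1)
    rw [hc1, one_mul, mul_inv_eq_iff_eq_mul] at h1
    exact h1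

theorem commute_of_coprime {H : Subgroup G} (hH : Group.IsNilpotent H) {a b : G} (ha : a ∈ H)
    (hb : b ∈ H) {m n : ℕ} (ham : a ^ m = 1) (hbn : b ^ n = 1) (hmn : m.Coprime n) :
    Commute a b := by
  have := commute_of_coprime_pow H hH ⟨a, ha⟩ ⟨b, hb⟩ m n (Subtype.ext (by simpa using ham))
    (Subtype.ext (by simpa using hbn)) hmn
  exact congrArg Subtype.val this.eq

theorem exists_primary_decomposition (g : G) (hg : IsOfFinOrder g) {p : ℕ} (hp : p.Prime) :
    ∃ u ∈ zpowers g, ∃ v ∈ zpowers g, g = u * v ∧ (∃ k, u ^ p ^ k = 1) ∧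
      ∃ m, v ^ m = 1 ∧ m.Coprime p ∧ m ∣ orderOf g := by
  obtain ⟨k, m, hm, hkm⟩ := Nat.exists_eq_pow_mul_and_not_dvd hg.orderOf_pos.ne' p hp.ne_one
  have hcop : (p ^ k).Coprime m := Nat.Coprime.pow_left _ ((Nat.Prime.coprime_iff_not_dvd hp).2 hm)
  have hbez := Nat.gcd_eq_gcd_ab (p ^ k) m
  rw [hcop.gcd_eq_one] at hbez
  have hg1 : g ^ ((p ^ k : ℕ) * (m : ℕ) : ℤ) = 1 := by
    rw [← Nat.cast_mul, zpow_natCast, ← hkm, pow_orderOf_eq_one]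
  refine ⟨g ^ ((m : ℤ) * (p ^ k).gcdB m), zpow_mem_zpowers _ _,
    g ^ (((p ^ k : ℕ) : ℤ) * (p ^ k).gcdA m), zpow_mem_zpowers _ _, ?_, ⟨k, ?_⟩, m, ?_, ?_, ?_⟩
  · rw [← zpow_add, add_comm, ← hbez]; simp
  · rw [← zpow_natCast, ← zpow_mul, show (m : ℤ) * (p ^ k).gcdB m * ((p ^ k : ℕ) : ℤ) =
      ((p ^ k : ℕ) * (m : ℕ) : ℤ) * (p ^ k).gcdB m by ring, zpow_mul, hg1, one_zpow]
  · rw [← zpow_natCast, ← zpow_mul, show ((p ^ k : ℕ) : ℤ) * (p ^ k).gcdA m * (m : ℤ) =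
      ((p ^ k : ℕ) * (m : ℕ) : ℤ) * (p ^ k).gcdA m by ring, zpow_mul, hg1, one_zpow]
  · exact ((Nat.Prime.coprime_iff_not_dvd hp).2 hm).symm
  · exact ⟨p ^ k, by rw [hkm]; ring⟩

theorem lt_inf_normalizer {D P : Subgroup G} (hP : Group.IsNilpotent P) (h : D < P) :
    D < P ⊓ normalizer (D : Set G) := by
  have h1 : D.subgroupOf P < ⊤ := by
    rw [lt_top_iff_ne_top]
    exact fun h' => h.not_ge (subgroupOf_eq_top.1 h')
  have h2 := Group.normalizerCondition_of_isNilpotent (h := hP) _ h1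
  obtain ⟨x, hx, hxD⟩ := SetLike.exists_of_lt h2
  refine lt_of_le_of_ne (le_inf h.le le_normalizer) fun heq => hxD ?_
  rw [mem_subgroupOf, heq]
  refine ⟨x.2, mem_normalizer_iff.2 ?_⟩
  rw [mem_normalizer_iff] at hx
  intro y
  constructor
  · intro hy
    have := (hx ⟨y, h.le hy⟩).1 (by rw [mem_subgroupOf]; exact hy)
    simpa [mem_subgroupOf] using this
  · intro hy
    have hyP : y ∈ P := by
      have := P.mul_mem (P.mul_mem (P.inv_mem x.2) (h.le hy)) x.2
      simpa [mul_assoc] using this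
    have := (hx ⟨y, hyP⟩).2 (by rw [mem_subgroupOf]; simpa using hy)
    simpa [mem_subgroupOf] using this

/-- `P` contains a `G`-conjugate of a non-identity element of `P` only via its normalizer. -/
def IsTI (P : Subgroup G) : Prop :=
  ∀ g x, x ∈ P → x ≠ 1 → g * x * g⁻¹ ∈ P → g ∈ normalizer ((P : Subgroup G) : Set G)

/-- A subgroup with a largest `p`-subgroup. -/
def HasMaxP (p : ℕ) (N : Subgroup G) : Prop :=
  ∃ T : Subgroup G, IsPGroup p T ∧ T ≤ N ∧ ∀ R : Subgroup G, IsPGroup p R → R ≤ N → R ≤ T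

theorem hasMaxP_of_normal_sylow [Finite G] {p : ℕ} [Fact p.Prime] {N : Subgroup G}
    (P : Sylow p N) (hP : (P : Subgroup N).Normal) : HasMaxP p N := by
  refine ⟨(P : Subgroup N).map N.subtype, P.isPGroup'.map _, map_subtype_le _, fun R hR hRN => ?_⟩
  have hR' : IsPGroup p (R.subgroupOf N) := hR.comap_subtype
  obtain ⟨Q, hQ⟩ := hR'.exists_le_sylow
  have := Sylow.unique_of_normal P hP
  rw [Subsingleton.elim Q P] at hQ
  have := map_mono (f := N.subtype) hQ
  rwa [subgroupOf_map_subtype, inf_eq_left.2 hRN] at this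

theorem hasMaxP_of_isNilpotent [Finite G] (p : ℕ) [Fact p.Prime] {N : Subgroup G}
    (hN : Group.IsNilpotent N) : HasMaxP p N := by
  obtain ⟨P⟩ : Nonempty (Sylow p N) := inferInstance
  exact hasMaxP_of_normal_sylow P inferInstance

theorem exists_not_hasMaxP [Finite G] {p : ℕ} [Fact p.Prime] (P : Sylow p G)
    (hP : ¬ IsTI (P : Subgroup G)) :
    ∃ D : Subgroup G, D ≠ ⊥ ∧ D < P ∧ ¬ HasMaxP p (normalizer (D : Set G)) := by
  simp only [IsTI, not_forall] at hP
  obtain ⟨g, x, hx, hx1, hgx, hg⟩ := hP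
  have hne : g • P ≠ P := by
    rwa [Ne, Sylow.smul_eq_iff_mem_normalizer]
  have : Nonempty {Q : Sylow p G // Q ≠ P} := ⟨⟨_, hne⟩⟩
  obtain ⟨⟨Q, hQ⟩, hmax⟩ := Finite.exists_max
    (fun Q : {Q : Sylow p G // Q ≠ P} => Nat.card (P ⊓ Q.1 : Subgroup G))
  set D : Subgroup G := P ⊓ Q with hD
  have hDP : D < P := by
    refine lt_of_le_of_ne inf_le_left fun h => hQ ?_
    have h1 : (P : Subgroup G) ≤ Q := by rw [← h]; exact inf_le_right
    exact Sylow.ext (P.is_maximal' Q.isPGroup' h1)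
  have hDQ : D < Q := by
    refine lt_of_le_of_ne inf_le_right fun h => hQ ?_
    have h1 : (Q : Subgroup G) ≤ P := by rw [← h]; exact inf_le_left
    exact (Sylow.ext (Q.is_maximal' P.isPGroup' h1)).symm
  refine ⟨D, fun hbot => ?_, hDP, ?_⟩
  · have h1 := hmax ⟨_, hne⟩
    simp only [hbot, card_bot] at h1
    have h2 : g * x * g⁻¹ ∈ ((P : Subgroup G) ⊓ (g • P : Sylow p G) : Subgroup G) := by
      refine ⟨hgx, ?_⟩
      rw [Sylow.coe_subgroup_smul]
      exact ⟨x, hx, rfl⟩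
    rw [eq_bot_of_card_le _ h1, mem_bot] at h2
    apply hx1
    simpa using h2
  · rintro ⟨T, hT, -, hTmax⟩
    obtain ⟨R, hR⟩ := hT.exists_le_sylow
    have hP1 := lt_inf_normalizer (IsPGroup.isNilpotent P.isPGroup') hDP
    have hQ1 := lt_inf_normalizer (IsPGroup.isNilpotent Q.isPGroup') hDQ
    have hP2 := (hTmax _ (P.isPGroup'.to_le inf_le_left) (inf_le_right)).trans hR
    have hQ2 := (hTmax _ (Q.isPGroup'.to_le inf_le_left) (inf_le_right)).trans hR
    have hRP : R = P := by
      by_contra hRP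
      have h1 := hmax ⟨R, hRP⟩
      simp only at h1
      have h2 : D < (P : Subgroup G) ⊓ R := hP1.trans_le (le_inf inf_le_left hP2)
      exact (Set.Finite.card_lt_card (Set.toFinite _) h2).not_ge h1
    rw [hRP] at hQ2
    exact hQ1.not_ge (le_inf hQ2 inf_le_left)

theorem commutator_lt_of_isNilpotent {P : Subgroup G} (hP : Group.IsNilpotent P) (hbot : P ≠ ⊥) :
    ⁅P, P⁆ < P := by
  have h3 : Nontrivial P := (nontrivial_iff_ne_bot _).2 hbot
  have h4 := Group.IsSolvable.commutator_lt_top_of_nontrivial P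
  refine lt_of_le_of_ne (commutator_le_self _) fun h => h4.ne ?_
  apply map_injective P.subtype_injective
  rw [map_subtype_commutator P, ← MonoidHom.range_eq_map, range_subtype, h]

theorem sylow_eq_bot_of_fusion [Finite G] {p : ℕ} [Fact p.Prime] (P : Sylow p G)
    (hG : commutator G = ⊤)
    (h : ∀ g x, x ∈ P → g * x * g⁻¹ ∈ P → x * (g * x * g⁻¹)⁻¹ ∈ ⁅(P : Subgroup G), (P : Subgroup G)⁆) :
    (P : Subgroup G) = ⊥ := by
  have h1 := Subgroup.commutator_inf_eq_focalSubgroup P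
  rw [hG, top_inf_eq, focalSubgroup_def] at h1
  have h2 : (P : Subgroup G) ≤ ⁅(P : Subgroup G), (P : Subgroup G)⁆ := by
    conv_lhs => rw [h1]
    rw [closure_le]
    rintro _ ⟨hg, x, hx, u, rfl⟩
    have := h u x hx (by
      have := P.mul_mem (P.inv_mem hg) hx
      simpa [commutatorElement_def, mul_assoc] using! this)
    simpa [commutatorElement_def, mul_assoc] using this
  by_contra hbot
  exact (commutator_lt_of_isNilpotent (IsPGroup.isNilpotent P.isPGroup') hbot).not_ge h2

theorem mem_normalizer_of_conj_mem [Finite G] {T : Subgroup G} {x : G}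
    (h : ∀ t ∈ T, x * t * x⁻¹ ∈ T) : x ∈ normalizer (T : Set G) := by
  have h1 : T.map (MulAut.conj x).toMonoidHom = T := by
    refine eq_of_le_of_card_ge ?_ (by rw [card_map_of_injective (MulAut.conj x).injective])
    rintro _ ⟨t, ht, rfl⟩
    exact h t ht
  rw [mem_normalizer_iff]
  refine fun t => ⟨h t, fun ht => ?_⟩
  rw [← h1] at ht
  obtain ⟨s, hs, hst⟩ := ht
  rwa [← (MulAut.conj x).injective (a₁ := s) (a₂ := t) hst]

theorem Sylow.mem_of_normalizer [Finite G] {p : ℕ} [Fact p.Prime] (P : Sylow p G) {u : G}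
    (hu : u ∈ normalizer ((P : Subgroup G) : Set G)) {k : ℕ} (huk : u ^ p ^ k = 1) : u ∈ P := by
  have h1 : IsPGroup p (zpowers u) := IsPGroup.of_card_dvd_pow (n := k)
    (by rw [Nat.card_zpowers]; exact orderOf_dvd_of_pow_eq_one huk)
  have h2 : IsPGroup p ((P : Subgroup G) ⊔ zpowers u : Subgroup G) :=
    P.isPGroup'.to_sup_of_normal_left' h1 (by simpa using hu)
  have := P.is_maximal' h2 le_sup_left
  have h3 : u ∈ (P : Subgroup G) ⊔ zpowers u := mem_sup_right (mem_zpowers u)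
  rw [this] at h3
  exact h3

/-- A non-trivial Sylow subgroup of a finite perfect group that is TI has non-nilpotent
normalizer. -/
theorem not_isNilpotent_normalizer_of_isTI [Finite G] {p : ℕ} [Fact p.Prime] (P : Sylow p G)
    (hG : commutator G = ⊤) (hP : (P : Subgroup G) ≠ ⊥) (hTI : IsTI (P : Subgroup G)) :
    ¬ Group.IsNilpotent (normalizer ((P : Subgroup G) : Set G)) := by
  intro hN
  refine hP (sylow_eq_bot_of_fusion P hG fun g x hx hgx => ?_)
  by_cases hx1 : x = 1
  · subst hx1; simp
  have hg := hTI g x hx hx1 hgx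
  obtain ⟨u, hu, v, hv, rfl, ⟨k, huk⟩, m, hvm, hmp, -⟩ :=
    exists_primary_decomposition g (isOfFinOrder_of_finite g) (Fact.out : p.Prime)
  have hu' := (zpowers_le.2 hg) hu
  have hv' := (zpowers_le.2 hg) hv
  have huP := Sylow.mem_of_normalizer P hu' huk
  obtain ⟨j, hj⟩ := P.isPGroup' ⟨x, hx⟩
  have hxj : x ^ p ^ j = 1 := by simpa [Subtype.ext_iff] using hj
  have hvx : Commute v x := commute_of_coprime hN hv' (le_normalizer hx) hvm hxj
    (Nat.Coprime.pow_right _ hmp)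
  have : x * (u * v * x * (u * v)⁻¹)⁻¹ = x * u * x⁻¹ * u⁻¹ := by
    rw [mul_assoc u v x, hvx.eq]; group
  rw [this, ← commutatorElement_def]
  exact commutator_mem_commutator hx huP

theorem isSolvable_of_forall_isNilpotent (n : ℕ) : ∀ (G : Type*) [Group G] [Finite G],
    Nat.card G = n → (∀ H : Subgroup G, H ≠ ⊤ → Group.IsNilpotent H) → Group.IsSolvable G := by
  induction n using Nat.strong_induction_on with
  | _ n ih =>
  intro G _ _ hn hG
  by_cases hs : ∃ N : Subgroup G, N.Normal ∧ N ≠ ⊥ ∧ N ≠ ⊤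
  · obtain ⟨N, hN, hbot, htop⟩ := hs
    have hN1 := hG N htop
    refine (Group.isSolvable_iff_subgroup_quotient N).2 ⟨inferInstance, ?_⟩
    refine ih _ ?_ (G ⧸ N) rfl fun H hH => ?_
    · rw [← hn, card_eq_card_quotient_mul_card_subgroup N]
      exact lt_mul_of_one_lt_right Nat.card_pos ((one_lt_card_iff_ne_bot N).2 hbot)
    · rw [← map_comap_eq_self_of_surjective (QuotientGroup.mk'_surjective N) H]
      refine isNilpotent_map _ (hG _ fun h => hH ?_)
      rw [← map_comap_eq_self_of_surjective (QuotientGroup.mk'_surjective N) H, h,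
        ← MonoidHom.range_eq_map, QuotientGroup.range_mk']
  · push Not at hs
    have hcomm : commutator G = ⊤ ∨ Group.IsSolvable G := by
      by_cases h : commutator G = ⊥
      · right
        exact ⟨1, by rw [derivedSeries_one, h]⟩
      · exact Or.inl (hs _ inferInstance h)
    refine hcomm.elim (fun hcomm => ?_) id
    rcases subsingleton_or_nontrivial G with h | h
    · infer_instance
    obtain ⟨p, hp, hpG⟩ := Nat.exists_prime_and_dvd (Finite.one_lt_card (α := G)).ne'
    have := Fact.mk hp
    obtain ⟨P⟩ : Nonempty (Sylow p G) := inferInstance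
    have hPbot : (P : Subgroup G) ≠ ⊥ := P.ne_bot_of_dvd_card hpG
    by_contra hns
    have hPtop : (P : Subgroup G) ≠ ⊤ := by
      intro h
      have h1 := IsPGroup.isNilpotent P.isPGroup'
      rw [h, Group.isNilpotent_top] at h1
      exact hns inferInstance
    have hnorm : ∀ D : Subgroup G, D ≠ ⊥ → D ≤ P → Group.IsNilpotent (normalizer (D : Set G)) := by
      intro D hD hDP
      refine hG _ fun h => hPtop ?_
      rw [normalizer_eq_top_iff] at h
      exact top_le_iff.1 ((hs D h hD).symm.le.trans hDP)
    by_cases hTI : IsTI (P : Subgroup G)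
    · exact not_isNilpotent_normalizer_of_isTI P hcomm hPbot hTI (hnorm _ hPbot le_rfl)
    · obtain ⟨D, hD, hDP, hmax⟩ := exists_not_hasMaxP P hTI
      exact hmax (hasMaxP_of_isNilpotent p (hnorm D hD hDP.le))

end ParaNil

namespace ParaNil

open Subgroup

variable {G : Type*} [Group G]

theorem exists_normal_prime_index (X : Type*) [Group X] [Finite X] [Nontrivial X]
    [Group.IsSolvable X] : ∃ M : Subgroup X, M.Normal ∧ M.index.Prime := by
  have h1 := (Group.IsSolvable.commutator_lt_top_of_nontrivial X).ne
  obtain ⟨M, hM, hle⟩ := (eq_top_or_exists_le_coatom (commutator X)).resolve_left h1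
  have hn : M.Normal := Normal.of_commutator_le X hle
  refine ⟨M, hn, ?_⟩
  have : IsMulCommutative (X ⧸ M) := Normal.quotient_commutative_iff_commutator_le.2 hle
  have hnt : Nontrivial (X ⧸ M) := QuotientGroup.nontrivial_iff.2 hM.1
  have hs : IsSimpleGroup (X ⧸ M) := by
    refine ⟨fun H _ => ?_⟩
    have h2 : M ≤ H.comap (QuotientGroup.mk' M) := by
      intro m hm
      rw [mem_comap, QuotientGroup.mk'_apply, (QuotientGroup.eq_one_iff m).2 hm]
      exact H.one_mem
    have h3 := map_comap_eq_self_of_surjective (QuotientGroup.mk'_surjective M) H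
    rcases hM.le_iff.1 h2 with h | h
    · right
      rw [← h3, h, ← MonoidHom.range_eq_map, QuotientGroup.range_mk']
    · left
      rw [← h3, h, QuotientGroup.map_mk'_self]
  let _ : CommGroup (X ⧸ M) := { mul_comm := fun a b => mul_comm' a b }
  exact IsSimpleGroup.prime_card

/-- If `y x y⁻¹ = r x` with `r` a `p`-element commuting with the `q`-element `x`, then `r = 1`. -/
theorem eq_one_of_conj_eq_mul {p q : ℕ} (hpq : p.Coprime q) {r x y : G} (hrx : Commute r x)
    (h : y * x * y⁻¹ = r * x) (hr : ∃ j, r ^ p ^ j = 1) (hx : ∃ k, x ^ q ^ k = 1) : r = 1 := by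
  obtain ⟨j, hj⟩ := hr
  obtain ⟨k, hk⟩ := hx
  have h1 : (y * x * y⁻¹) ^ q ^ k = 1 := by rw [conj_pow, hk]; simp
  rw [h, hrx.mul_pow, hk, mul_one] at h1
  exact orderOf_eq_one_iff.1 (Nat.eq_one_of_dvd_coprimes (hpq.pow j k)
    (orderOf_dvd_of_pow_eq_one hj) (orderOf_dvd_of_pow_eq_one h1))

/-- The structure of a finite minimal non-nilpotent subgroup `Y = P ⟨x⟩`. -/
structure SchmidtData (Y : Subgroup G) (p q : ℕ) (P : Subgroup G) (x : G) : Prop where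
  hp : p.Prime
  hq : q.Prime
  hpq : p ≠ q
  le : P ≤ Y
  mem : x ∈ Y
  normal : ∀ y ∈ Y, ∀ u ∈ P, y * u * y⁻¹ ∈ P
  isPGroup : IsPGroup p P
  gen : ∀ y ∈ Y, ∃ u ∈ P, ∃ k : ℤ, y = u * x ^ k
  pow : ∃ k, x ^ q ^ k = 1
  central : ∀ y ∈ Y, Commute (x ^ q) y
  not_comm : ∃ u ∈ P, ¬ Commute x u
  invariant : ∀ T ≤ P, (∀ t ∈ T, x * t * x⁻¹ ∈ T) → T = P ∨ ∀ t ∈ T, ∀ y ∈ Y, Commute t y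
  pow_central : ∀ u ∈ P, ∀ y ∈ Y, Commute (u ^ p) y
  comm_central : ∀ u ∈ P, ∀ v ∈ P, ∀ y ∈ Y, Commute (u * v * u⁻¹ * v⁻¹) y

theorem exists_schmidt_pair (X : Type*) [Group X] [Finite X] (hX : MinimalNonNilpotent X) :
    ∃ (p q : ℕ) (P : Subgroup X) (x : X), p.Prime ∧ q.Prime ∧ p ≠ q ∧ P.Normal ∧ IsPGroup p P ∧
      (∃ k, x ^ q ^ k = 1) ∧ (∃ u ∈ P, ¬ Commute x u) := by
  have : Nontrivial X := by
    by_contra h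
    rw [not_nontrivial_iff_subsingleton] at h
    exact hX.1 inferInstance
  have := isSolvable_of_forall_isNilpotent _ X rfl hX.2
  obtain ⟨M, hM, hq⟩ := exists_normal_prime_index X
  set q := M.index with hqdef
  have := Fact.mk hq
  have hMnil : Group.IsNilpotent M := hX.2 M (fun h => hq.ne_one (by rw [hqdef, h, index_top]))
  have hnormal : ∀ p : ℕ, p.Prime → p ≠ q → ∀ P : Sylow p X, (P : Subgroup X).Normal := by
    intro p hp hpq P
    have := Fact.mk hp
    have hPM : (P : Subgroup X) ≤ M := by
      intro u hu
      obtain ⟨j, hj⟩ := P.isPGroup' ⟨u, hu⟩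
      have hj : u ^ p ^ j = 1 := by simpa [Subtype.ext_iff] using hj
      rw [← QuotientGroup.eq_one_iff, ← orderOf_eq_one_iff]
      refine Nat.eq_one_of_dvd_coprimes (Nat.Coprime.pow_left j ((Nat.coprime_primes hp hq).2 hpq))
        (orderOf_dvd_of_pow_eq_one ?_) (orderOf_dvd_natCard _)
      rw [← QuotientGroup.mk_pow, hj, QuotientGroup.mk_one]
    have hn : (P.subtype hPM : Subgroup M).Normal := inferInstance
    have hc := (P.subtype hPM).characteristic_of_normal hn
    have h2 : ((P.subtype hPM : Subgroup M).map M.subtype).Normal :=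
      ConjAct.normal_of_characteristic_of_normal
    rwa [Sylow.coe_subtype, subgroupOf_map_subtype, inf_eq_left.2 hPM] at h2
  have hQ : ∃ Q : Sylow q X, ¬ (Q : Subgroup X).Normal := by
    by_contra hcon
    push Not at hcon
    apply hX.1
    refine ((Group.isNilpotent_of_finite_tfae (G := X)).out 0 3 rfl rfl).2 ?_
    intro p hp P
    by_cases hpq : p = q
    · subst hpq
      exact hcon P
    · exact hnormal p hp.out hpq P
  obtain ⟨Q, hQ⟩ := hQ
  by_contra hcon
  push Not at hcon
  apply hQ
  rw [← normalizer_eq_top_iff, ← index_eq_one]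
  by_contra hne
  obtain ⟨p, hp, hdvd⟩ := Nat.exists_prime_and_dvd hne
  have := Fact.mk hp
  obtain ⟨P⟩ : Nonempty (Sylow p X) := inferInstance
  by_cases hpq : p = q
  · subst hpq
    exact Q.not_dvd_index (hdvd.trans (index_dvd_of_le le_normalizer))
  · have hle : (P : Subgroup X) ≤ normalizer ((Q : Subgroup X) : Set X) := by
      intro u hu
      rw [mem_normalizer_iff]
      have hc : ∀ x ∈ Q, u * x * u⁻¹ = x := by
        intro x hx
        obtain ⟨j, hj⟩ := Q.isPGroup' ⟨x, hx⟩
        have hj : x ^ q ^ j = 1 := by simpa [Subtype.ext_iff] using hj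
        have h1 := hcon p q P x hp hq hpq (hnormal p hp hpq P) P.isPGroup' ⟨j, hj⟩ u hu
        rw [← h1.eq, mul_inv_cancel_right]
      intro x
      refine ⟨fun hx => by rw [hc x hx]; exact hx, fun hx => ?_⟩
      have h2 := hc _ hx
      have h3 : u * x * u⁻¹ = x := by
        have := congrArg (fun z => u⁻¹ * z * u) h2
        simpa [mul_assoc] using this
      rwa [h3] at hx
    exact P.not_dvd_index (hdvd.trans (index_dvd_of_le hle))

theorem exists_schmidtData [Finite G] {Y : Subgroup G} (hY : MinimalNonNilpotent Y) :
    ∃ p q P x, SchmidtData Y p q P x := by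
  obtain ⟨p, q, P, hP⟩ : ∃ (p q : ℕ) (P : Subgroup G), ∃ x : G, p.Prime ∧ q.Prime ∧ p ≠ q ∧ P ≤ Y ∧
      (∀ y ∈ Y, ∀ u ∈ P, y * u * y⁻¹ ∈ P) ∧ IsPGroup p P ∧ x ∈ Y ∧ (∃ k, x ^ q ^ k = 1) ∧
      ∃ u ∈ P, ¬ Commute x u := by
    obtain ⟨p, q, P, x, hp, hq, hpq, hP, hPp, ⟨k, hk⟩, u, hu, hxu⟩ := exists_schmidt_pair Y hY
    refine ⟨p, q, P.map Y.subtype, x, hp, hq, hpq, map_subtype_le _, ?_, hPp.map _, x.2, ⟨k, ?_⟩,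
      u, ⟨u, hu, rfl⟩, fun h => hxu (Subtype.ext h.eq)⟩
    · rintro y hy _ ⟨u, hu, rfl⟩
      exact ⟨⟨y, hy⟩ * u * ⟨y, hy⟩⁻¹, hP.conj_mem u hu ⟨y, hy⟩, rfl⟩
    · simpa [Subtype.ext_iff] using hk
  -- choose `x` of minimal order
  obtain ⟨x, ⟨hp, hq, hpq, hPY, hnorm, hPp, hxY, hxk, hxu⟩, hmin⟩ := exists_minimalFor_of_wellFoundedLT
    (fun x : G => p.Prime ∧ q.Prime ∧ p ≠ q ∧ P ≤ Y ∧
      (∀ y ∈ Y, ∀ u ∈ P, y * u * y⁻¹ ∈ P) ∧ IsPGroup p P ∧ x ∈ Y ∧ (∃ k, x ^ q ^ k = 1) ∧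
      ∃ u ∈ P, ¬ Commute x u) orderOf hP
  have hcop : p.Coprime q := (Nat.coprime_primes hp hq).2 hpq
  have hPelt : ∀ u ∈ P, ∃ j, u ^ p ^ j = 1 := by
    intro u hu
    obtain ⟨j, hj⟩ := hPp ⟨u, hu⟩
    exact ⟨j, by simpa [Subtype.ext_iff] using hj⟩
  rw [minimalNonNilpotent_iff] at hY
  have hcommnil : ∀ H : Subgroup G, Group.IsNilpotent H → x ∈ H → ∀ u ∈ P, u ∈ H →
      Commute x u := by
    intro H hH hxH u hu huH
    obtain ⟨k, hk⟩ := hxk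
    obtain ⟨j, hj⟩ := hPelt u hu
    exact commute_of_coprime hH hxH huH hk hj (hcop.symm.pow k j)
  have hsup : P ⊔ zpowers x = Y := by
    have hle : P ⊔ zpowers x ≤ Y := sup_le hPY (zpowers_le.2 hxY)
    by_contra hne
    obtain ⟨u, hu, hc⟩ := hxu
    exact hc (hcommnil _ (hY.2 _ (lt_of_le_of_ne hle hne)) (mem_sup_right (mem_zpowers x)) u hu
      (mem_sup_left hu))
  have hgen : ∀ T ≤ P, (∀ t ∈ T, x * t * x⁻¹ ∈ T) → ∀ y ∈ T ⊔ zpowers x, ∃ u ∈ T, ∃ k : ℤ,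
      y = u * x ^ k := by
    intro T hT hTx y hy
    have hxN : zpowers x ≤ normalizer (T : Set G) := by
      rw [zpowers_le]
      exact mem_normalizer_of_conj_mem hTx
    rw [← SetLike.mem_coe, coe_mul_of_right_le_normalizer_left _ _ hxN] at hy
    obtain ⟨u, hu, _, ⟨k, rfl⟩, rfl⟩ := hy
    exact ⟨u, hu, k, rfl⟩
  have hxcomm : ∀ u ∈ P, Commute (x * u * x⁻¹ * u⁻¹) x → Commute x u := by
    intro u hu hc
    have hr : u * x * u⁻¹ * x⁻¹ ∈ P := by
      have h1 := P.mul_mem hu (P.inv_mem (hnorm x hxY u hu))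
      simpa [mul_assoc] using h1
    have h2 := eq_one_of_conj_eq_mul (r := u * x * u⁻¹ * x⁻¹) (x := x) (y := u) hcop ?_
      (by group) (hPelt _ hr) hxk
    · rw [mul_inv_eq_one, mul_inv_eq_iff_eq_mul] at h2
      exact h2.symm
    · have : u * x * u⁻¹ * x⁻¹ = (x * u * x⁻¹ * u⁻¹)⁻¹ := by group
      rw [this]
      exact hc.inv_left
  have hTx : ∀ T ≤ P, (∀ t ∈ T, x * t * x⁻¹ ∈ T) → T ≠ P → ∀ t ∈ T, Commute x t := by
    intro T hT hTi hne t ht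
    refine hcommnil (T ⊔ zpowers x) (hY.2 _ (lt_of_le_of_ne
      (sup_le (hT.trans hPY) (zpowers_le.2 hxY)) fun h => hne ?_)) (mem_sup_right (mem_zpowers x)) t
      (hT ht) (mem_sup_left ht)
    refine le_antisymm hT fun y hy => ?_
    obtain ⟨u, hu, k, hk⟩ := hgen T hT hTi y (h ▸ hPY hy)
    have h1 : x ^ k ∈ P := by
      rw [eq_inv_mul_iff_mul_eq.2 hk.symm]
      exact P.mul_mem (P.inv_mem (hT hu)) hy
    obtain ⟨j, hj⟩ := hPelt _ h1
    obtain ⟨m, hm⟩ := hxk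
    have h2 : (x ^ k) ^ q ^ m = 1 := by rw [← zpow_natCast, zpow_comm, zpow_natCast, hm, one_zpow]
    have h3 : x ^ k = 1 := orderOf_eq_one_iff.1 (Nat.eq_one_of_dvd_coprimes (hcop.pow j m)
      (orderOf_dvd_of_pow_eq_one hj) (orderOf_dvd_of_pow_eq_one h2))
    rwa [hk, h3, mul_one]
  obtain ⟨u₀, hu₀, hxu₀⟩ := hxu
  obtain ⟨C, hC⟩ : ∃ C : Subgroup G, C = P ⊓ centralizer {x} := ⟨_, rfl⟩
  have hmemC : ∀ c, c ∈ C ↔ c ∈ P ∧ Commute x c := by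
    intro c
    rw [hC, mem_inf, mem_centralizer_singleton_iff]
    exact and_congr_right fun _ => eq_comm
  have hCP : C < P := by
    refine lt_of_le_of_ne (by rw [hC]; exact inf_le_left) fun h => hxu₀ ?_
    exact ((hmemC u₀).1 (h ▸ hu₀)).2
  have hPnil : Group.IsNilpotent P := by
    have := Fact.mk hp
    exact IsPGroup.isNilpotent hPp
  have hCx : ∀ c ∈ C, x * c * x⁻¹ = c := fun c hc => by
    rw [((hmemC c).1 hc).2.eq, mul_inv_cancel_right]
  have hxNC : x ∈ normalizer (C : Set G) :=
    mem_normalizer_of_conj_mem fun c hc => by rwa [hCx c hc]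
  have hPNC : P ≤ normalizer (C : Set G) := by
    have h1 := lt_inf_normalizer hPnil hCP
    by_contra hle
    refine h1.not_ge fun t ht => (hmemC t).2 ⟨ht.1, hTx _ inf_le_left ?_ ?_ t ht⟩
    · intro t ht
      exact mem_inf.2 ⟨hnorm x hxY t ht.1, mul_mem (mul_mem hxNC (mem_inf.1 ht).2) (inv_mem hxNC)⟩
    · exact fun h => hle (inf_eq_left.1 h)
  have hPC : ∀ c ∈ C, ∀ u ∈ P, Commute c u := by
    by_contra hcon
    refine hxu₀ (hxcomm u₀ hu₀ ?_)
    refine (hTx (P ⊓ centralizer (C : Set G)) inf_le_left ?_ ?_ _ ?_).symm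
    · intro t ht
      refine ⟨hnorm x hxY t ht.1, ?_⟩
      intro c hc
      have h1 := ht.2 c hc
      calc c * (x * t * x⁻¹) = x * c * x⁻¹ * (x * t * x⁻¹) := by rw [hCx c hc]
        _ = x * (c * t) * x⁻¹ := by group
        _ = x * t * x⁻¹ * (x * c * x⁻¹) := by rw [h1]; group
        _ = _ := by rw [hCx c hc]
    · exact fun h => hcon fun c hc u hu => (inf_eq_left.1 h hu) c hc
    · refine ⟨P.mul_mem (hnorm x hxY _ hu₀) (P.inv_mem hu₀), ?_⟩
      intro c hc
      have h1 : u₀⁻¹ * c * u₀ ∈ C := by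
        have := (mem_normalizer_iff.1 (inv_mem (hPNC hu₀)) c).1 hc
        simpa using this
      have h2 := ((hmemC _).1 h1).2.inv_left
      calc c * (x * u₀ * x⁻¹ * u₀⁻¹) = (x * c * x⁻¹) * (x * u₀ * x⁻¹ * u₀⁻¹) := by rw [hCx c hc]
        _ = x * u₀ * ((u₀⁻¹ * c * u₀) * x⁻¹) * u₀⁻¹ := by group
        _ = (x * u₀ * x⁻¹ * u₀⁻¹) * c := by rw [← h2.eq]; group
  have hgenY : ∀ y ∈ Y, ∃ u ∈ P, ∃ k : ℤ, y = u * x ^ k := fun y hy =>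
    hgen P le_rfl (hnorm x hxY) y (by rwa [hsup])
  have hcent : ∀ c, (∀ u ∈ P, Commute c u) → Commute c x → ∀ y ∈ Y, Commute c y := by
    intro c h1 h2 y hy
    obtain ⟨u, hu, k, rfl⟩ := hgenY y hy
    exact (h1 u hu).mul_right (h2.zpow_right k)
  have hinv : ∀ T ≤ P, (∀ t ∈ T, x * t * x⁻¹ ∈ T) → T = P ∨ ∀ t ∈ T, ∀ y ∈ Y, Commute t y := by
    intro T hT hTi
    refine or_iff_not_imp_left.2 fun hne t ht => ?_
    have h1 := hTx T hT hTi hne t ht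
    exact hcent t (hPC t ((hmemC t).2 ⟨hT ht, h1⟩)) h1.symm
  have hcomm : ∀ u ∈ P, ∀ v ∈ P, ∀ y ∈ Y, Commute (u * v * u⁻¹ * v⁻¹) y := by
    intro u hu v hv
    refine (hinv ⁅P, P⁆ (commutator_le_self P) ?_).resolve_left ?_ _ (commutator_mem_commutator hu hv)
    · intro t ht
      have h1 : ⁅P, P⁆.map (MulAut.conj x).toMonoidHom ≤ ⁅P, P⁆ := by
        rw [map_commutator]
        refine commutator_mono ?_ ?_ <;>
        · rintro _ ⟨t, ht, rfl⟩
          exact hnorm x hxY t ht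
      exact h1 ⟨t, ht, rfl⟩
    · refine (commutator_lt_of_isNilpotent hPnil fun h => hxu₀ ?_).ne
      rw [h, mem_bot] at hu₀
      rw [hu₀]
      exact Commute.one_right x
  have hpow : ∀ u ∈ P, ∀ y ∈ Y, Commute (u ^ p) y := by
    have hmul : ∀ u ∈ P, ∀ v ∈ P, (∀ y ∈ Y, Commute (u ^ p) y) → (∀ y ∈ Y, Commute (v ^ p) y) →
        ∀ y ∈ Y, Commute ((u * v) ^ p) y := by
      intro u hu v hv hup hvp y hy
      have key : ∀ w : Y, (∀ y ∈ Y, Commute (w : G) y) ↔ (w : Y ⧸ center Y) = 1 := by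
        intro w
        rw [QuotientGroup.eq_one_iff, mem_center_iff]
        constructor
        · intro h z
          exact Subtype.ext (h z z.2).symm.eq
        · intro h z hz
          exact (congrArg Subtype.val (h ⟨z, hz⟩)).symm
      have h1 := (key (⟨u, hPY hu⟩ ^ p)).1 hup
      have h2 := (key (⟨v, hPY hv⟩ ^ p)).1 hvp
      have h3 := (key (⟨u, hPY hu⟩ * ⟨v, hPY hv⟩ * ⟨u, hPY hu⟩⁻¹ * ⟨v, hPY hv⟩⁻¹)).1
        (hcomm u hu v hv)
      refine (key ((⟨u, hPY hu⟩ * ⟨v, hPY hv⟩) ^ p)).2 ?_ y hy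
      simp only [QuotientGroup.mk_pow, QuotientGroup.mk_mul, QuotientGroup.mk_inv] at h1 h2 h3 ⊢
      rw [mul_inv_eq_one, mul_inv_eq_iff_eq_mul] at h3
      rw [Commute.mul_pow h3, h1, h2, one_mul]
    have hone : ∀ y ∈ Y, Commute ((1 : G) ^ p) y := fun y _ => by
      rw [one_pow]; exact Commute.one_left y
    let T : Subgroup G :=
      { carrier := {u | u ∈ P ∧ ∀ y ∈ Y, Commute (u ^ p) y}
        mul_mem' := fun {a b} ha hb => ⟨P.mul_mem ha.1 hb.1, hmul a ha.1 b hb.1 ha.2 hb.2⟩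
        one_mem' := ⟨P.one_mem, hone⟩
        inv_mem' := fun {a} ha => ⟨P.inv_mem ha.1, fun y hy => by
          rw [inv_pow]; exact (ha.2 y hy).inv_left⟩ }
    rcases hinv T (fun t ht => ht.1) (fun t ht => ⟨hnorm x hxY t ht.1, fun y hy => by
      rw [conj_pow, ((ht.2 x hxY).symm).eq, mul_inv_cancel_right]
      exact ht.2 y hy⟩) with h | h
    · intro u hu
      rw [← h] at hu
      exact hu.2
    · exfalso
      -- the least power of `u₀` that is central
      have hex : ∃ j, ∀ y ∈ Y, Commute (u₀ ^ p ^ j) y := by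
        obtain ⟨j, hj⟩ := hPelt u₀ hu₀
        exact ⟨j, fun y _ => by rw [hj]; exact Commute.one_left y⟩
      classical
      have h1 := Nat.find_spec hex
      have h2 := fun m => Nat.find_min hex (m := m)
      rcases hj : Nat.find hex with _ | j
      · rw [hj, pow_zero, pow_one] at h1
        exact hxu₀ (h1 x hxY).symm
      · rw [hj] at h1 h2
        refine h2 j (Nat.lt_succ_self j) (h _ ⟨P.pow_mem hu₀ _, ?_⟩)
        rwa [← pow_mul, ← pow_succ]
  refine ⟨p, q, P, x, hp, hq, hpq, hPY, hxY, hnorm, hPp, hgenY, hxk, ?_, ⟨u₀, hu₀, hxu₀⟩, hinv, hpow,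
    hcomm⟩
  have hx1 : x ≠ 1 := fun h => hxu₀ (h ▸ Commute.one_left _)
  have hqx : q ∣ orderOf x := by
    obtain ⟨k, hk⟩ := hxk
    obtain ⟨j, -, hj⟩ := (Nat.dvd_prime_pow hq).1 (orderOf_dvd_of_pow_eq_one hk)
    rcases j with _ | j
    · exact absurd (orderOf_eq_one_iff.1 (by simpa using hj)) hx1
    · rw [hj]
      exact dvd_pow_self q (Nat.succ_ne_zero j)
  refine hcent _ ?_ ((Commute.refl x).pow_left q)
  by_contra hcon
  push Not at hcon
  obtain ⟨k, hk⟩ := hxk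
  have h1 : orderOf (x ^ q) < orderOf x := by
    rw [orderOf_pow_of_dvd hq.ne_zero hqx]
    exact Nat.div_lt_self (orderOf_pos x) hq.one_lt
  refine h1.not_ge (hmin ⟨hp, hq, hpq, hPY, hnorm, hPp, Y.pow_mem hxY q, ⟨k, ?_⟩, hcon⟩ h1.le)
  rw [← pow_mul, mul_comm, pow_mul, hk, one_pow]

end ParaNil

namespace ParaNil

open Subgroup

variable {G : Type*} [Group G]

theorem eq_one_of_pow_coprime {a : G} {m n : ℕ} (h : m.Coprime n) (hm : a ^ m = 1)
    (hn : a ^ n = 1) : a = 1 :=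
  orderOf_eq_one_iff.1 (Nat.eq_one_of_dvd_coprimes h
    (orderOf_dvd_of_pow_eq_one hm) (orderOf_dvd_of_pow_eq_one hn))

theorem _root_.IsPGroup.exists_pow_eq_one {p : ℕ} {P : Subgroup G} (hP : IsPGroup p P) {u : G}
    (hu : u ∈ P) : ∃ j, u ^ p ^ j = 1 := by
  obtain ⟨j, hj⟩ := hP ⟨u, hu⟩
  exact ⟨j, by simpa [Subtype.ext_iff] using hj⟩

theorem exists_orderOf_pow_eq_prime {p : ℕ} [Fact p.Prime] {u : G} (hu : u ≠ 1)
    (h : ∃ j, u ^ p ^ j = 1) : ∃ m : ℕ, orderOf (u ^ m) = p := by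
  obtain ⟨j, hj⟩ := h
  obtain ⟨i, -, hi⟩ := (Nat.dvd_prime_pow Fact.out).1 (orderOf_dvd_of_pow_eq_one hj)
  rcases i with _ | i
  · exact absurd (orderOf_eq_one_iff.1 (by simpa using hi)) hu
  · refine ⟨p ^ i, ?_⟩
    have hp : p.Prime := Fact.out
    rw [orderOf_pow_of_dvd (pow_ne_zero _ hp.ne_zero) (by rw [hi]; exact pow_dvd_pow p i.le_succ), hi,
      Nat.pow_div i.le_succ hp.pos]
    simp

theorem eq_of_card_eq_of_isCyclic [Finite G] {Q T U : Subgroup G} (hQ : IsCyclic Q) (hT : T ≤ Q)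
    (hU : U ≤ Q) (h : Nat.card T = Nat.card U) : T = U := by
  classical
  have := Fintype.ofFinite Q
  have key : ∀ V : Subgroup G, V ≤ Q → Nat.card V = Nat.card T → ∀ a : Q,
      (a : G) ∈ V ↔ a ^ Nat.card T = 1 := by
    intro V hV hc
    have h1 := IsCyclic.card_pow_eq_one_le (α := Q) (n := Nat.card T) Nat.card_pos
    have h2 : (Finset.univ.filter fun a : Q => (a : G) ∈ V) ⊆
        Finset.univ.filter fun a : Q => a ^ Nat.card T = 1 := by
      intro a ha
      simp only [Finset.mem_filter, Finset.mem_univ, true_and] at ha ⊢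
      rw [← hc]
      have h5 : (a : G) ^ Nat.card V = 1 :=
        congrArg Subtype.val (pow_card_eq_one' (x := (⟨a, ha⟩ : V)))
      exact Subtype.ext h5
    have h3 : (Finset.univ.filter fun a : Q => (a : G) ∈ V).card = Nat.card T := by
      rw [← hc, ← Nat.card_congr (subgroupOfEquivOfLe hV).toEquiv, ← Fintype.card_subtype,
        ← Nat.card_eq_fintype_card]
      rfl
    have h4 := Finset.eq_of_subset_of_card_le h2 (by rw [h3]; exact h1)
    intro a
    have := Finset.ext_iff.1 h4 a
    simpa using this
  ext a
  constructor
  · intro ha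
    exact (key U hU h.symm ⟨a, hT ha⟩).2 ((key T hT rfl ⟨a, hT ha⟩).1 ha)
  · intro ha
    exact (key T hT rfl ⟨a, hU ha⟩).2 ((key U hU h.symm ⟨a, hU ha⟩).1 ha)

namespace SchmidtData

variable {Y P : Subgroup G} {p q : ℕ} {x : G}

theorem coprime (h : SchmidtData Y p q P x) : p.Coprime q := (Nat.coprime_primes h.hp h.hq).2 h.hpq

theorem pow_form (h : SchmidtData Y p q P x) {u : G} (hu : u ∈ P) (k : ℤ) (n : ℕ) :
    ∃ v ∈ P, (u * x ^ k) ^ n = v * x ^ (k * n) := by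
  induction n with
  | zero => exact ⟨1, P.one_mem, by simp⟩
  | succ n ih =>
    obtain ⟨v, hv, hvn⟩ := ih
    refine ⟨v * (x ^ (k * n) * u * (x ^ (k * n))⁻¹),
      P.mul_mem hv (h.normal _ (Y.zpow_mem h.mem _) _ hu), ?_⟩
    rw [pow_succ, hvn, Nat.cast_succ, mul_add, mul_one, zpow_add]
    group

theorem exists_pow_mem (h : SchmidtData Y p q P x) : ∃ k, ∀ y ∈ Y, y ^ q ^ k ∈ P := by
  obtain ⟨k, hk⟩ := h.pow
  refine ⟨k, fun y hy => ?_⟩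
  obtain ⟨u, hu, m, rfl⟩ := h.gen y hy
  obtain ⟨v, hv, hvn⟩ := h.pow_form hu m (q ^ k)
  rwa [hvn, mul_comm, zpow_mul, zpow_natCast, hk, one_zpow, mul_one]

theorem mem_of_pow (h : SchmidtData Y p q P x) {y : G} (hy : y ∈ Y) {n : ℕ} (hn : y ^ n = 1)
    (hqn : n.Coprime q) : y ∈ P := by
  obtain ⟨k, hk⟩ := h.exists_pow_mem
  have h1 := hk y hy
  have hc : (orderOf y).Coprime (q ^ k) :=
    (Nat.Coprime.coprime_dvd_left (orderOf_dvd_of_pow_eq_one hn) hqn).pow_right k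
  obtain ⟨m, hm⟩ := exists_pow_eq_self_of_coprime hc.symm
  rw [← hm]
  exact P.pow_mem h1 m

theorem hasMaxP (h : SchmidtData Y p q P x) : HasMaxP p Y := by
  refine ⟨P, h.isPGroup, h.le, fun R hR hRY u hu => ?_⟩
  obtain ⟨j, hj⟩ := hR.exists_pow_eq_one hu
  exact h.mem_of_pow (hRY hu) hj (h.coprime.pow_left j)

theorem prime_eq (h : SchmidtData Y p q P x) {s : ℕ} (hs : s.Prime) {y : G} (hy : y ∈ Y)
    (hy1 : y ≠ 1) (hys : ∃ j, y ^ s ^ j = 1) : s = p ∨ s = q := by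
  by_contra hcon
  push Not at hcon
  obtain ⟨j, hj⟩ := hys
  have h1 := h.mem_of_pow hy hj (((Nat.coprime_primes hs h.hq).2 hcon.2).pow_left j)
  obtain ⟨i, hi⟩ := h.isPGroup.exists_pow_eq_one h1
  exact hy1 (eq_one_of_pow_coprime (((Nat.coprime_primes hs h.hp).2 hcon.1).pow j i) hj hi)

theorem x_ne_one (h : SchmidtData Y p q P x) : x ≠ 1 := by
  rintro rfl
  obtain ⟨u, -, hu⟩ := h.not_comm
  exact hu (Commute.one_left u)

/-- The quotient of `Y` by `P` is generated by the image of `x`. -/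
theorem isCyclic_of_isPGroup (h : SchmidtData Y p q P x) {T : Subgroup G} (hT : T ≤ Y)
    (hTq : IsPGroup q T) : IsCyclic T := by
  have hn : (P.subgroupOf Y).Normal := by
    rw [normal_subgroupOf_iff h.le]
    exact fun u y hu hy => h.normal y hy u hu
  have hc : IsCyclic (Y ⧸ P.subgroupOf Y) := by
    refine ⟨((⟨x, h.mem⟩ : Y) : Y ⧸ P.subgroupOf Y), fun y => ?_⟩
    induction y using QuotientGroup.induction_on with
    | H y =>
      obtain ⟨u, hu, k, hk⟩ := h.gen y y.2
      refine ⟨k, ?_⟩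
      have : y = ⟨u, h.le hu⟩ * ⟨x, h.mem⟩ ^ k := Subtype.ext (by simpa using hk)
      have h1 : (((⟨u, h.le hu⟩ : Y)) : Y ⧸ P.subgroupOf Y) = 1 :=
        (QuotientGroup.eq_one_iff _).2 (by rwa [mem_subgroupOf])
      rw [this, QuotientGroup.mk_mul, h1, one_mul, QuotientGroup.mk_zpow]
  refine isCyclic_of_injective ((QuotientGroup.mk' (P.subgroupOf Y)).comp (inclusion hT)) ?_
  rw [injective_iff_map_eq_one]
  intro t ht
  have h1 : (t : G) ∈ P := by
    have := (QuotientGroup.eq_one_iff (inclusion hT t)).1 ht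
    rwa [mem_subgroupOf] at this
  obtain ⟨i, hi⟩ := h.isPGroup.exists_pow_eq_one h1
  obtain ⟨j, hj⟩ := hTq.exists_pow_eq_one t.2
  exact Subtype.ext (eq_one_of_pow_coprime (h.coprime.pow i j) hi hj)

end SchmidtData

/-- Running assumptions: a finite perfect simple group whose proper subgroups are nilpotent or
minimal non-nilpotent. -/
structure Setting (S : Type*) [Group S] : Prop where
  finite : Finite S
  simple : IsSimpleGroup S
  perfect : commutator S = ⊤
  proper : ProperNilOrMinimal S

namespace Setting

variable {S : Type*} [Group S]

theorem ne_top_of_isNilpotent (h : Setting S) {H : Subgroup S} (hH : Group.IsNilpotent H) :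
    H ≠ ⊤ := by
  have := h.finite
  have := h.simple
  rintro rfl
  rw [Group.isNilpotent_top] at hH
  refine (Group.IsSolvable.commutator_lt_top_of_nontrivial S).ne h.perfect

theorem normalizer_ne_top (h : Setting S) {D : Subgroup S} (hD : D ≠ ⊥) (hD' : D ≠ ⊤) :
    normalizer (D : Set S) ≠ ⊤ := by
  intro h1
  rw [normalizer_eq_top_iff] at h1
  exact (h.simple.eq_bot_or_eq_top_of_normal D h1).elim hD hD'

theorem nilOrMinimal_normalizer (h : Setting S) {D : Subgroup S} (hD : D ≠ ⊥)
    (hn : Group.IsNilpotent D) : NilOrMinimal (normalizer (D : Set S)) :=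
  h.proper _ (h.normalizer_ne_top hD (h.ne_top_of_isNilpotent hn))

/-- A Sylow subgroup that is not TI is cyclic. -/
theorem of_not_isTI (h : Setting S) {p : ℕ} [Fact p.Prime] (P : Sylow p S)
    (hP : ¬ IsTI (P : Subgroup S)) :
    IsCyclic P ∧ ∃ D : Subgroup S, D ≠ ⊥ ∧ D < P ∧ ¬ HasMaxP p (normalizer (D : Set S)) := by
  have := h.finite
  have hp : p.Prime := Fact.out
  have hPnil := IsPGroup.isNilpotent P.isPGroup'
  obtain ⟨D, hD, hDP, hmax⟩ := exists_not_hasMaxP P hP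
  refine ⟨?_, D, hD, hDP, hmax⟩
  have hDp : IsPGroup p D := P.isPGroup'.to_le hDP.le
  have hN := h.nilOrMinimal_normalizer hD (isNilpotent_of_le hDP.le hPnil)
  have hNm : MinimalNonNilpotent (normalizer (D : Set S)) :=
    hN.resolve_left fun h1 => hmax (hasMaxP_of_isNilpotent p h1)
  obtain ⟨r, s, R, y, hs⟩ := exists_schmidtData hNm
  obtain ⟨⟨d, hd⟩, hd1⟩ := (nontrivial_iff_exists_ne (1 : D)).1 ((nontrivial_iff_ne_bot D).2 hD)
  have hd1 : d ≠ 1 := fun h => hd1 (Subtype.ext h)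
  have hps : p = s := by
    refine (hs.prime_eq hp (le_normalizer hd) hd1 (hDp.exists_pow_eq_one hd)).resolve_left ?_
    rintro rfl
    exact hmax hs.hasMaxP
  subst hps
  set Q : Subgroup S := (P : Subgroup S) ⊓ normalizer (D : Set S) with hQ
  have hQc : IsCyclic Q := hs.isCyclic_of_isPGroup inf_le_right (P.isPGroup'.to_le inf_le_left)
  have hDQ : D ≤ Q := le_inf hDP.le le_normalizer
  -- an element of order `p` in `D`
  obtain ⟨m, hm⟩ := exists_orderOf_pow_eq_prime hd1 (hDp.exists_pow_eq_one hd)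
  set e := d ^ m with he
  have heD : e ∈ D := D.pow_mem hd m
  have hE : ∀ f ∈ Q, orderOf f = p → zpowers f = zpowers e := fun f hf hfp =>
    eq_of_card_eq_of_isCyclic hQc (zpowers_le.2 hf) (zpowers_le.2 (hDQ heD))
      (by rw [Nat.card_zpowers, Nat.card_zpowers, hfp, hm])
  -- it generates a central subgroup of `P`
  have hPE : (P : Subgroup S) ≤ normalizer (zpowers e : Set S) := by
    have : Nontrivial P := (nontrivial_iff_ne_bot (P : Subgroup S)).2
      (fun h => by rw [h] at hDP; exact not_lt_bot hDP)
    obtain ⟨z, hz1⟩ := (nontrivial_iff_exists_ne (1 : center P)).1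
      ((nontrivial_iff_ne_bot _).2 (Group.IsNilpotent.center_ne_bot (G := P)))
    have hz1' : ((z : P) : S) ≠ 1 := fun h => hz1 (Subtype.ext (Subtype.ext h))
    obtain ⟨n, hn⟩ := exists_orderOf_pow_eq_prime hz1' (P.isPGroup'.exists_pow_eq_one (z : P).2)
    have hzc : ∀ u ∈ P, Commute u (((z : P) : S) ^ n) := fun u hu => by
      have := mem_center_iff.1 z.2 ⟨u, hu⟩
      exact Commute.pow_right (congrArg Subtype.val this) n
    have hzQ : (((z : P) : S) ^ n) ∈ Q := by
      refine ⟨pow_mem (z : P).2 n, mem_normalizer_of_conj_mem fun t ht => ?_⟩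
      rwa [← (hzc t (hDP.le ht)).eq, mul_inv_cancel_right]
    rw [← hE _ hzQ hn]
    intro u hu
    refine mem_normalizer_of_conj_mem ?_
    rintro _ ⟨k, rfl⟩
    refine ⟨k, ?_⟩
    have := (hzc u hu).zpow_right k
    simp only
    rw [this.eq, mul_inv_cancel_right]
  have hNE : normalizer (D : Set S) ≤ normalizer (zpowers e : Set S) := by
    intro g hg
    refine mem_normalizer_of_conj_mem ?_
    rintro _ ⟨k, rfl⟩
    have h1 : g * e * g⁻¹ ∈ D := (mem_normalizer_iff.1 hg e).1 heD
    have h2 : orderOf (g * e * g⁻¹) = p := by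
      rw [← hm]
      exact orderOf_injective (MulAut.conj g).toMonoidHom (MulAut.conj g).injective e
    rw [← hE _ (hDQ h1) h2]
    exact ⟨k, conj_zpow⟩
  have hEbot : zpowers e ≠ ⊥ := by
    rw [Ne, zpowers_eq_bot]
    rintro h1
    rw [h1, orderOf_one] at hm
    exact hp.one_lt.ne hm
  have hEnil := h.nilOrMinimal_normalizer hEbot
    (isNilpotent_of_le (zpowers_le.2 (hDP.le heD)) hPnil)
  have hNN := hEnil.eq_of_le hNm hNE
  have hPQ : (P : Subgroup S) ≤ Q := le_inf le_rfl (hNN ▸ hPE)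
  exact isCyclic_of_injective (inclusion hPQ) (inclusion_injective hPQ)

theorem not_isNilpotent_normalizer (h : Setting S) {p : ℕ} [Fact p.Prime] (P : Sylow p S)
    (hP : (P : Subgroup S) ≠ ⊥) : ¬ Group.IsNilpotent (normalizer ((P : Subgroup S) : Set S)) := by
  have := h.finite
  by_cases hTI : IsTI (P : Subgroup S)
  · exact not_isNilpotent_normalizer_of_isTI P h.perfect hP hTI
  intro hN
  have hc := (h.of_not_isTI P hTI).1
  have hle : normalizer ((P : Subgroup S) : Set S) ≤ centralizer ((P : Subgroup S) : Set S) := by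
    intro g hg
    obtain ⟨u, hu, v, hv, rfl, ⟨k, huk⟩, m, hvm, hmp, -⟩ :=
      exists_primary_decomposition g (isOfFinOrder_of_finite g) (Fact.out : p.Prime)
    have hu' := (zpowers_le.2 hg) hu
    have hv' := (zpowers_le.2 hg) hv
    have huP := Sylow.mem_of_normalizer P hu' huk
    refine mul_mem ?_ ?_
    · intro y hy
      have := hc.isMulCommutative.1.1 (⟨y, hy⟩ : P) ⟨u, huP⟩
      exact congrArg Subtype.val this
    · intro y hy
      obtain ⟨j, hj⟩ := P.isPGroup'.exists_pow_eq_one hy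
      exact (commute_of_coprime hN hv' (le_normalizer hy) hvm hj (hmp.pow_right j)).eq.symm
  have hcompl := MonoidHom.ker_transferSylow_isComplement' P hle
  rcases h.simple.eq_bot_or_eq_top_of_normal _ (MonoidHom.normal_ker (MonoidHom.transferSylow P hle))
    with h1 | h1
  · rw [h1] at hcompl
    exact h.ne_top_of_isNilpotent (IsPGroup.isNilpotent P.isPGroup') (isComplement'_bot_left.1 hcompl)
  · rw [h1] at hcompl
    exact hP (isComplement'_top_left.1 hcompl)

theorem schmidtData_normalizer (h : Setting S) {p : ℕ} [Fact p.Prime] (P : Sylow p S)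
    (hP : (P : Subgroup S) ≠ ⊥) :
    ∃ q x, SchmidtData (normalizer ((P : Subgroup S) : Set S)) p q P x := by
  have := h.finite
  have hp : p.Prime := Fact.out
  have hN := (h.nilOrMinimal_normalizer hP (IsPGroup.isNilpotent P.isPGroup')).resolve_left
    (h.not_isNilpotent_normalizer P hP)
  obtain ⟨r, s, R, x, hs⟩ := exists_schmidtData hN
  obtain ⟨⟨d, hd⟩, hd1⟩ := (nontrivial_iff_exists_ne (1 : P)).1
    ((nontrivial_iff_ne_bot (P : Subgroup S)).2 hP)
  have hd1 : d ≠ 1 := fun h => hd1 (Subtype.ext h)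
  rcases hs.prime_eq hp (le_normalizer hd) hd1 (P.isPGroup'.exists_pow_eq_one hd) with rfl | rfl
  · have hRP : R = P := by
      refine le_antisymm (fun u hu => ?_) (fun u hu => ?_)
      · obtain ⟨j, hj⟩ := hs.isPGroup.exists_pow_eq_one hu
        exact Sylow.mem_of_normalizer P (hs.le hu) hj
      · obtain ⟨j, hj⟩ := P.isPGroup'.exists_pow_eq_one hu
        exact hs.mem_of_pow (le_normalizer hu) hj (hs.coprime.pow_left j)
    exact ⟨s, x, hRP ▸ hs⟩
  · exfalso
    obtain ⟨k, hk⟩ := hs.pow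
    have hxP := Sylow.mem_of_normalizer P hs.mem hk
    obtain ⟨u, hu, hxu⟩ := hs.not_comm
    have h1 : x * u * x⁻¹ * u⁻¹ ∈ R := R.mul_mem (hs.normal x hs.mem u hu) (R.inv_mem hu)
    have h2 : x * u * x⁻¹ * u⁻¹ ∈ P := by
      have := P.mul_mem hxP ((mem_normalizer_iff.1 (hs.le hu) x⁻¹).1 (P.inv_mem hxP))
      simpa [mul_assoc] using! this
    obtain ⟨i, hi⟩ := hs.isPGroup.exists_pow_eq_one h1
    obtain ⟨j, hj⟩ := P.isPGroup'.exists_pow_eq_one h2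
    have h3 := eq_one_of_pow_coprime (hs.coprime.pow i j) hi hj
    rw [mul_inv_eq_one, mul_inv_eq_iff_eq_mul] at h3
    exact hxu h3

theorem isTI (h : Setting S) {p : ℕ} [Fact p.Prime] (P : Sylow p S) : IsTI (P : Subgroup S) := by
  have := h.finite
  by_contra hTI
  obtain ⟨hc, D, hD, hDP, hmax⟩ := h.of_not_isTI P hTI
  have hP : (P : Subgroup S) ≠ ⊥ := fun h => by rw [h] at hDP; exact not_lt_bot hDP
  obtain ⟨q, x, hs⟩ := h.schmidtData_normalizer P hP
  have hxN : x ∈ normalizer (D : Set S) := by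
    have h1 : D.map (MulAut.conj x).toMonoidHom = D := by
      refine eq_of_card_eq_of_isCyclic hc ?_ hDP.le (card_map_of_injective (MulAut.conj x).injective)
      rintro _ ⟨t, ht, rfl⟩
      exact hs.normal x hs.mem t (hDP.le ht)
    refine mem_normalizer_of_conj_mem fun t ht => ?_
    rw [← h1]
    exact ⟨t, ht, rfl⟩
  have hcent := (hs.invariant D hDP.le fun t ht => (mem_normalizer_iff.1 hxN t).1 ht).resolve_left
    hDP.ne
  have hle : normalizer ((P : Subgroup S) : Set S) ≤ normalizer (D : Set S) := fun y hy =>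
    mem_normalizer_of_conj_mem fun t ht => by
      rwa [← (hcent t ht y hy).eq, mul_inv_cancel_right]
  have hPnil := IsPGroup.isNilpotent P.isPGroup'
  have hN := (h.nilOrMinimal_normalizer hP hPnil).resolve_left (h.not_isNilpotent_normalizer P hP)
  have heq := (h.nilOrMinimal_normalizer hD (isNilpotent_of_le hDP.le hPnil)).eq_of_le hN hle
  exact hmax (heq ▸ hs.hasMaxP)

end Setting

end ParaNil

namespace ParaNil

open Subgroup

variable {G : Type*} [Group G]

/-- The set of conjugates of the elements of `T`. -/
def conjSet (T : Set G) : Set G := {s | ∃ g, ∃ t ∈ T, s = g * t * g⁻¹}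

theorem card_conjSet [Finite G] {T : Set G} {M : Subgroup G}
    (hT : ∀ t ∈ T, ∀ g, g * t * g⁻¹ ∈ T → g ∈ M) (hM : ∀ g ∈ M, ∀ t ∈ T, g * t * g⁻¹ ∈ T) :
    Nat.card (conjSet T) * Nat.card M = Nat.card T * Nat.card G := by
  have h0 : ∀ s : conjSet T, ∃ g : G, g⁻¹ * s * g ∈ T := by
    rintro ⟨_, g, t, ht, rfl⟩
    exact ⟨g, by simpa [mul_assoc] using ht⟩
  choose c hc using h0
  have hmem : ∀ g : G, ∀ t : T, (c ⟨g * t * g⁻¹, g, t, t.2, rfl⟩)⁻¹ * g ∈ M := by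
    intro g t
    refine hT t t.2 _ ?_
    have := hc ⟨g * t * g⁻¹, g, t, t.2, rfl⟩
    simpa [mul_assoc] using this
  let e : T × G ≃ conjSet T × M :=
    { toFun := fun x => (⟨x.2 * x.1 * x.2⁻¹, x.2, x.1, x.1.2, rfl⟩, ⟨_, hmem x.2 x.1⟩)
      invFun := fun y => (⟨(y.2 : G)⁻¹ * ((c y.1)⁻¹ * y.1 * c y.1) * ((y.2 : G)⁻¹)⁻¹,
        hM _ (M.inv_mem y.2.2) _ (hc y.1)⟩, c y.1 * y.2)
      left_inv := fun x => by
        ext <;> simp [mul_assoc]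
      right_inv := fun y => by
        have h : c y.1 * ↑y.2 * ((y.2 : G)⁻¹ * ((c y.1)⁻¹ * y.1 * c y.1) * ((y.2 : G)⁻¹)⁻¹) *
            (c y.1 * y.2)⁻¹ = y.1 := by group
        refine Prod.ext (Subtype.ext h) (Subtype.ext ?_)
        simp only [h, Subtype.coe_eta]
        group }
  rw [← Nat.card_prod, ← Nat.card_prod, Nat.card_congr e]

/-- The nontrivial elements of a subgroup. -/
abbrev sharp (P : Subgroup G) : Set G := {u | u ∈ P ∧ u ≠ 1}

theorem card_sharp [Finite G] (P : Subgroup G) : Nat.card (sharp P) + 1 = Nat.card P := by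
  classical
  have : (sharp P) = (P : Set G) \ {1} := rfl
  rw [this, Nat.card_coe_set_eq, Set.ncard_sdiff_singleton_add_one P.one_mem]
  exact (Nat.card_coe_set_eq (P : Set G)).symm

theorem IsTI.card_conjSet_sharp [Finite G] {P : Subgroup G} (hP : IsTI P) :
    Nat.card (conjSet (sharp P)) * Nat.card (normalizer (P : Set G)) =
      Nat.card (sharp P) * Nat.card G := by
  refine card_conjSet (fun t ht g hg => hP g t ht.1 ht.2 hg.1) fun g hg t ht => ?_
  refine ⟨(mem_normalizer_iff.1 hg t).1 ht.1, fun h => ht.2 ?_⟩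
  rwa [mul_inv_eq_one, mul_eq_left] at h

namespace SchmidtData

variable {Y P : Subgroup G} {p q : ℕ} {x : G}

theorem pow_mem (h : SchmidtData Y p q P x) (hx : x ^ q = 1) {y : G} (hy : y ∈ Y) :
    y ^ q ∈ P := by
  obtain ⟨u, hu, m, rfl⟩ := h.gen y hy
  obtain ⟨v, hv, hvn⟩ := h.pow_form hu m q
  rwa [hvn, mul_comm, zpow_mul, zpow_natCast, hx, one_zpow, mul_one]

theorem eq_one_of_mem (h : SchmidtData Y p q P x) {y : G} (hy : y ∈ P) {n : ℕ}
    (hyn : y ^ n = 1) (hn : p.Coprime n) : y = 1 := by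
  obtain ⟨i, hi⟩ := h.isPGroup.exists_pow_eq_one hy
  exact eq_one_of_pow_coprime (hn.pow_left i) hi hyn

theorem card_eq (h : SchmidtData Y p q P x) (hx : x ^ q = 1) : Nat.card Y = Nat.card P * q := by
  have ho : orderOf x = q := by
    have := Fact.mk h.hq
    exact orderOf_eq_prime hx h.x_ne_one
  have hmem : ∀ k : zpowers x, (k : G) ∈ Y := fun k => zpowers_le.2 h.mem k.2
  let f : P × zpowers x → Y := fun a => ⟨a.1 * a.2, mul_mem (h.le a.1.2) (hmem a.2)⟩
  have hf : Function.Bijective f := by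
    constructor
    · rintro ⟨a, b⟩ ⟨c, d⟩ he
      have h1 : (a : G) * b = c * d := congrArg Subtype.val he
      have h2 : (c : G)⁻¹ * a = d * (b : G)⁻¹ := by
        rw [inv_mul_eq_iff_eq_mul, ← mul_assoc, ← h1, mul_inv_cancel_right]
      have h3 : (c : G)⁻¹ * a = 1 := by
        refine h.eq_one_of_mem (P.mul_mem (P.inv_mem c.2) a.2) (n := q) ?_ h.coprime
        rw [h2]
        obtain ⟨m, hm⟩ := (zpowers x).mul_mem d.2 ((zpowers x).inv_mem b.2)
        have hm : x ^ m = d * (b : G)⁻¹ := hm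
        rw [← hm, ← zpow_natCast, ← zpow_mul, mul_comm, zpow_mul, zpow_natCast, hx, one_zpow]
      have h4 := h2.symm.trans h3
      exact Prod.ext (Subtype.ext (inv_mul_eq_one.1 h3).symm) (Subtype.ext (mul_inv_eq_one.1 h4).symm)
    · rintro ⟨y, hy⟩
      obtain ⟨u, hu, k, rfl⟩ := h.gen y hy
      exact ⟨(⟨u, hu⟩, ⟨x ^ k, k, rfl⟩), rfl⟩
  rw [← Nat.card_congr (Equiv.ofBijective f hf), Nat.card_prod, Nat.card_zpowers, ho]

end SchmidtData

theorem exists_sylow_mem {p k : ℕ} [Fact p.Prime] {u : G} (hu : u ^ p ^ k = 1) :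
    ∃ P : Sylow p G, u ∈ P := by
  have h1 : IsPGroup p (zpowers u) := IsPGroup.of_card_dvd_pow (n := k)
    (by rw [Nat.card_zpowers]; exact orderOf_dvd_of_pow_eq_one hu)
  obtain ⟨P, hP⟩ := h1.exists_le_sylow
  exact ⟨P, zpowers_le.1 hP⟩

namespace Setting

variable {S : Type*} [Group S]

theorem pow_eq_one (h : Setting S) {p q : ℕ} [Fact p.Prime] {P : Sylow p S} {x : S}
    (hs : SchmidtData (normalizer ((P : Subgroup S) : Set S)) p q P x) : x ^ q = 1 := by
  have := h.finite
  have := Fact.mk hs.hq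
  by_contra hx
  obtain ⟨k, hk⟩ := hs.pow
  obtain ⟨R, hxR⟩ := exists_sylow_mem hk
  have hR : (R : Subgroup S) ≠ ⊥ := fun hb => hs.x_ne_one (by
    have : x ∈ (R : Subgroup S) := hxR
    rwa [hb, mem_bot] at this)
  have hle : normalizer ((P : Subgroup S) : Set S) ≤ normalizer ((R : Subgroup S) : Set S) := by
    intro g hg
    have hxq : x ^ q ∈ R := pow_mem hxR q
    refine h.isTI R g (x ^ q) hxq hx ?_
    rwa [← (hs.central g hg).eq, mul_inv_cancel_right]
  have hP : (P : Subgroup S) ≠ ⊥ := by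
    rintro hb
    obtain ⟨u, hu, hxu⟩ := hs.not_comm
    rw [hb, mem_bot] at hu
    exact hxu (hu ▸ Commute.one_right x)
  obtain ⟨u, hu, hxu⟩ := hs.not_comm
  have huR := hle (hs.le hu)
  have h1 : x * u * x⁻¹ * u⁻¹ ∈ (P : Subgroup S) :=
    mul_mem (hs.normal x hs.mem u hu) (inv_mem hu)
  have h2 : x * u * x⁻¹ * u⁻¹ ∈ R := by
    have := R.mul_mem hxR ((mem_normalizer_iff.1 huR x⁻¹).1 (R.inv_mem hxR))
    simpa [mul_assoc] using! this
  obtain ⟨j, hj⟩ := R.isPGroup'.exists_pow_eq_one h2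
  have h3 := hs.eq_one_of_mem h1 hj (hs.coprime.pow_right j)
  rw [mul_inv_eq_one, mul_inv_eq_iff_eq_mul] at h3
  exact hxu h3

end Setting

end ParaNil

namespace ParaNil

open Subgroup

variable {G : Type*} [Group G]

theorem exists_pow_mul_eq {a b : G} {p q : ℕ} (hpq : p.Coprime q) (hab : Commute a b)
    (ha : a ^ p = 1) (hb : b ^ q = 1) : ∃ n : ℕ, (a * b) ^ n = a ∧ ∀ c d : G, Commute c d →
      c ^ p = 1 → d ^ q = 1 → (c * d) ^ n = c := by
  obtain ⟨n, hn1, hn2⟩ := Nat.chineseRemainder hpq 1 0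
  have key : ∀ c d : G, Commute c d → c ^ p = 1 → d ^ q = 1 → (c * d) ^ n = c := by
    intro c d hcd hc hd
    rw [hcd.mul_pow]
    have h1 : c ^ n = c ^ 1 := pow_eq_pow_iff_modEq.2
      (hn1.of_dvd (orderOf_dvd_of_pow_eq_one hc))
    have h2 : d ^ n = d ^ 0 := pow_eq_pow_iff_modEq.2
      (hn2.of_dvd (orderOf_dvd_of_pow_eq_one hd))
    rw [h1, h2, pow_one, pow_zero, mul_one]
  exact ⟨n, key a b hab ha hb, key⟩

theorem not_card_add_lt {a b p q g n u v w : ℕ} (hp : 2 ≤ p) (hq : 2 ≤ q)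
    (ha : p * p ≤ a + 1) (hb : q * q ≤ b + 1) (hn : n ≤ p * q) (hg : 0 < g)
    (hu : u * ((a + 1) * q) = a * g) (hv : v * ((b + 1) * p) = b * g)
    (hw : w * n = (p - 1) * (q - 1) * g) : ¬ u + v + w < g := by
  intro hsum
  have hw' : ((p : ℚ) - 1) * (q - 1) * g ≤ w * (p * q) := by
    have : (p - 1) * (q - 1) * g ≤ w * (p * q) := hw ▸ Nat.mul_le_mul_left _ hn
    have := (Nat.cast_le (α := ℚ)).2 this
    push_cast [Nat.cast_sub (show 1 ≤ p by omega), Nat.cast_sub (show 1 ≤ q by omega)] at this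
    exact this
  have hu' : (u : ℚ) * ((a + 1) * q) = a * g := by exact_mod_cast hu
  have hv' : (v : ℚ) * ((b + 1) * p) = b * g := by exact_mod_cast hv
  have hsum' : (u : ℚ) + v + w < g := by exact_mod_cast hsum
  have hp' : (2 : ℚ) ≤ p := by exact_mod_cast hp
  have hq' : (2 : ℚ) ≤ q := by exact_mod_cast hq
  have ha' : (p : ℚ) * p ≤ a + 1 := by exact_mod_cast ha
  have hb' : (q : ℚ) * q ≤ b + 1 := by exact_mod_cast hb
  have hg' : (0 : ℚ) < g := by exact_mod_cast hg
  have ha0 : (0 : ℚ) < a + 1 := by positivity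
  have hb0 : (0 : ℚ) < b + 1 := by positivity
  have h1 : (u : ℚ) = (1 - 1 / (a + 1)) * (1 / q) * g := by
    field_simp
    linarith
  have h2 : (v : ℚ) = (1 - 1 / (b + 1)) * (1 / p) * g := by
    field_simp
    linarith
  have h3 : (1 - 1 / p) * (1 - 1 / q) * g ≤ (w : ℚ) := by
    have : (1 - 1 / p) * (1 - 1 / q) * g = ((p : ℚ) - 1) * (q - 1) * g / (p * q) := by
      field_simp
    rw [this, div_le_iff₀ (by positivity)]
    exact hw'
  have h4 : 1 / ((a : ℚ) + 1) ≤ (1 / p) * (1 / p) := by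
    rw [one_div_mul_one_div]
    exact one_div_le_one_div_of_le (by positivity) ha'
  have h5 : 1 / ((b : ℚ) + 1) ≤ (1 / q) * (1 / q) := by
    rw [one_div_mul_one_div]
    exact one_div_le_one_div_of_le (by positivity) hb'
  have h6 : (1 : ℚ) / p ≤ 1 / 2 := one_div_le_one_div_of_le (by norm_num) hp'
  have h7 : (1 : ℚ) / q ≤ 1 / 2 := one_div_le_one_div_of_le (by norm_num) hq'
  have h8 : (0 : ℚ) < 1 / p := by positivity
  have h9 : (0 : ℚ) < 1 / q := by positivity
  generalize (1 : ℚ) / p = x at *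
  generalize (1 : ℚ) / q = y at *
  generalize 1 / ((a : ℚ) + 1) = α at *
  generalize 1 / ((b : ℚ) + 1) = β at *
  have h10 : ((1 - α) * y + (1 - β) * x + (1 - x) * (1 - y)) * g < 1 * g := by linarith
  have h11 := lt_of_mul_lt_mul_right h10 hg'.le
  have h12 : α * y ≤ x * x * y := mul_le_mul_of_nonneg_right h4 h9.le
  have h13 : β * x ≤ y * y * x := mul_le_mul_of_nonneg_right h5 h8.le
  have h14 : 0 ≤ x * y * (1 - x - y) := mul_nonneg (by positivity) (by linarith)
  linarith

namespace Setting

variable {S : Type*} [Group S]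

theorem eq_one_of_commute (h : Setting S) {p q : ℕ} [Fact p.Prime] {P : Sylow p S} {x : S}
    (hs : SchmidtData (normalizer ((P : Subgroup S) : Set S)) p q P x) {c : S}
    (hc : c ∈ P) (hcx : Commute c x) : c = 1 := by
  have := h.finite
  have := Fact.mk hs.hq
  by_contra hc1
  have hx := h.pow_eq_one hs
  obtain ⟨R, hxR⟩ := exists_sylow_mem (p := q) (k := 1) (by rwa [pow_one])
  have hxR' : x ∈ (R : Subgroup S) := hxR
  have hR : (R : Subgroup S) ≠ ⊥ := fun hb => hs.x_ne_one (by rwa [hb, mem_bot] at hxR')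
  have hTIR := h.isTI R
  have hTIP := h.isTI P
  have hcR : c ∈ normalizer ((R : Subgroup S) : Set S) := by
    refine hTIR c x hxR' hs.x_ne_one ?_
    rwa [hcx.eq, mul_inv_cancel_right]
  obtain ⟨s, y, hr⟩ := h.schmidtData_normalizer R hR
  have hps : p = s := (hr.prime_eq hs.hp hcR hc1 (P.isPGroup'.exists_pow_eq_one hc)).resolve_left
    hs.hpq
  subst hps
  have hy := h.pow_eq_one hr
  have hPR : ∀ u ∈ (P : Subgroup S), u ∈ (R : Subgroup S) → u = 1 := by
    intro u hu hu'
    obtain ⟨i, hi⟩ := R.isPGroup'.exists_pow_eq_one hu'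
    exact hs.eq_one_of_mem hu hi (hs.coprime.pow_right i)
  have hpow : ∀ u ∈ (P : Subgroup S), u ∈ normalizer ((R : Subgroup S) : Set S) → u ^ p = 1 :=
    fun u hu hu' => hPR _ (pow_mem hu p) (hr.pow_mem hy hu')
  have hcp := hpow c hc hcR
  have hoc : orderOf c = p := orderOf_eq_prime hcp hc1
  have hox : orderOf x = q := orderOf_eq_prime hx hs.x_ne_one
  -- the intersection of the two normalizers
  set M := normalizer ((P : Subgroup S) : Set S) ⊓ normalizer ((R : Subgroup S) : Set S) with hM
  have hcyc : ∀ u ∈ (P : Subgroup S), u ∈ normalizer ((R : Subgroup S) : Set S) →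
      u ∈ zpowers c := by
    intro u hu hu'
    by_cases hu1 : u = 1
    · rw [hu1]; exact one_mem _
    have h1 : IsCyclic ((P : Subgroup S) ⊓ normalizer ((R : Subgroup S) : Set S) : Subgroup S) :=
      hr.isCyclic_of_isPGroup inf_le_right (P.isPGroup'.to_le inf_le_left)
    have := eq_of_card_eq_of_isCyclic h1 (zpowers_le.2 (mem_inf.2 ⟨hu, hu'⟩))
      (zpowers_le.2 (mem_inf.2 ⟨hc, hcR⟩))
      (by rw [Nat.card_zpowers, Nat.card_zpowers, hoc, orderOf_eq_prime (hpow u hu hu') hu1])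
    rw [← this]
    exact mem_zpowers u
  have hMform : ∀ m ∈ M, ∃ i j : ℤ, m = c ^ i * x ^ j := by
    intro m hm
    obtain ⟨u, hu, k, rfl⟩ := hs.gen m hm.1
    have hu' : u ∈ normalizer ((R : Subgroup S) : Set S) := by
      have h1 := mul_mem (mem_inf.1 hm).2 (inv_mem (zpow_mem (le_normalizer hxR') k))
      rwa [mul_inv_cancel_right] at h1
    obtain ⟨i, rfl⟩ := hcyc u hu hu'
    exact ⟨i, k, rfl⟩
  have hMcard : Nat.card M ≤ p * q := by
    have hmem : ∀ a : zpowers c × zpowers x, (a.1 : S) * a.2 ∈ M := fun a =>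
      mul_mem (mem_inf.2 ⟨le_normalizer (zpowers_le.2 hc a.1.2), zpowers_le.2 hcR a.1.2⟩)
        (mem_inf.2 ⟨zpowers_le.2 hs.mem a.2.2, le_normalizer (zpowers_le.2 hxR' a.2.2)⟩)
    have := Nat.card_le_card_of_surjective
      (fun a : zpowers c × zpowers x => (⟨a.1 * a.2, hmem a⟩ : M)) (by
        rintro ⟨m, hm⟩
        obtain ⟨i, j, rfl⟩ := hMform m hm
        exact ⟨(⟨_, i, rfl⟩, ⟨_, j, rfl⟩), rfl⟩)
    rwa [Nat.card_prod, Nat.card_zpowers, Nat.card_zpowers, hoc, hox] at this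
  -- the set of elements of order `p * q` in it
  set T : Set S := {t | ∃ a ∈ sharp (zpowers c), ∃ b ∈ sharp (zpowers x), t = a * b} with hT
  have hcx' : ∀ a ∈ zpowers c, ∀ b ∈ zpowers x, Commute a b := by
    rintro _ ⟨i, rfl⟩ _ ⟨j, rfl⟩
    exact (hcx.zpow_left i).zpow_right j
  have hap : ∀ a ∈ zpowers c, a ^ p = 1 := by
    rintro _ ⟨i, rfl⟩
    simp only
    rw [← zpow_natCast, ← zpow_mul, mul_comm, zpow_mul, zpow_natCast, hcp, one_zpow]
  have hbq : ∀ b ∈ zpowers x, b ^ q = 1 := by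
    rintro _ ⟨i, rfl⟩
    simp only
    rw [← zpow_natCast, ← zpow_mul, mul_comm, zpow_mul, zpow_natCast, hx, one_zpow]
  have hconjpow : ∀ (g t : S) (n : ℕ), (g * t * g⁻¹) ^ n = g * t ^ n * g⁻¹ := fun g t n =>
    conj_pow
  have hTM : ∀ t ∈ T, ∀ g, g * t * g⁻¹ ∈ T → g ∈ M := by
    rintro t ⟨a, ha, b, hb, rfl⟩ g ⟨a', ha', b', hb', hg⟩
    obtain ⟨n, hn, hn'⟩ := exists_pow_mul_eq hs.coprime (hcx' a ha.1 b hb.1) (hap a ha.1)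
      (hbq b hb.1)
    obtain ⟨m, hm, hm'⟩ := exists_pow_mul_eq hs.coprime.symm (hcx' a ha.1 b hb.1).symm
      (hbq b hb.1) (hap a ha.1)
    have h1 := hconjpow g (a * b) n
    rw [hn, hg, hn' a' b' (hcx' a' ha'.1 b' hb'.1) (hap a' ha'.1) (hbq b' hb'.1)] at h1
    have h2 := hconjpow g (a * b) m
    rw [hg, (hcx' a ha.1 b hb.1).eq, (hcx' a' ha'.1 b' hb'.1).eq, hm,
      hm' b' a' (hcx' a' ha'.1 b' hb'.1).symm (hbq b' hb'.1) (hap a' ha'.1)] at h2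
    refine mem_inf.2 ⟨hTIP g a (zpowers_le.2 hc ha.1) ha.2 ?_,
      hTIR g b (zpowers_le.2 hxR' hb.1) hb.2 ?_⟩
    · rw [← h1]; exact zpowers_le.2 hc ha'.1
    · rw [← h2]; exact zpowers_le.2 hxR' hb'.1
  have hMT : ∀ g ∈ M, ∀ t ∈ T, g * t * g⁻¹ ∈ T := by
    rintro g hg t ⟨a, ha, b, hb, rfl⟩
    obtain ⟨i, j, rfl⟩ := hMform g hg
    obtain ⟨k, rfl⟩ := ha.1
    obtain ⟨l, rfl⟩ := hb.1
    have h1 : Commute (c ^ i * x ^ j) (c ^ k * x ^ l) := by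
      have e1 : ∀ m n : ℤ, Commute (c ^ m) (x ^ n) := fun m n => (hcx.zpow_left m).zpow_right n
      refine Commute.mul_left (Commute.mul_right ?_ (e1 _ _)) (Commute.mul_right (e1 _ _).symm ?_)
      · exact (Commute.refl c).zpow_zpow _ _
      · exact (Commute.refl x).zpow_zpow _ _
    simp only at h1 ⊢
    rw [h1.eq, mul_inv_cancel_right]
    exact ⟨_, ha, _, hb, rfl⟩
  have hTcard : Nat.card T = (p - 1) * (q - 1) := by
    have h1 : Nat.card (sharp (zpowers c)) = p - 1 := by
      have := card_sharp (zpowers c)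
      rw [Nat.card_zpowers, hoc] at this
      omega
    have h2 : Nat.card (sharp (zpowers x)) = q - 1 := by
      have := card_sharp (zpowers x)
      rw [Nat.card_zpowers, hox] at this
      omega
    rw [← h1, ← h2, ← Nat.card_prod]
    symm
    refine Nat.card_congr (Equiv.ofBijective
      (fun a => (⟨a.1 * a.2, a.1, a.1.2, a.2, a.2.2, rfl⟩ : T)) ⟨?_, ?_⟩)
    · rintro ⟨⟨a, ha⟩, b, hb⟩ ⟨⟨a', ha'⟩, b', hb'⟩ he
      have he : a * b = a' * b' := congrArg Subtype.val he
      obtain ⟨n, hn, hn'⟩ := exists_pow_mul_eq hs.coprime (hcx' a ha.1 b hb.1) (hap a ha.1)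
        (hbq b hb.1)
      rw [he, hn' a' b' (hcx' a' ha'.1 b' hb'.1) (hap a' ha'.1) (hbq b' hb'.1)] at hn
      subst hn
      have := mul_left_cancel he
      subst this
      rfl
    · rintro ⟨_, a, ha, b, hb, rfl⟩
      exact ⟨(⟨a, ha⟩, ⟨b, hb⟩), rfl⟩
  -- the counts
  have hu := hTIP.card_conjSet_sharp
  have hv := hTIR.card_conjSet_sharp
  have hw := card_conjSet hTM hMT
  rw [hs.card_eq hx, ← card_sharp] at hu
  rw [hr.card_eq hy, ← card_sharp] at hv
  rw [hTcard] at hw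
  have hsq : ∀ {r : ℕ} [Fact r.Prime] (Q : Sylow r S) (d : S), d ∈ Q → orderOf d = r →
      (Q : Subgroup S) ≠ zpowers d → r * r ≤ Nat.card (Q : Subgroup S) := by
    intro r _ Q d hd hdr hne
    have hr : r.Prime := Fact.out
    obtain ⟨n, hn⟩ := IsPGroup.iff_card.1 Q.isPGroup'
    have hlt : Nat.card (zpowers d) < Nat.card (Q : Subgroup S) := by
      refine lt_of_le_of_ne (card_le_of_le (zpowers_le.2 hd)) fun he => hne ?_
      exact (eq_of_le_of_card_ge (zpowers_le.2 hd) he.ge).symm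
    rw [Nat.card_zpowers, hdr, hn] at hlt
    rw [hn, ← pow_two]
    refine Nat.pow_le_pow_right hr.pos ?_
    by_contra hcon
    have := Nat.pow_le_pow_right hr.pos (show n ≤ 1 by omega)
    rw [pow_one] at this
    omega
  have ha : p * p ≤ Nat.card (P : Subgroup S) := by
    refine hsq P c hc hoc fun hP => ?_
    obtain ⟨u, hu, hxu⟩ := hs.not_comm
    rw [hP] at hu
    exact hxu (hcx' u hu x (mem_zpowers x)).symm
  have hb : q * q ≤ Nat.card (R : Subgroup S) := by
    refine hsq R x hxR hox fun hR' => ?_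
    obtain ⟨r, hrR, k, hk⟩ := hr.gen c hcR
    obtain ⟨v, hv, hyv⟩ := hr.not_comm
    have hRc : ∀ w ∈ (R : Subgroup S), Commute c w := fun w hw => by
      rw [hR'] at hw
      exact hcx' c (mem_zpowers c) w hw
    have hRR : ∀ w ∈ (R : Subgroup S), ∀ w' ∈ (R : Subgroup S), Commute w w' := by
      intro w hw w' hw'
      rw [hR'] at hw hw'
      obtain ⟨i, rfl⟩ := hw
      obtain ⟨j, rfl⟩ := hw'
      exact (Commute.refl x).zpow_zpow _ _
    have hyk : y ^ k = r⁻¹ * c := by rw [hk, inv_mul_cancel_left]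
    have hykv : Commute (y ^ k) v := by
      rw [hyk]
      exact Commute.mul_left (hRR _ (inv_mem hrR) v hv) (hRc v hv)
    have hyk1 : y ^ k ≠ 1 := by
      intro h1
      rw [h1, mul_one] at hk
      exact hc1 (hPR c hc (hk ▸ hrR))
    refine hyv ?_
    have hyz : y ∈ zpowers (y ^ k) := by
      have hoy : orderOf y = p := orderOf_eq_prime hy hr.x_ne_one
      have hoyk : orderOf (y ^ k) = p := by
        refine orderOf_eq_prime ?_ hyk1
        rw [← zpow_natCast, ← zpow_mul, mul_comm, zpow_mul, zpow_natCast, hy, one_zpow]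
      have : zpowers (y ^ k) = zpowers y := eq_of_le_of_card_ge (zpowers_le.2 ⟨k, rfl⟩)
        (by rw [Nat.card_zpowers, Nat.card_zpowers, hoy, hoyk])
      rw [this]
      exact mem_zpowers y
    obtain ⟨l, hl⟩ := hyz
    have hl : (y ^ k) ^ l = y := hl
    rw [← hl]
    exact hykv.zpow_left l
  rw [← card_sharp] at ha hb
  refine not_card_add_lt hs.hp.two_le hs.hq.two_le ha hb hMcard Nat.card_pos hu hv hw ?_
  -- disjointness
  classical
  have hfin : ∀ A : Set S, A.Finite := fun A => Set.toFinite A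
  have hord : ∀ {r : ℕ} [Fact r.Prime] (Q : Sylow r S), ∀ s ∈ conjSet (sharp (Q : Subgroup S)),
      s ≠ 1 ∧ ∃ j, s ^ r ^ j = 1 := by
    rintro r _ Q _ ⟨g, t, ht, rfl⟩
    refine ⟨fun h1 => ht.2 ?_, ?_⟩
    · rwa [conj_eq_one_iff] at h1
    · obtain ⟨j, hj⟩ := Q.isPGroup'.exists_pow_eq_one ht.1
      exact ⟨j, by rw [hconjpow, hj, mul_one, mul_inv_cancel]⟩
  have hordT : ∀ s ∈ conjSet T, (∀ j, s ^ p ^ j ≠ 1) ∧ ∀ j, s ^ q ^ j ≠ 1 := by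
    rintro _ ⟨g, _, ⟨a, ha, b, hb, rfl⟩, rfl⟩
    have hab := hcx' a ha.1 b hb.1
    constructor
    · intro j h1
      rw [hconjpow, conj_eq_one_iff, hab.mul_pow] at h1
      refine hb.2 (eq_one_of_pow_coprime (m := p ^ j * p) (n := q) ?_ ?_ (hbq b hb.1))
      · rw [← pow_succ]; exact hs.coprime.pow_left _
      · rw [mul_eq_one_iff_inv_eq] at h1
        rw [pow_mul, ← h1, inv_pow, inv_eq_one, ← pow_mul, mul_comm, pow_mul, hap a ha.1, one_pow]
    · intro j h1
      rw [hconjpow, conj_eq_one_iff, hab.mul_pow] at h1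
      refine ha.2 (eq_one_of_pow_coprime (m := q ^ j * q) (n := p) ?_ ?_ (hap a ha.1))
      · rw [← pow_succ]; exact hs.coprime.symm.pow_left _
      · rw [mul_eq_one_iff_eq_inv] at h1
        rw [pow_mul, h1, inv_pow, inv_eq_one, ← pow_mul, mul_comm, pow_mul, hbq b hb.1, one_pow]
  have hd1 : Disjoint (conjSet (sharp (P : Subgroup S))) (conjSet (sharp (R : Subgroup S))) := by
    rw [Set.disjoint_left]
    intro s h1 h2
    obtain ⟨h3, i, hi⟩ := hord P s h1
    obtain ⟨-, j, hj⟩ := hord R s h2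
    exact h3 (eq_one_of_pow_coprime (hs.coprime.pow i j) hi hj)
  have hd2 : Disjoint (conjSet (sharp (P : Subgroup S)) ∪ conjSet (sharp (R : Subgroup S)))
      (conjSet T) := by
    rw [Set.disjoint_left]
    rintro s (h1 | h1) h2
    · obtain ⟨-, i, hi⟩ := hord P s h1
      exact (hordT s h2).1 i hi
    · obtain ⟨-, i, hi⟩ := hord R s h1
      exact (hordT s h2).2 i hi
  simp only [Nat.card_coe_set_eq]
  rw [← Set.ncard_union_eq hd1, ← Set.ncard_union_eq hd2, ← Nat.card_coe_set_eq,
    ← Nat.card_univ, ← Nat.card_univ]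
  have hlt : (conjSet (sharp (P : Subgroup S)) ∪ conjSet (sharp (R : Subgroup S)) ∪ conjSet T) ⊂
      Set.univ := by
    refine Set.ssubset_univ_iff.2 fun he => ?_
    rcases he.symm ▸ Set.mem_univ (1 : S) with (h1 | h1) | h1
    · exact (hord P 1 h1).1 rfl
    · exact (hord R 1 h1).1 rfl
    · exact (hordT 1 h1).1 0 (one_pow _)
  have := Set.ncard_lt_ncard hlt
  simpa [Nat.card_coe_set_eq] using this

end Setting

end ParaNil

namespace ParaNil

open Subgroup

variable {S : Type*} [Group S]

/-- The structure of the normalizer of a nontrivial Sylow subgroup in a `Setting`. -/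
structure LocalData (p q : ℕ) (P : Subgroup S) : Prop where
  hp : p.Prime
  hq : q.Prime
  hpq : p ≠ q
  ne_bot : P ≠ ⊥
  isTI : IsTI P
  card_normalizer : Nat.card (normalizer (P : Set S)) = Nat.card P * q
  dvd : q ∣ Nat.card P - 1
  comm : ∀ u ∈ P, ∀ v ∈ P, Commute u v
  pow : ∀ u ∈ P, u ^ p = 1
  cent : ∀ u ∈ P, u ≠ 1 → ∀ g, Commute g u → g ∈ P
  irred : ∀ T ≤ P, (∀ g ∈ normalizer (P : Set S), ∀ t ∈ T, g * t * g⁻¹ ∈ T) → T = ⊥ ∨ T = P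
  gen : ∃ x ∈ normalizer (P : Set S), x ≠ 1 ∧ x ^ q = 1 ∧
    ∀ g ∈ normalizer (P : Set S), ∃ u ∈ P, ∃ k : ℤ, g = u * x ^ k

theorem mem_zpowers_zpow {x : S} {q : ℕ} (hq : q.Prime) (hx : x ^ q = 1) {k : ℤ}
    (hk : x ^ k ≠ 1) : x ∈ zpowers (x ^ k) := by
  have hxc : Nat.card (zpowers x) ∣ q := by
    rw [Nat.card_zpowers]; exact orderOf_dvd_of_pow_eq_one hx
  have hle : zpowers (x ^ k) ≤ zpowers x := zpowers_le.2 ⟨k, rfl⟩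
  have : Finite (zpowers x) :=
    Nat.finite_of_card_ne_zero (ne_zero_of_dvd_ne_zero hq.ne_zero hxc)
  have h1 : Nat.card (zpowers (x ^ k)) = q := by
    refine ((Nat.dvd_prime hq).1 ((card_dvd_of_le hle).trans hxc)).resolve_left ?_
    rw [Nat.card_zpowers]
    exact fun h => hk (orderOf_eq_one_iff.1 h)
  have : zpowers (x ^ k) = zpowers x := by
    have hf : (zpowers x : Set S).Finite := Set.toFinite _
    refine SetLike.coe_injective (Set.eq_of_subset_of_ncard_le hle ?_ hf)
    rw [← Nat.card_coe_set_eq, ← Nat.card_coe_set_eq]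
    exact (Nat.le_of_dvd hq.pos hxc).trans h1.ge
  rw [this]
  exact mem_zpowers x

theorem Setting.exists_localData (h : Setting S) {p : ℕ} [Fact p.Prime] (P : Sylow p S)
    (hP : (P : Subgroup S) ≠ ⊥) : ∃ q, LocalData p q (P : Subgroup S) := by
  have := h.finite
  obtain ⟨q, x, hs⟩ := h.schmidtData_normalizer P hP
  have hx := h.pow_eq_one hs
  have hC : ∀ c ∈ (P : Subgroup S), Commute c x → c = 1 := fun c hc hcx =>
    h.eq_one_of_commute hs hc hcx
  have hTI := h.isTI P
  have hcomm : ∀ u ∈ (P : Subgroup S), ∀ v ∈ (P : Subgroup S), Commute u v := by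
    intro u hu v hv
    have h1 := hC _ (mul_mem (mul_mem (mul_mem hu hv) (inv_mem hu)) (inv_mem hv))
      (hs.comm_central u hu v hv x hs.mem)
    rw [mul_inv_eq_one, mul_inv_eq_iff_eq_mul] at h1
    exact h1
  have := Fact.mk hs.hq
  refine ⟨q, hs.hp, hs.hq, hs.hpq, hP, hTI, hs.card_eq hx, ?_, hcomm, ?_, ?_, ?_, ?_⟩
  · let f : zpowers x →* MulAut P := (P : Subgroup S).normalizerMonoidHom.comp
      (inclusion (zpowers_le.2 hs.mem))
    let _ : MulAction (zpowers x) P := MulAction.compHom P f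
    have hxq : IsPGroup q (zpowers x) := IsPGroup.of_card_dvd_pow (n := 1)
      (by rw [Nat.card_zpowers, pow_one]; exact orderOf_dvd_of_pow_eq_one hx)
    have h1 := hxq.card_modEq_card_fixedPoints P
    have h2 : Nat.card (MulAction.fixedPoints (zpowers x) P) = 1 := by
      rw [Nat.card_eq_one_iff_unique]
      refine ⟨⟨?_⟩, ⟨⟨1, fun m => map_one (f m)⟩⟩⟩
      have key : ∀ a : MulAction.fixedPoints (zpowers x) P, (a : P) = 1 := by
        rintro ⟨a, ha⟩
        have h3 := congrArg Subtype.val (ha ⟨x, mem_zpowers x⟩)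
        have h3 : x * a * x⁻¹ = a := h3
        rw [mul_inv_eq_iff_eq_mul] at h3
        exact Subtype.ext (hC a a.2 h3.symm)
      intro a b
      exact Subtype.ext ((key a).trans (key b).symm)
    rw [h2] at h1
    exact (Nat.modEq_iff_dvd' Nat.card_pos).1 h1.symm
  · exact fun u hu => hC _ (pow_mem hu p) (hs.pow_central u hu x hs.mem)
  · intro u hu hu1 g hg
    have hgN : g ∈ normalizer ((P : Subgroup S) : Set S) := by
      refine hTI g u hu hu1 ?_
      rwa [hg.eq, mul_inv_cancel_right]
    obtain ⟨v, hv, k, rfl⟩ := hs.gen g hgN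
    by_cases hk : x ^ k = 1
    · rwa [hk, mul_one]
    · exfalso
      have h1 : Commute (x ^ k) u := by
        have := Commute.mul_left (hcomm _ (inv_mem hv) u hu) hg
        rwa [inv_mul_cancel_left] at this
      obtain ⟨l, hl⟩ := mem_zpowers_zpow hs.hq hx hk
      have h2 := h1.zpow_left l
      have hl : (x ^ k) ^ l = x := hl
      rw [hl] at h2
      exact hu1 (hC u hu h2.symm)
  · intro T hT hTN
    rcases hs.invariant T hT (hTN x hs.mem) with h1 | h1
    · exact Or.inr h1
    · exact Or.inl ((eq_bot_iff_forall T).2 fun t ht => hC t (hT ht) (h1 t ht x hs.mem))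
  · exact ⟨x, hs.mem, hs.x_ne_one, hx, hs.gen⟩

namespace Setting

theorem exists_sylow_mem (h : Setting S) {s : S} (hs : s ≠ 1) :
    ∃ p, ∃ _ : Fact p.Prime, ∃ P : Sylow p S, (P : Subgroup S) ≠ ⊥ ∧ s ∈ P := by
  have := h.finite
  obtain ⟨p, hp, hd⟩ := Nat.exists_prime_and_dvd (fun h1 => hs (orderOf_eq_one_iff.1 h1))
  have := Fact.mk hp
  set e := s ^ (orderOf s / p) with he
  have hep : e ^ p = 1 := by
    rw [he, ← pow_mul, Nat.div_mul_cancel hd, pow_orderOf_eq_one]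
  have he1 : e ≠ 1 := by
    refine pow_ne_one_of_lt_orderOf ?_ ?_
    · exact (Nat.div_pos (Nat.le_of_dvd (orderOf_pos s) hd) hp.pos).ne'
    · exact Nat.div_lt_self (orderOf_pos s) hp.one_lt
  obtain ⟨P, hP⟩ := ParaNil.exists_sylow_mem (p := p) (k := 1) (u := e) (by rwa [pow_one])
  have hP' : e ∈ (P : Subgroup S) := hP
  have hb : (P : Subgroup S) ≠ ⊥ := fun hb => he1 (by rwa [hb, mem_bot] at hP')
  obtain ⟨q, hl⟩ := h.exists_localData P hb
  exact ⟨p, this, P, hb, hl.cent e hP he1 s ((Commute.refl s).pow_right _)⟩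

end Setting

end ParaNil

namespace ParaNil

open Subgroup

section

open scoped Classical

theorem trace_pi_matrix_mul {n : ℕ} (d : Fin n → ℕ)
    (A B : Π i, Matrix (Fin (d i)) (Fin (d i)) ℂ) :
    LinearMap.trace ℂ _ (LinearMap.mulLeft ℂ A ∘ₗ LinearMap.mulRight ℂ B) =
      ∑ i, (A i).trace * (B i).trace := by
  rw [LinearMap.trace_eq_matrix_trace ℂ
    (Pi.basis fun i => Matrix.stdBasis ℂ (Fin (d i)) (Fin (d i))), Matrix.trace,
    Fintype.sum_sigma]
  refine Finset.sum_congr rfl fun i _ => ?_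
  rw [Matrix.trace, Matrix.trace, Finset.sum_mul_sum, Fintype.sum_prod_type]
  refine Finset.sum_congr rfl fun j _ => Finset.sum_congr rfl fun k _ => ?_
  rw [Matrix.diag_apply, LinearMap.toMatrix_apply, Pi.basis_repr, Pi.basis_apply]
  simp only [LinearMap.comp_apply, LinearMap.mulLeft_apply, LinearMap.mulRight_apply, Pi.mul_apply,
    Pi.single_eq_same, Matrix.diag_apply, Matrix.stdBasis_eq_single]
  have : ∀ M : Matrix (Fin (d i)) (Fin (d i)) ℂ, (Matrix.stdBasis ℂ _ _).repr M (j, k) = M j k :=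
    fun M => rfl
  rw [this, ← Matrix.mul_assoc, Matrix.mul_apply]
  rw [Finset.sum_eq_single k (fun l _ hl => by
    simp [Matrix.mul_apply, hl.symm]) (by simp), Matrix.mul_apply,
    Finset.sum_eq_single j (fun l _ hl => by simp [hl.symm]) (by simp)]
  simp

theorem trace_monoidAlgebra_mul {S : Type*} [Group S] [Fintype S] (a b : S) :
    LinearMap.trace ℂ (MonoidAlgebra ℂ S) (LinearMap.mulLeft ℂ (MonoidAlgebra.of ℂ S a) ∘ₗ
      LinearMap.mulRight ℂ (MonoidAlgebra.of ℂ S b⁻¹)) =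
      (Nat.card {x : S // x⁻¹ * a * x = b} : ℂ) := by
  rw [LinearMap.trace_eq_matrix_trace ℂ (MonoidAlgebra.basis S ℂ), Matrix.trace,
    Nat.card_eq_fintype_card, Fintype.card_subtype, ← Finset.sum_boole]
  refine Finset.sum_congr rfl fun x _ => ?_
  rw [Matrix.diag_apply, LinearMap.toMatrix_apply]
  have : (MonoidAlgebra.basis S ℂ).repr ((LinearMap.mulLeft ℂ (MonoidAlgebra.of ℂ S a) ∘ₗ
      LinearMap.mulRight ℂ (MonoidAlgebra.of ℂ S b⁻¹)) ((MonoidAlgebra.basis S ℂ) x)) =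
      Finsupp.single (a * (x * b⁻¹)) 1 := by
    have h1 : (LinearMap.mulLeft ℂ (MonoidAlgebra.of ℂ S a) ∘ₗ
        LinearMap.mulRight ℂ (MonoidAlgebra.of ℂ S b⁻¹)) ((MonoidAlgebra.basis S ℂ) x) =
        MonoidAlgebra.basis S ℂ (a * (x * b⁻¹)) := by
      simp [MonoidAlgebra.single_mul_single]
    rw [h1, Module.Basis.repr_self]
  rw [this, Finsupp.single_apply]
  refine if_congr ?_ rfl rfl
  rw [← mul_assoc, mul_inv_eq_iff_eq_mul, mul_assoc, inv_mul_eq_iff_eq_mul]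

theorem exists_natCast_eq_trace {d : ℕ} {E : Matrix (Fin d) (Fin d) ℂ} (hE : E * E = E) :
    ∃ m : ℕ, E.trace = m := by
  have h1 : IsIdempotentElem (Matrix.toLin' E) :=
    (Matrix.toLin'_mul E E).symm.trans (by rw [hE])
  have h2 := LinearMap.IsProj.trace (LinearMap.IsIdempotentElem.isProj_range _ h1)
  rw [Matrix.trace_toLin'_eq] at h2
  exact ⟨_, h2⟩

/-- The properties of the table of irreducible complex characters that are used below. -/
structure IsCharTable {S I : Type*} [Group S] [Fintype S] [Fintype I] (χ : I → S → ℂ) : Prop where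
  conj : ∀ i x s, χ i (x * s * x⁻¹) = χ i s
  col : ∀ a b, ∑ i, χ i a * χ i b⁻¹ = (Nat.card {x : S // x⁻¹ * a * x = b} : ℂ)
  row : ∀ i, ∑ s, χ i s * χ i s⁻¹ = (Nat.card S : ℂ)
  deg : ∀ i, ∃ n : ℕ, 0 < n ∧ χ i 1 = n
  int : ∀ (A : Subgroup S) (l : A →* ℂˣ) i, ∃ m : ℕ,
    ∑ a : A, χ i a * ((l a⁻¹ : ℂˣ) : ℂ) = (Nat.card A : ℂ) * m

theorem exists_isCharTable (S : Type*) [Group S] [Fintype S] :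
    ∃ (n : ℕ) (χ : Fin n → S → ℂ), IsCharTable χ := by
  obtain ⟨n, d, hd, ⟨e⟩⟩ :=
    IsSemisimpleRing.exists_algEquiv_pi_matrix_of_isAlgClosed ℂ (MonoidAlgebra ℂ S)
  set ρ : ∀ i : Fin n, S → Matrix (Fin (d i)) (Fin (d i)) ℂ :=
    fun i s => e (MonoidAlgebra.of ℂ S s) i with hρ
  have hmul : ∀ i s t, ρ i (s * t) = ρ i s * ρ i t := fun i s t => by
    simp only [hρ, map_mul, Pi.mul_apply]
  have hone : ∀ i, ρ i 1 = 1 := fun i => by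
    simp only [hρ, map_one, Pi.one_apply]
  have hcol : ∀ a b, ∑ i, (ρ i a).trace * (ρ i b⁻¹).trace =
      (Nat.card {x : S // x⁻¹ * a * x = b} : ℂ) := by
    intro a b
    rw [← trace_monoidAlgebra_mul, ← trace_pi_matrix_mul, ← LinearMap.trace_conj' _ e.toLinearEquiv]
    congr 1
    ext v
    simp [LinearEquiv.conj_apply, hρ]
  have hconj : ∀ i x s, (ρ i (x * s * x⁻¹)).trace = (ρ i s).trace := by
    intro i x s
    rw [hmul, Matrix.trace_mul_comm, ← hmul, ← mul_assoc, inv_mul_cancel, one_mul]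
  refine ⟨n, fun i s => (ρ i s).trace, ⟨hconj, hcol, fun i => ?_, fun i => ?_, fun A l i => ?_⟩⟩
  · -- dual vectors to the characters
    obtain ⟨z, hz⟩ : ∃ z : S → ℂ, ∀ j, ∑ s, z s * (ρ j s).trace = if j = i then 1 else 0 := by
      have hdi : 0 < d i := Nat.pos_of_ne_zero (hd i).out
      set v := e.symm (Pi.single i (Matrix.single ⟨0, hdi⟩ ⟨0, hdi⟩ 1)) with hv
      refine ⟨fun s => (MonoidAlgebra.basis S ℂ).repr v s, fun j => ?_⟩
      have h1 : e v j = ∑ s, (MonoidAlgebra.basis S ℂ).repr v s • ρ j s := by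
        conv_lhs => rw [← (MonoidAlgebra.basis S ℂ).sum_repr v]
        rw [map_sum, Finset.sum_apply]
        refine Finset.sum_congr rfl fun s _ => ?_
        rw [map_smul, Pi.smul_apply]
        rfl
      have h2 := congrArg Matrix.trace h1
      rw [Matrix.trace_sum] at h2
      simp only [Matrix.trace_smul, smul_eq_mul] at h2
      rw [← h2, hv, AlgEquiv.apply_symm_apply]
      split_ifs with hj
      · subst hj
        rw [Pi.single_eq_same, Matrix.trace_single_eq_same]
      · rw [Pi.single_eq_of_ne hj, Matrix.trace_zero]
    have h1 : ∀ b, ∑ j, (∑ s, (ρ i s).trace * (ρ j s⁻¹).trace) * (ρ j b).trace =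
        Nat.card S * (ρ i b).trace := by
      intro b
      simp only [Finset.sum_mul]
      rw [Finset.sum_comm]
      have h2 : ∀ s, ∑ j, (ρ i s).trace * (ρ j s⁻¹).trace * (ρ j b).trace =
          ∑ x : S, if x⁻¹ * b * x = s then (ρ i b).trace else 0 := by
        intro s
        have h3 := hcol b s
        rw [Nat.card_eq_fintype_card, Fintype.card_subtype, ← Finset.sum_boole] at h3
        calc _ = (ρ i s).trace * ∑ j, (ρ j b).trace * (ρ j s⁻¹).trace := by
              rw [Finset.mul_sum]
              exact Finset.sum_congr rfl fun j _ => by ring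
          _ = _ := by
              rw [h3, Finset.mul_sum]
              refine Finset.sum_congr rfl fun x _ => ?_
              split_ifs with hx
              · have := hconj i x⁻¹ b
                rw [inv_inv, hx] at this
                rw [this, mul_one]
              · rw [mul_zero]
      rw [Finset.sum_congr rfl fun s _ => h2 s, Finset.sum_comm]
      simp [Nat.card_eq_fintype_card]
    have h4 : ∑ b, z b * ∑ j, (∑ s, (ρ i s).trace * (ρ j s⁻¹).trace) * (ρ j b).trace =
        Nat.card S * ∑ b, z b * (ρ i b).trace := by
      rw [Finset.mul_sum]
      refine Finset.sum_congr rfl fun b _ => ?_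
      rw [h1]
      ring
    rw [hz, if_pos rfl, mul_one] at h4
    rw [← h4]
    simp only [Finset.mul_sum]
    rw [Finset.sum_comm]
    have h5 : ∀ j, ∑ b, z b * ((∑ s, (ρ i s).trace * (ρ j s⁻¹).trace) * (ρ j b).trace) =
        if j = i then ∑ s, (ρ i s).trace * (ρ j s⁻¹).trace else 0 := by
      intro j
      calc _ = (∑ s, (ρ i s).trace * (ρ j s⁻¹).trace) * ∑ b, z b * (ρ j b).trace := by
            rw [Finset.mul_sum]
            exact Finset.sum_congr rfl fun b _ => by ring
        _ = _ := by rw [hz]; split_ifs <;> simp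
    have h6 := Finset.sum_congr (rfl : (Finset.univ : Finset (Fin n)) = _) fun j _ => h5 j
    rw [h6]
    simp
  · refine ⟨d i, Nat.pos_of_ne_zero (hd i).out, ?_⟩
    simp [hone]
  · set E : Matrix (Fin (d i)) (Fin (d i)) ℂ :=
      (Nat.card A : ℂ)⁻¹ • ∑ a : A, ((l a⁻¹ : ℂˣ) : ℂ) • ρ i a with hE
    have hA : (Nat.card A : ℂ) ≠ 0 := Nat.cast_ne_zero.2 Nat.card_pos.ne'
    have h1 : ∀ b : A, ρ i b * ∑ a : A, ((l a⁻¹ : ℂˣ) : ℂ) • ρ i a =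
        ((l b : ℂˣ) : ℂ) • ∑ a : A, ((l a⁻¹ : ℂˣ) : ℂ) • ρ i a := by
      intro b
      rw [Finset.mul_sum, Finset.smul_sum]
      refine Fintype.sum_equiv (Equiv.mulLeft b) _ _ fun a => ?_
      have h : l a⁻¹ = l b * l (b * a)⁻¹ := by
        rw [map_inv, map_inv, map_mul, mul_inv, mul_inv_cancel_left]
      rw [Matrix.mul_smul, ← hmul, smul_smul, Equiv.coe_mulLeft, coe_mul, h, Units.val_mul]
    have h2 : E * E = E := by
      rw [hE, Matrix.smul_mul, Matrix.mul_smul, Finset.sum_mul]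
      congr 1
      simp only [Matrix.smul_mul, h1, smul_smul]
      rw [← Finset.sum_smul]
      have : ∑ a : A, ((l a⁻¹ : ℂˣ) : ℂ) * (l a : ℂˣ) = Nat.card A := by
        simp [Nat.card_eq_fintype_card]
      rw [this, smul_smul, inv_mul_cancel₀ hA, one_smul]
    obtain ⟨m, hm⟩ := exists_natCast_eq_trace h2
    refine ⟨m, ?_⟩
    rw [← hm, hE, Matrix.trace_smul, Matrix.trace_sum, smul_eq_mul, mul_inv_cancel_left₀ hA]
    exact Finset.sum_congr rfl fun a _ => by rw [Matrix.trace_smul, smul_eq_mul, mul_comm]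

end

end ParaNil

namespace ParaNil

section

open scoped Classical

theorem exists_eq_single_sub_single {I : Type*} [Fintype I] {n v : I → ℤ} (hn : ∀ i, 0 < n i)
    (hv : ∑ i, v i * v i = 2) (hnv : ∑ i, n i * v i = 0) :
    ∃ x y, x ≠ y ∧ ∀ i, v i = (if i = x then 1 else 0) - (if i = y then 1 else 0) := by
  have h1 : ∃ x, 0 < v x := by
    by_contra! h
    have h2 : ∀ i ∈ Finset.univ, n i * v i = 0 :=
      (Finset.sum_eq_zero_iff_of_nonpos fun i _ => mul_nonpos_of_nonneg_of_nonpos (hn i).le (h i)).1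
        hnv
    rw [Finset.sum_eq_zero fun i hi => by
      rw [(mul_eq_zero.1 (h2 i hi)).resolve_left (hn i).ne', mul_zero]] at hv
    omega
  have h2 : ∃ y, v y < 0 := by
    by_contra! h
    obtain ⟨x, hx⟩ := h1
    have h2 : ∀ i ∈ Finset.univ, n i * v i = 0 :=
      (Finset.sum_eq_zero_iff_of_nonneg fun i _ => mul_nonneg (hn i).le (h i)).1 hnv
    exact (mul_pos (hn x) hx).ne' (h2 x (Finset.mem_univ x))
  obtain ⟨x, hx⟩ := h1
  obtain ⟨y, hy⟩ := h2
  have hxy : x ≠ y := fun h => by subst h; omega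
  refine ⟨x, y, hxy, ?_⟩
  have h3 := Finset.add_sum_erase Finset.univ (fun i => v i * v i) (Finset.mem_univ x)
  have h4 := Finset.add_sum_erase (Finset.univ.erase x) (fun i => v i * v i)
    (Finset.mem_erase.2 ⟨hxy.symm, Finset.mem_univ y⟩)
  have h5 : 0 ≤ ∑ i ∈ (Finset.univ.erase x).erase y, v i * v i :=
    Finset.sum_nonneg fun i _ => mul_self_nonneg _
  have h6 : v x = 1 := by nlinarith
  have h7 : v y = -1 := by nlinarith
  have h8 : ∑ i ∈ (Finset.univ.erase x).erase y, v i * v i = 0 := by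
    simp only [h6, h7] at h3 h4
    omega
  intro i
  by_cases hix : i = x
  · simp [hix, h6, hxy]
  by_cases hiy : i = y
  · simp [hiy, h7, hxy.symm]
  · have := (Finset.sum_eq_zero_iff_of_nonneg fun i _ => mul_self_nonneg _).1 h8 i (by simp [hix, hiy])
    simpa [hix, hiy] using this

theorem sum_eq_of_involution {Ω : Type*} [Fintype Ω] {b : Ω → Ω} (hb : ∀ x, b (b x) = x)
    (hne : ∀ x, b x ≠ x) {h : Ω → ZMod 2} {t : ZMod 2} {o : Ω}
    (hh : ∀ x, h x + h (b x) = (if x = o then t else 0) + (if b x = o then t else 0)) :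
    ∑ x, h x = t := by
  have h1 : ∑ x, (h x - if x = o then t else 0) = 0 := by
    refine Finset.sum_involution (fun x _ => b x) (fun x _ => ?_) (fun x _ _ => hne x)
      (fun x _ => Finset.mem_univ _) (fun x _ => hb x)
    rw [sub_add_sub_comm, hh, sub_self]
  rw [Finset.sum_sub_distrib, Finset.sum_ite_eq' Finset.univ o, if_pos (Finset.mem_univ o)] at h1
  exact sub_eq_zero.1 h1

/-- The inner products between the multiplicities of linear characters of the members of a family of
subgroups in the restrictions of irreducible characters. -/
structure MultData {I K : Type*} [Fintype I] [Fintype K] {Ω : K → Type*} [∀ k, Fintype (Ω k)]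
    (i₀ : I) (n : I → ℤ) (b : ∀ k, Ω k → Ω k) (c : ∀ k, Option (Ω k) → I → ℤ) (q : K → ℤ) :
    Prop where
  card : Fintype.card I = 1 + ∑ k, Fintype.card (Ω k)
  n_pos : ∀ i, 0 < n i
  invol : ∀ k x, b k (b k x) = x
  invol_ne : ∀ k x, b k x ≠ x
  none_apply : ∀ k, c k none i₀ = 1
  some_apply : ∀ k x, c k (some x) i₀ = 0
  sum_n : ∀ k x y, ∑ i, n i * c k x i = ∑ i, n i * c k y i
  gram : ∀ k, ∃ κ : ℤ, (∑ i, c k none i * c k none i = κ + q k) ∧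
    (∀ x, ∑ i, c k none i * c k (some x) i = κ) ∧
    ∀ x y, ∑ i, c k (some x) i * c k (some y) i = κ + if x = y then 1 else 0
  cross : ∀ j k, j ≠ k → ∃ γ : ℤ, ∀ x y, ∑ i, c j x i * c k y i = γ

namespace MultData

variable {I K : Type*} [Fintype I] [Fintype K] {Ω : K → Type*} [∀ k, Fintype (Ω k)]
    {i₀ : I} {n : I → ℤ} {b : ∀ k, Ω k → Ω k} {c : ∀ k, Option (Ω k) → I → ℤ} {q : K → ℤ}

theorem exists_exceptional (h : MultData i₀ n b c q) :
    ∃ X : (Σ k, Ω k) → I, Function.Injective X ∧ (∀ s, X s ≠ i₀) ∧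
      ∀ k x i, c k (some x) i - c k (some (b k x)) i =
        (if i = X ⟨k, x⟩ then 1 else 0) - (if i = X ⟨k, b k x⟩ then 1 else 0) := by
  have h1 : ∀ k x, ∃ i j, i ≠ j ∧ ∀ t, c k (some x) t - c k (some (b k x)) t =
      (if t = i then 1 else 0) - (if t = j then 1 else 0) := by
    intro k x
    obtain ⟨κ, -, -, hκ⟩ := h.gram k
    refine exists_eq_single_sub_single h.n_pos ?_ ?_
    · have : ∀ i, (c k (some x) i - c k (some (b k x)) i) * (c k (some x) i - c k (some (b k x)) i) =
        c k (some x) i * c k (some x) i - 2 * (c k (some x) i * c k (some (b k x)) i) +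
        c k (some (b k x)) i * c k (some (b k x)) i := fun i => by ring
      simp only [this, Finset.sum_add_distrib, Finset.sum_sub_distrib, ← Finset.mul_sum, hκ]
      rw [if_neg (h.invol_ne k x).symm]
      simp only [if_true]
      ring
    · simp only [mul_sub, Finset.sum_sub_distrib]
      rw [h.sum_n k (some x) (some (b k x)), sub_self]
  choose f g hfg hf using h1
  have hsum : ∀ (F : I → ℤ) k x, ∑ i, F i * (c k (some x) i - c k (some (b k x)) i) =
      F (f k x) - F (g k x) := by
    intro F k x
    simp [hf, mul_sub, Finset.sum_sub_distrib]
  have hgf : ∀ k x, f k (b k x) = g k x := by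
    intro k x
    have h2 := hf k (b k x) (g k x)
    have h3 := hf k x (g k x)
    rw [h.invol] at h2
    rw [if_neg (hfg k x).symm, if_pos rfl] at h3
    by_contra hne
    rw [if_neg (Ne.symm hne)] at h2
    split_ifs at h2 <;> omega
  have hcross : ∀ j k x y, (⟨j, x⟩ : Σ k, Ω k) ≠ ⟨k, y⟩ → (⟨j, x⟩ : Σ k, Ω k) ≠ ⟨k, b k y⟩ →
      ∑ i, (c j (some x) i - c j (some (b j x)) i) * (c k (some y) i - c k (some (b k y)) i) = 0 := by
    intro j k x y h2 h3
    simp only [sub_mul, mul_sub, Finset.sum_sub_distrib]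
    by_cases hjk : j = k
    · subst hjk
      obtain ⟨κ, -, -, hκ⟩ := h.gram j
      have h4 : x ≠ y := fun h => h2 (by rw [h])
      have h5 : x ≠ b j y := fun h => h3 (by rw [h])
      have h6 : b j x ≠ y := fun h' => h5 (by rw [← h', h.invol])
      have h7 : b j x ≠ b j y := fun h' => h4 (by rw [← h.invol j x, h', h.invol])
      rw [hκ, hκ, hκ, hκ, if_neg h4, if_neg h5, if_neg h6, if_neg h7]
      ring
    · obtain ⟨γ, hγ⟩ := h.cross j k hjk
      simp only [hγ, sub_self]
  refine ⟨fun s => f s.1 s.2, ?_, ?_, ?_⟩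
  · rintro ⟨j, x⟩ ⟨k, y⟩ hxy
    by_contra hne
    simp only at hxy
    by_cases h2 : (⟨j, x⟩ : Σ k, Ω k) = ⟨k, b k y⟩
    · obtain ⟨rfl, h3⟩ := Sigma.mk.inj_iff.1 h2
      rw [eq_of_heq h3, hgf] at hxy
      exact hfg _ _ hxy.symm
    · have h3 := hcross j k x y hne h2
      rw [hsum, hf, hf, hxy, if_pos rfl, if_neg (hfg k y).symm] at h3
      rw [if_neg fun h4 => hfg j x (hxy.trans h4)] at h3
      split_ifs at h3 <;> simp at h3
  · rintro ⟨k, x⟩ h2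
    have h3 := hf k x i₀
    rw [h.some_apply, h.some_apply, if_pos h2.symm, if_neg fun h4 => hfg k x (h2.trans h4)] at h3
    omega
  · intro k x i
    simp only [hgf]
    exact hf k x i

theorem sum_eq (h : MultData i₀ n b c q) {X : (Σ k, Ω k) → I} (hX : Function.Injective X)
    (hX₀ : ∀ s, X s ≠ i₀) {M : Type*} [AddCommMonoid M] (F : I → M) :
    ∑ i, F i = F i₀ + ∑ k, ∑ x, F (X ⟨k, x⟩) := by
  have h1 : Function.Bijective (fun o : Option (Σ k, Ω k) => o.elim i₀ X) := by
    refine (Fintype.bijective_iff_injective_and_card _).2 ⟨?_, ?_⟩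
    · rintro (_ | s) (_ | t) hst
      · rfl
      · exact absurd hst.symm (hX₀ t)
      · exact absurd hst (hX₀ s)
      · rw [hX hst]
    · rw [Fintype.card_option, Fintype.card_sigma, h.card, add_comm]
  rw [← h1.sum_comp F, Fintype.sum_option, Fintype.sum_sigma]
  rfl

/-- The two irreducible constituents attached to a pair of orbits belonging to different members
interact: one of the multiplicity differences is odd. -/
theorem exists_pos_constituent (h : MultData i₀ n b c q) (j : K) (o : Ω j) :
    ∃ (t : I) (T : Finset K), c j (some o) t ≠ c j (some (b j o)) t ∧ j ∉ T ∧
      (∑ k ∈ T, (Fintype.card (Ω k) : ℤ) ≤ q j - 1) ∧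
      ∀ k ∉ T, k ≠ j → ∃ x, c k (some x) t ≠ c k none t := by
  obtain ⟨X, hX, hX₀, hdiff⟩ := h.exists_exceptional
  have hXb : ∀ k x, X ⟨k, x⟩ ≠ X ⟨k, b k x⟩ := by
    intro k x h'
    have := hX h'
    simp only [Sigma.mk.injEq, heq_eq_eq, true_and] at this
    exact h.invol_ne k x this.symm
  have hsum : ∀ (F : I → ℤ) k x, F (X ⟨k, x⟩) - F (X ⟨k, b k x⟩) =
      ∑ i, F i * (c k (some x) i - c k (some (b k x)) i) := by
    intro F k x
    simp [hdiff, mul_sub, Finset.sum_sub_distrib]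
  set u : ∀ k, Ω k → I → ℤ := fun k x i => c k none i - c k (some x) i with hu
  have hu₀ : ∀ k x, u k x i₀ = 1 := fun k x => by simp [hu, h.none_apply, h.some_apply]
  have hinv : ∀ k l, k ≠ l → ∀ x y, u k x (X ⟨l, y⟩) = u k x (X ⟨l, b l y⟩) := by
    intro k l hkl x y
    obtain ⟨γ, hγ⟩ := h.cross k l hkl
    refine sub_eq_zero.1 ((hsum (u k x) l y).trans ?_)
    simp only [hu, sub_mul, mul_sub, Finset.sum_sub_distrib, hγ, sub_self]
  have hself : ∀ k x y, u k x (X ⟨k, y⟩) - u k x (X ⟨k, b k y⟩) =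
      (if b k y = x then 1 else 0) - (if y = x then 1 else 0) := by
    intro k x y
    obtain ⟨κ, -, h1, h2⟩ := h.gram k
    rw [hsum (u k x) k y]
    simp only [hu, sub_mul, mul_sub, Finset.sum_sub_distrib, h1, h2, eq_comm (a := x)]
    ring
  have hnorm : ∀ k x, ∑ i, u k x i * u k x i = q k + 1 := by
    intro k x
    obtain ⟨κ, h0, h1, h2⟩ := h.gram k
    have : ∀ i, u k x i * u k x i = c k none i * c k none i - 2 * (c k none i * c k (some x) i) +
      c k (some x) i * c k (some x) i := fun i => by simp only [hu]; ring
    simp only [this, Finset.sum_add_distrib, Finset.sum_sub_distrib, ← Finset.mul_sum, h0, h1, h2]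
    simp
    ring
  have hpar : ∀ k l, k ≠ l → ∀ x y,
      1 + ((u k x (X ⟨l, y⟩) : ℤ) : ZMod 2) + (u l y (X ⟨k, x⟩) : ℤ) = 0 := by
    intro k l hkl x y
    have h1 : ∑ i, u k x i * u l y i = 0 := by
      obtain ⟨γ, hγ⟩ := h.cross k l hkl
      simp only [hu, sub_mul, mul_sub, Finset.sum_sub_distrib, hγ, sub_self]
    have h2 := congrArg (Int.cast : ℤ → ZMod 2) h1
    rw [h.sum_eq hX hX₀, hu₀, hu₀] at h2
    push_cast at h2
    have h3 : ∀ m, ∑ z, ((u k x (X ⟨m, z⟩) : ℤ) : ZMod 2) * (u l y (X ⟨m, z⟩) : ℤ) =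
        (if m = l then ((u k x (X ⟨l, y⟩) : ℤ) : ZMod 2) else 0) +
        (if m = k then ((u l y (X ⟨k, x⟩) : ℤ) : ZMod 2) else 0) := by
      have h22 : ∀ a : ZMod 2, a + a = 0 := by decide
      have hsm : ∀ m w z, ((u m w (X ⟨m, b m z⟩) : ℤ) : ZMod 2) = (u m w (X ⟨m, z⟩) : ℤ) +
          ((if z = w then 1 else 0) + (if b m z = w then 1 else 0)) := by
        intro m w z
        have h4 := congrArg (Int.cast : ℤ → ZMod 2) (hself m w z)
        push_cast at h4
        have h5 : ∀ a b c d : ZMod 2, a - b = c - d → b = a + (d + c) := by decide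
        exact h5 _ _ _ _ h4
      intro m
      by_cases hml : m = l
      · subst hml
        rw [if_pos rfl, if_neg hkl.symm, add_zero]
        refine sum_eq_of_involution (h.invol m) (h.invol_ne m) (o := y) fun z => ?_
        rw [hsm m y z, ← hinv k m hkl x z, mul_add, ← add_assoc, h22, zero_add, mul_add]
        by_cases h1 : z = y
        · subst h1
          simp [h.invol_ne]
        · by_cases h3 : b m z = y
          · subst h3
            simp [(h.invol_ne m z).symm, ← hinv k m hkl x z]
          · simp [h1, h3]
      · by_cases hmk : m = k
        · subst hmk
          rw [if_neg hkl, if_pos rfl, zero_add]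
          refine sum_eq_of_involution (h.invol m) (h.invol_ne m) (o := x) fun z => ?_
          rw [hsm m x z, ← hinv l m hkl.symm y z, add_mul, ← add_assoc, h22, zero_add, add_mul]
          by_cases h1 : z = x
          · subst h1
            simp [h.invol_ne]
          · by_cases h3 : b m z = x
            · subst h3
              simp [(h.invol_ne m z).symm, ← hinv l m hkl.symm y z]
            · simp [h1, h3]
        · rw [if_neg hml, if_neg hmk, add_zero]
          refine Finset.sum_involution (fun z _ => b m z) (fun z _ => ?_)
            (fun z _ _ => h.invol_ne m z) (fun z _ => Finset.mem_univ _) (fun z _ => h.invol m z)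
          rw [hinv k m (Ne.symm hmk) x z, hinv l m (Ne.symm hml) y z, h22]
    simp only [h3, Finset.sum_add_distrib, Finset.sum_ite_eq', Finset.mem_univ, if_true] at h2
    rw [← add_assoc] at h2
    exact h2
  refine ⟨X ⟨j, o⟩, Finset.univ.filter fun k => k ≠ j ∧ ∀ x, u j o (X ⟨k, x⟩) ≠ 0, ?_, by simp,
    ?_, ?_⟩
  · have h1 := hdiff j o (X ⟨j, o⟩)
    rw [if_pos rfl, if_neg (hXb j o)] at h1
    omega
  · have h1 := hnorm j o
    rw [h.sum_eq hX hX₀, hu₀, ← Finset.add_sum_erase _ _ (Finset.mem_univ j)] at h1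
    have h2 : 1 ≤ ∑ x, u j o (X ⟨j, x⟩) * u j o (X ⟨j, x⟩) := by
      have h3 := hself j o o
      rw [if_neg (h.invol_ne j o), if_pos rfl] at h3
      have h4 : ∃ x, u j o (X ⟨j, x⟩) ≠ 0 := by
        by_contra! h4
        rw [h4, h4] at h3
        omega
      obtain ⟨x, hx⟩ := h4
      exact (Int.add_one_le_iff.2 (mul_self_pos.2 hx)).trans
        (Finset.single_le_sum (f := fun x => u j o (X ⟨j, x⟩) * u j o (X ⟨j, x⟩))
          (fun _ _ => mul_self_nonneg _) (Finset.mem_univ x))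
    have h3 : ∑ k ∈ Finset.univ.filter fun k => k ≠ j ∧ ∀ x, u j o (X ⟨k, x⟩) ≠ 0,
        (Fintype.card (Ω k) : ℤ) ≤
        ∑ k ∈ Finset.univ.erase j, ∑ x, u j o (X ⟨k, x⟩) * u j o (X ⟨k, x⟩) := by
      refine (Finset.sum_le_sum fun k hk => ?_).trans
        (Finset.sum_le_sum_of_subset_of_nonneg (t := Finset.univ.erase j) (fun k hk => ?_)
          fun _ _ _ => Finset.sum_nonneg fun _ _ => mul_self_nonneg _)
      · rw [Finset.mem_filter] at hk
        rw [Fintype.card_eq_sum_ones, Nat.cast_sum]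
        exact Finset.sum_le_sum fun x _ => Int.add_one_le_iff.2 (mul_self_pos.2 (hk.2.2 x))
      · rw [Finset.mem_filter] at hk
        exact Finset.mem_erase.2 ⟨hk.2.1, hk.1⟩
    omega
  · intro k hk hkj
    simp only [Finset.mem_filter, Finset.mem_univ, true_and, not_and, not_forall, not_not] at hk
    obtain ⟨x, hx⟩ := hk hkj
    refine ⟨x, fun h1 => ?_⟩
    have h2 := hpar j k (Ne.symm hkj) o x
    have h3 : u k x (X ⟨j, o⟩) = 0 := by simp only [hu, h1, sub_self]
    rw [hx, h3] at h2
    simp at h2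

end MultData

end

end ParaNil

namespace ParaNil

open Subgroup

section

open scoped Classical

section Dual

variable {A : Type*} [Group A] [Fintype A]

theorem finite_dual (hA : ∀ a b : A, a * b = b * a) : Finite (A →* ℂˣ) := by
  let _ : CommGroup A := { (inferInstance : Group A) with mul_comm := hA }
  have h1 : NeZero (Monoid.exponent A) := ⟨Monoid.exponent_ne_zero_of_finite⟩
  have := CommGroup.card_monoidHom_of_hasEnoughRootsOfUnity A ℂ
  exact Nat.finite_of_card_ne_zero (this ▸ Nat.card_pos.ne')

theorem card_dual (hA : ∀ a b : A, a * b = b * a) : Nat.card (A →* ℂˣ) = Nat.card A := by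
  let _ : CommGroup A := { (inferInstance : Group A) with mul_comm := hA }
  have h1 : NeZero (Monoid.exponent A) := ⟨Monoid.exponent_ne_zero_of_finite⟩
  exact CommGroup.card_monoidHom_of_hasEnoughRootsOfUnity A ℂ

theorem sum_apply_dual (hA : ∀ a b : A, a * b = b * a) [Fintype (A →* ℂˣ)] (x : A) :
    ∑ l : A →* ℂˣ, (l x : ℂ) = if x = 1 then (Nat.card A : ℂ) else 0 := by
  split_ifs with hx
  · subst hx
    rw [← card_dual hA]
    simp [Nat.card_eq_fintype_card]
  · let _ : CommGroup A := { (inferInstance : Group A) with mul_comm := hA }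
    have h1 : NeZero (Monoid.exponent A) := ⟨Monoid.exponent_ne_zero_of_finite⟩
    obtain ⟨m, hm⟩ := CommGroup.exists_apply_ne_one_of_hasEnoughRootsOfUnity A ℂ hx
    have h2 : (m x : ℂ) * ∑ l : A →* ℂˣ, (l x : ℂ) = ∑ l : A →* ℂˣ, (l x : ℂ) := by
      rw [Finset.mul_sum]
      exact Fintype.sum_equiv (Equiv.mulLeft m) _ _ fun l => by simp
    exact eq_zero_of_mul_eq_self_left (fun h => hm (Units.ext h)) h2

theorem sum_dual_apply (l : A →* ℂˣ) :
    ∑ x, (l x : ℂ) = if l = 1 then (Nat.card A : ℂ) else 0 := by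
  split_ifs with hl
  · subst hl
    simp [Nat.card_eq_fintype_card]
  · obtain ⟨y, hy⟩ : ∃ y, l y ≠ 1 := by
      by_contra! h
      exact hl (MonoidHom.ext h)
    have h2 : (l y : ℂ) * ∑ x, (l x : ℂ) = ∑ x, (l x : ℂ) := by
      rw [Finset.mul_sum]
      exact Fintype.sum_equiv (Equiv.mulLeft y) _ _ fun l => by simp
    exact eq_zero_of_mul_eq_self_left (fun h => hy (Units.ext h)) h2

end Dual

variable {S I : Type*} [Group S] [Fintype S] [Fintype I] {χ : I → S → ℂ}

/-- The multiplicity of a linear character of a subgroup in the restriction of a character. -/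
noncomputable def mult (χ : I → S → ℂ) {A : Subgroup S} (l : A →* ℂˣ) (i : I) : ℤ :=
  if h : ∃ m : ℤ, ∑ a : A, χ i a * (l a⁻¹ : ℂˣ) = Nat.card A * m then h.choose else 0

namespace IsCharTable

theorem mult_spec (h : IsCharTable χ) {A : Subgroup S} (l : A →* ℂˣ) (i : I) :
    ∑ a : A, χ i a * (l a⁻¹ : ℂˣ) = Nat.card A * (mult χ l i : ℂ) := by
  have h1 : ∃ m : ℤ, ∑ a : A, χ i a * (l a⁻¹ : ℂˣ) = Nat.card A * m := by
    obtain ⟨m, hm⟩ := h.int A l i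
    exact ⟨m, by exact_mod_cast hm⟩
  rw [mult, dif_pos h1]
  exact h1.choose_spec

theorem gram (h : IsCharTable χ) {A B : Subgroup S} (l : A →* ℂˣ) (m : B →* ℂˣ) :
    (Nat.card A : ℂ) * Nat.card B * (∑ i, mult χ l i * mult χ m i : ℤ) =
      ∑ z : S, ∑ x : A, ∑ y : B, if z⁻¹ * x * z = (y : S) then
        ((l x⁻¹ : ℂˣ) : ℂ) * (m y : ℂˣ) else 0 := by
  push_cast
  calc _ = ∑ i, (Nat.card A * (mult χ l i : ℂ)) * (Nat.card B * (mult χ m i : ℂ)) := by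
        rw [Finset.mul_sum]
        exact Finset.sum_congr rfl fun i _ => by ring
    _ = ∑ i, ∑ x : A, ∑ y : B, χ i x * χ i (y : S)⁻¹ * (((l x⁻¹ : ℂˣ) : ℂ) * (m y : ℂˣ)) := by
        refine Finset.sum_congr rfl fun i _ => ?_
        rw [← h.mult_spec, ← h.mult_spec, Finset.sum_mul_sum]
        refine Finset.sum_congr rfl fun x _ => ?_
        refine Fintype.sum_equiv (Equiv.inv B) _ _ fun y => ?_
        simp only [Equiv.inv_apply, coe_inv, inv_inv]
        ring
    _ = ∑ x : A, ∑ y : B, ∑ z : S, if z⁻¹ * x * z = (y : S) then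
        ((l x⁻¹ : ℂˣ) : ℂ) * (m y : ℂˣ) else 0 := by
        rw [Finset.sum_comm]
        refine Finset.sum_congr rfl fun x _ => ?_
        rw [Finset.sum_comm]
        refine Finset.sum_congr rfl fun y _ => ?_
        rw [← Finset.sum_mul, h.col, Nat.card_eq_fintype_card, Fintype.card_subtype,
          ← Finset.sum_boole, Finset.sum_mul]
        exact Finset.sum_congr rfl fun z _ => by split_ifs <;> simp
    _ = _ := by
        rw [Finset.sum_congr rfl fun x _ => Finset.sum_comm, Finset.sum_comm]

theorem sum_deg_mul_mult (h : IsCharTable χ) {A : Subgroup S} (l : A →* ℂˣ) :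
    (Nat.card A : ℂ) * ∑ i, χ i 1 * mult χ l i = Nat.card S := by
  calc _ = ∑ i, ∑ a : A, χ i a * χ i 1⁻¹ * (l a⁻¹ : ℂˣ) := by
        rw [Finset.mul_sum]
        refine Finset.sum_congr rfl fun i _ => ?_
        rw [mul_left_comm, ← h.mult_spec, Finset.mul_sum]
        exact Finset.sum_congr rfl fun a _ => by rw [inv_one]; ring
    _ = _ := by
        rw [Finset.sum_comm, Finset.sum_eq_single 1]
        · rw [← Finset.sum_mul, h.col]
          simp
        · intro a _ ha
          rw [← Finset.sum_mul, h.col]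
          have : IsEmpty {x : S // x⁻¹ * a * x = 1} := by
            refine ⟨fun x => ha (Subtype.ext ?_)⟩
            have := x.2
            rwa [mul_assoc, inv_mul_eq_one, eq_comm, mul_eq_right] at this
          simp
        · simp

theorem sum_sq (h : IsCharTable χ) {A : Subgroup S} (hA : ∀ a b : A, a * b = b * a)
    [Fintype (A →* ℂˣ)] (i : I) :
    (Nat.card A : ℂ) * ∑ l : A →* ℂˣ, (mult χ l i : ℂ) ^ 2 = ∑ a : A, χ i a * χ i (a : S)⁻¹ := by
  have hA0 : (Nat.card A : ℂ) ≠ 0 := Nat.cast_ne_zero.2 Nat.card_pos.ne'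
  refine mul_left_cancel₀ hA0 ?_
  calc _ = ∑ l : A →* ℂˣ, (Nat.card A * (mult χ l i : ℂ)) * (Nat.card A * (mult χ l i : ℂ)) := by
        rw [Finset.mul_sum, Finset.mul_sum]
        exact Finset.sum_congr rfl fun l _ => by ring
    _ = ∑ l : A →* ℂˣ, ∑ a : A, ∑ b : A, χ i a * χ i b * ((l (a * b)⁻¹ : ℂˣ) : ℂ) := by
        refine Finset.sum_congr rfl fun l _ => ?_
        rw [← h.mult_spec, Finset.sum_mul_sum]
        refine Finset.sum_congr rfl fun a _ => Finset.sum_congr rfl fun b _ => ?_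
        rw [map_inv, map_inv, map_inv, map_mul, mul_inv, Units.val_mul]
        ring
    _ = ∑ a : A, ∑ b : A, χ i a * χ i b * if (a * b)⁻¹ = 1 then (Nat.card A : ℂ) else 0 := by
        rw [Finset.sum_comm]
        refine Finset.sum_congr rfl fun a _ => ?_
        rw [Finset.sum_comm]
        refine Finset.sum_congr rfl fun b _ => ?_
        rw [← Finset.mul_sum, sum_apply_dual hA]
        congr
    _ = _ := by
        rw [Finset.mul_sum]
        refine Finset.sum_congr rfl fun a _ => ?_
        rw [Finset.sum_eq_single a⁻¹]
        · simp [mul_comm]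
        · intro b _ hb
          rw [if_neg, mul_zero]
          rw [inv_eq_one, mul_eq_one_iff_inv_eq]
          exact hb.symm
        · simp

theorem sum_mult (h : IsCharTable χ) {A : Subgroup S} (hA : ∀ a b : A, a * b = b * a)
    [Fintype (A →* ℂˣ)] (i : I) : ∑ l : A →* ℂˣ, (mult χ l i : ℂ) = χ i 1 := by
  have hA0 : (Nat.card A : ℂ) ≠ 0 := Nat.cast_ne_zero.2 Nat.card_pos.ne'
  refine mul_left_cancel₀ hA0 ?_
  rw [Finset.mul_sum, Finset.sum_congr rfl fun l _ => (h.mult_spec l i).symm, Finset.sum_comm,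
    Finset.sum_eq_single 1]
  · rw [← Finset.mul_sum, sum_apply_dual hA]
    simp [mul_comm]
  · intro a _ ha
    rw [← Finset.mul_sum, sum_apply_dual hA, if_neg (by simpa using ha), mul_zero]
  · simp

end IsCharTable

end

end ParaNil

namespace ParaNil

open Subgroup

section

open scoped Classical

variable {S I : Type*} [Group S]

/-- The nontrivial linear characters of a subgroup. -/
@[ext]
structure NontrivialDual (A : Subgroup S) where
  /-- The underlying homomorphism. -/
  hom : A →* ℂˣ
  hom_ne : hom ≠ 1

namespace NontrivialDual

variable {A : Subgroup S}

instance : MulAction (normalizer (A : Set S)) (NontrivialDual A) where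
  smul z l := ⟨l.hom.comp (A.normalizerMonoidHom z⁻¹).toMonoidHom, fun h => l.hom_ne (by
    ext x
    have h1 := DFunLike.congr_fun h (A.normalizerMonoidHom z x)
    have h2 : l.hom (A.normalizerMonoidHom z⁻¹ (A.normalizerMonoidHom z x)) = 1 := h1
    rw [map_inv, MulAut.inv_apply_self] at h2
    rw [h2]
    rfl)⟩
  one_smul l := NontrivialDual.ext (by
    ext x
    change ((l.hom (A.normalizerMonoidHom 1⁻¹ x) : ℂˣ) : ℂ) = l.hom x
    rw [inv_one, map_one]
    rfl)
  mul_smul z w l := NontrivialDual.ext (by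
    ext x
    change ((l.hom (A.normalizerMonoidHom (z * w)⁻¹ x) : ℂˣ) : ℂ) =
      l.hom (A.normalizerMonoidHom w⁻¹ (A.normalizerMonoidHom z⁻¹ x))
    rw [mul_inv_rev, map_mul]
    rfl)

theorem smul_apply (z : normalizer (A : Set S)) (l : NontrivialDual A) (x : A) :
    (z • l).hom x = l.hom (A.normalizerMonoidHom z⁻¹ x) := rfl

theorem coe_normalizerMonoidHom (z : normalizer (A : Set S)) (x : A) :
    ((A.normalizerMonoidHom z x : A) : S) = z * x * (z : S)⁻¹ := rfl

theorem smul_eq_self [Finite S] (hA : ∀ u ∈ A, ∀ v ∈ A, Commute u v)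
    (hc : ∀ u ∈ A, u ≠ 1 → ∀ g, Commute g u → g ∈ A) (z : normalizer (A : Set S))
    (l : NontrivialDual A) : z • l = l ↔ (z : S) ∈ A := by
  constructor
  · intro h
    by_contra hz
    have hinj : Function.Injective fun x : A => x⁻¹ * A.normalizerMonoidHom z⁻¹ x := by
      intro x y hxy
      have h1 : A.normalizerMonoidHom z⁻¹ (x * y⁻¹) = x * y⁻¹ := by
        simp only at hxy
        rw [map_mul, map_inv (A.normalizerMonoidHom z⁻¹), ← mul_inv_eq_one]
        rw [inv_mul_eq_iff_eq_mul] at hxy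
        rw [hxy, ← mul_assoc x y⁻¹, mul_inv_cancel_right, mul_inv_cancel]
      have h2 := congrArg (Subtype.val) h1
      rw [coe_normalizerMonoidHom, coe_inv, inv_inv, mul_assoc, inv_mul_eq_iff_eq_mul] at h2
      by_contra hne
      exact hz (hc _ (x * y⁻¹).2 (fun h3 => hne (mul_inv_eq_one.1 (Subtype.ext h3))) z h2.symm)
    have hsurj := Finite.surjective_of_injective hinj
    refine l.hom_ne (MonoidHom.ext fun y => ?_)
    obtain ⟨x, rfl⟩ := hsurj y
    have h1 : (z • l).hom x = l.hom x := by rw [h]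
    rw [smul_apply] at h1
    rw [map_mul, map_inv, h1, inv_mul_cancel]
    rfl
  · intro hz
    refine NontrivialDual.ext (MonoidHom.ext fun x => ?_)
    rw [smul_apply]
    congr 1
    refine Subtype.ext ?_
    rw [coe_normalizerMonoidHom, coe_inv, inv_inv, mul_assoc, hA x x.2 z hz, inv_mul_cancel_left]

/-- The inverse of a nontrivial linear character. -/
noncomputable def bar (l : NontrivialDual A) : NontrivialDual A := 
  ⟨l.hom⁻¹, fun h => l.hom_ne (MonoidHom.ext fun x => inv_eq_one.1 (DFunLike.congr_fun h x))⟩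

theorem bar_bar (l : NontrivialDual A) : bar (bar l) = l := NontrivialDual.ext (inv_inv l.hom)

theorem smul_bar (z : normalizer (A : Set S)) (l : NontrivialDual A) : z • bar l = bar (z • l) :=
  rfl

theorem smul_ne_bar [Finite S] (hA : ∀ u ∈ A, ∀ v ∈ A, Commute u v)
    (hc : ∀ u ∈ A, u ≠ 1 → ∀ g, Commute g u → g ∈ A) (hS : Odd (Nat.card S))
    (z : normalizer (A : Set S)) (l : NontrivialDual A) : z • l ≠ bar l := by
  intro h
  have h1 : (z * z) • l = l := by rw [mul_smul, h, smul_bar, h, bar_bar]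
  rw [smul_eq_self hA hc] at h1
  obtain ⟨k, hk⟩ := hS
  have hodd : ∀ s : S, s = (s * s) ^ (k + 1) := by
    intro s
    rw [← pow_two, ← pow_mul, show 2 * (k + 1) = Nat.card S + 1 by omega, pow_succ, pow_card_eq_one',
      one_mul]
  have h2 : (z : S) ∈ A := by
    rw [hodd z]
    exact pow_mem h1 _
  rw [(smul_eq_self hA hc z l).2 h2] at h
  refine l.hom_ne (MonoidHom.ext fun x => ?_)
  have h3 : l.hom x = (l.hom x)⁻¹ := by
    conv_lhs => rw [h]
    rfl
  have h4 : l.hom x * l.hom x = 1 := by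
    nth_rewrite 1 [h3]
    rw [inv_mul_cancel]
  have h5 : x = (x * x) ^ (k + 1) := Subtype.ext (hodd x)
  rw [h5, map_pow, map_mul, h4, one_pow]
  rfl

theorem card_smul_eq [Finite S] (hA : ∀ u ∈ A, ∀ v ∈ A, Commute u v)
    (hc : ∀ u ∈ A, u ≠ 1 → ∀ g, Commute g u → g ∈ A) {l m : NontrivialDual A}
    (h : l ∈ MulAction.orbit (normalizer (A : Set S)) m) :
    Nat.card {z : normalizer (A : Set S) // z • m = l} = Nat.card A := by
  obtain ⟨w, rfl⟩ := h
  refine Nat.card_congr ((Equiv.subtypeEquiv (Equiv.mulLeft w⁻¹)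
    (p := fun z : normalizer (A : Set S) => z • m = w • m) (q := fun z : normalizer (A : Set S) => (z : S) ∈ A)
    fun z => ?_).trans ?_)
  · rw [Equiv.coe_mulLeft, ← smul_eq_self hA hc _ m, mul_smul, inv_smul_eq_iff]
  · exact
      { toFun := fun z => ⟨z.1, z.2⟩
        invFun := fun a => ⟨⟨a, le_normalizer a.2⟩, a.2⟩
        left_inv := fun _ => rfl
        right_inv := fun _ => rfl }

theorem card_orbit [Finite S] {q : ℕ} (hA : ∀ u ∈ A, ∀ v ∈ A, Commute u v)
    (hc : ∀ u ∈ A, u ≠ 1 → ∀ g, Commute g u → g ∈ A)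
    (hq : Nat.card (normalizer (A : Set S)) = Nat.card A * q) (l : NontrivialDual A) :
    Nat.card (MulAction.orbit (normalizer (A : Set S)) l) = q := by
  have h1 : MulAction.stabilizer (normalizer (A : Set S)) l = A.subgroupOf (normalizer A) := by
    ext z
    rw [MulAction.mem_stabilizer_iff, smul_eq_self hA hc, mem_subgroupOf]
  have h2 := (MulAction.stabilizer (normalizer (A : Set S)) l).card_mul_index
  rw [MulAction.index_stabilizer, h1, hq, Nat.card_congr (subgroupOfEquivOfLe le_normalizer).toEquiv,
    ← Nat.card_coe_set_eq] at h2
  exact Nat.eq_of_mul_eq_mul_left Nat.card_pos h2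

theorem card_quotient [Finite S] {q : ℕ} (hA : ∀ u ∈ A, ∀ v ∈ A, Commute u v)
    (hc : ∀ u ∈ A, u ≠ 1 → ∀ g, Commute g u → g ∈ A)
    (hq : Nat.card (normalizer (A : Set S)) = Nat.card A * q) :
    Nat.card (MulAction.orbitRel.Quotient (normalizer (A : Set S)) (NontrivialDual A)) * q + 1 =
      Nat.card A := by
  have := Fintype.ofFinite S
  have hcomm : ∀ a b : A, a * b = b * a := fun a b => Subtype.ext (hA a a.2 b b.2)
  have hfin := finite_dual hcomm
  let e : NontrivialDual A ≃ {l : A →* ℂˣ // l ≠ 1} :=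
    { toFun := fun l => ⟨l.hom, l.hom_ne⟩
      invFun := fun l => ⟨l.1, l.2⟩
      left_inv := fun _ => rfl
      right_inv := fun _ => rfl }
  have hfin' : Finite (NontrivialDual A) := Finite.of_equiv _ e.symm
  have h1 : Nat.card (NontrivialDual A) = Nat.card
      (MulAction.orbitRel.Quotient (normalizer (A : Set S)) (NontrivialDual A)) * q := by
    have := Fintype.ofFinite
      (MulAction.orbitRel.Quotient (normalizer (A : Set S)) (NontrivialDual A))
    rw [Nat.card_congr (MulAction.selfEquivSigmaOrbits (normalizer (A : Set S)) (NontrivialDual A)),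
      Nat.card_sigma, Finset.sum_congr rfl fun ω _ => ?_, Finset.sum_const, smul_eq_mul,
      Finset.card_univ, Nat.card_eq_fintype_card]
    rw [← ω.out_eq']
    exact card_orbit hA hc hq _
  rw [← h1, ← card_dual hcomm]
  have := Fintype.ofFinite (A →* ℂˣ)
  have h2 : Nat.card (NontrivialDual A) = Fintype.card {l : A →* ℂˣ // l ≠ 1} := by
    rw [← Nat.card_eq_fintype_card]
    exact Nat.card_congr e
  rw [h2, Nat.card_eq_fintype_card, Fintype.card_subtype_compl, Fintype.card_subtype_eq]
  have : 0 < Fintype.card (A →* ℂˣ) := Fintype.card_pos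
  omega

end NontrivialDual

end

end ParaNil

namespace ParaNil

open Subgroup

/-- Representatives of the conjugacy classes of nontrivial Sylow subgroups. -/
structure LocalFamily {S K : Type*} [Group S] (p q : K → ℕ) (A : K → Subgroup S) : Prop where
  data : ∀ k, LocalData (p k) (q k) (A k)
  injective : Function.Injective p
  isPGroup : ∀ k, IsPGroup (p k) (A k)
  cover : ∀ s : S, s ≠ 1 → ∃ k z, z * s * z⁻¹ ∈ A k

namespace LocalFamily

variable {S K : Type*} [Group S] {p q : K → ℕ} {A : K → Subgroup S}

theorem disjoint (h : LocalFamily p q A) {j k : K} (hjk : j ≠ k) {x z : S} (hx : x ∈ A j)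
    (hz : z * x * z⁻¹ ∈ A k) : x = 1 := by
  have h1 : x ^ p k = 1 := by
    have h2 := (h.data k).pow _ hz
    rwa [conj_pow, mul_inv_eq_one, mul_eq_left] at h2
  exact eq_one_of_pow_coprime ((Nat.coprime_primes (h.data j).hp (h.data k).hp).2
    fun h3 => hjk (h.injective h3)) ((h.data j).pow _ hx) h1

theorem card_conj [Finite S] (h : LocalFamily p q A) {k : K} {s z₀ : S} (hs : s ≠ 1)
    (hz₀ : z₀ * s * z₀⁻¹ ∈ A k) :
    Nat.card {z // z * s * z⁻¹ ∈ A k} = Nat.card (normalizer (A k : Set S)) := by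
  refine (Nat.card_congr (Equiv.subtypeEquiv (Equiv.mulRight z₀) fun z => ?_)).symm
  rw [Equiv.coe_mulRight]
  have h1 : z * z₀ * s * (z * z₀)⁻¹ = z * (z₀ * s * z₀⁻¹) * z⁻¹ := by group
  rw [h1]
  refine ⟨fun hz => (mem_normalizer_iff.1 hz _).1 hz₀, fun hz => (h.data k).isTI z _ hz₀ ?_ hz⟩
  rwa [Ne, mul_inv_eq_one, mul_eq_left]

variable [Fintype S] [Fintype K]

open scoped Classical in
theorem sum_eq (h : LocalFamily p q A) {F : S → ℂ} (hF : ∀ z s, F (z * s * z⁻¹) = F s) :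
    ∑ s, F s = F 1 + ∑ k, (Nat.card S : ℂ) / Nat.card (normalizer (A k : Set S)) *
      (∑ x : A k, F x - F 1) := by
  have hN : ∀ k, (Nat.card (normalizer (A k : Set S)) : ℂ) ≠ 0 :=
    fun k => Nat.cast_ne_zero.2 Nat.card_pos.ne'
  have h1 : ∀ s ∈ Finset.univ.erase (1 : S),
      F s = ∑ k, (∑ z : S, if z * s * z⁻¹ ∈ A k then F (z * s * z⁻¹) else 0) /
        Nat.card (normalizer (A k : Set S)) := by
    intro s hs
    have hs1 : s ≠ 1 := (Finset.mem_erase.1 hs).1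
    obtain ⟨k, z₀, hz₀⟩ := h.cover s hs1
    rw [Finset.sum_eq_single k]
    · simp only [hF]
      rw [← Finset.sum_filter, Finset.sum_const, nsmul_eq_mul, eq_div_iff (hN k), mul_comm,
        ← h.card_conj hs1 hz₀, Nat.card_eq_fintype_card, Fintype.card_subtype]
    · intro j _ hj
      rw [Finset.sum_eq_zero, zero_div]
      intro z _
      rw [if_neg]
      intro hz
      have h2 : z₀ * z⁻¹ * (z * s * z⁻¹) * (z₀ * z⁻¹)⁻¹ = z₀ * s * z₀⁻¹ := by group
      have h3 := h.disjoint hj hz (h2.symm ▸ hz₀)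
      rw [mul_inv_eq_one, mul_eq_left] at h3
      exact hs1 h3
    · simp
  rw [← Finset.add_sum_erase _ _ (Finset.mem_univ (1 : S)), Finset.sum_congr rfl h1,
    Finset.sum_comm]
  congr 1
  refine Finset.sum_congr rfl fun k _ => ?_
  rw [← Finset.sum_div, Finset.sum_comm]
  have h2 : ∀ z ∈ (Finset.univ : Finset S), (∑ s ∈ Finset.univ.erase 1,
      if z * s * z⁻¹ ∈ A k then F (z * s * z⁻¹) else 0) = ∑ x : A k, F x - F 1 := by
    intro z _
    have h3 : (∑ s, if z * s * z⁻¹ ∈ A k then F (z * s * z⁻¹) else 0) = ∑ x : A k, F x := by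
      rw [← Finset.sum_subtype (Finset.univ.filter fun s => s ∈ A k) (by simp) F, Finset.sum_filter]
      exact Fintype.sum_equiv (MulAut.conj z).toEquiv _ _ fun s => by
        by_cases hs : z * s * z⁻¹ ∈ A k <;> simp [MulAut.conj_apply, hs]
    rw [← h3, ← Finset.add_sum_erase _ _ (Finset.mem_univ (1 : S))]
    simp [one_mem]
  rw [Finset.sum_congr rfl h2, Finset.sum_const, nsmul_eq_mul, Finset.card_univ,
    ← Nat.card_eq_fintype_card]
  ring

end LocalFamily

end ParaNil

namespace ParaNil

open Subgroup

section

open scoped Classical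

variable {S I : Type*} [Group S] [Fintype S] [Fintype I] {χ : I → S → ℂ}

theorem dual_mul_inv_eq_one_iff {A : Type*} [Group A] {l m : A →* ℂˣ} : l * m⁻¹ = 1 ↔ l = m := by
  refine ⟨fun h => MonoidHom.ext fun x => ?_, fun h => MonoidHom.ext fun x => ?_⟩
  · exact mul_inv_eq_one.1 (DFunLike.congr_fun h x)
  · rw [h]
    exact mul_inv_cancel (m x)

theorem sum_conj_of_trivial {A B : Subgroup S} (l : A →* ℂˣ) (m : B →* ℂˣ) {z : S}
    (h : ∀ x ∈ A, z⁻¹ * x * z ∈ B → x = 1) :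
    (∑ x : A, ∑ y : B, if z⁻¹ * x * z = (y : S) then
      ((l x⁻¹ : ℂˣ) : ℂ) * (m y : ℂˣ) else 0) = 1 := by
  rw [Finset.sum_eq_single 1, Finset.sum_eq_single 1]
  · simp
  · intro y _ hy
    rw [if_neg]
    simpa using fun h1 : (1 : S) = y => hy (Subtype.ext h1.symm)
  · simp
  · intro x _ hx
    refine Finset.sum_eq_zero fun y _ => ?_
    rw [if_neg]
    intro h1
    exact hx (Subtype.ext (h x x.2 (h1 ▸ y.2)))
  · simp

theorem sum_conj_of_mem_normalizer {A : Subgroup S} (l m : A →* ℂˣ) (z : normalizer (A : Set S)) :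
    (∑ x : A, ∑ y : A, if (z : S)⁻¹ * x * z = (y : S) then
      ((l x⁻¹ : ℂˣ) : ℂ) * (m y : ℂˣ) else 0) =
      if m.comp (A.normalizerMonoidHom z⁻¹).toMonoidHom = l then (Nat.card A : ℂ) else 0 := by
  have h1 : ∀ x : A, (∑ y : A, if (z : S)⁻¹ * x * z = (y : S) then
      ((l x⁻¹ : ℂˣ) : ℂ) * (m y : ℂˣ) else 0) =
      ((m.comp (A.normalizerMonoidHom z⁻¹).toMonoidHom * l⁻¹) x : ℂˣ) := by
    intro x
    have h2 : (z : S)⁻¹ * x * z = (A.normalizerMonoidHom z⁻¹ x : A) := by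
      rw [NontrivialDual.coe_normalizerMonoidHom, coe_inv, inv_inv]
    rw [Finset.sum_eq_single (A.normalizerMonoidHom z⁻¹ x), if_pos h2]
    · simp [mul_comm]
    · intro y _ hy
      rw [if_neg]
      intro h3
      exact hy (Subtype.ext (h3.symm.trans h2))
    · simp
  simp only [h1]
  rw [sum_dual_apply]
  exact if_congr dual_mul_inv_eq_one_iff rfl rfl

namespace IsCharTable

theorem gram_cross (h : IsCharTable χ) {A B : Subgroup S} (l : A →* ℂˣ) (m : B →* ℂˣ)
    (hAB : ∀ z : S, ∀ x ∈ A, z⁻¹ * x * z ∈ B → x = 1) :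
    (Nat.card A : ℤ) * Nat.card B * ∑ i, mult χ l i * mult χ m i = Nat.card S := by
  have h1 := h.gram l m
  rw [Finset.sum_congr rfl fun z _ => sum_conj_of_trivial l m (hAB z)] at h1
  simp only [Finset.sum_const, Finset.card_univ, nsmul_eq_mul, mul_one] at h1
  rw [Nat.card_eq_fintype_card (α := S)]
  exact_mod_cast h1

theorem gram_self (h : IsCharTable χ) {A : Subgroup S} (hA : IsTI A) (l m : A →* ℂˣ) :
    (Nat.card A : ℤ) * Nat.card A * ∑ i, mult χ l i * mult χ m i =
      Nat.card S - Nat.card (normalizer (A : Set S)) + Nat.card A *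
      Nat.card {z : normalizer (A : Set S) //
        m.comp (A.normalizerMonoidHom z⁻¹).toMonoidHom = l} := by
  have h1 := h.gram l m
  rw [← Finset.sum_filter_add_sum_filter_not _ (fun z => z ∈ normalizer (A : Set S)),
    Finset.sum_subtype _ (p := fun z => z ∈ normalizer (A : Set S)) (by simp),
    Finset.sum_congr rfl fun z _ => sum_conj_of_mem_normalizer l m z,
    Finset.sum_congr (rfl : (Finset.univ.filter fun z => z ∉ normalizer (A : Set S)) = _) fun z hz =>
      sum_conj_of_trivial l m (z := z) fun x hx hxz => by
        by_contra hx1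
        rw [Finset.mem_filter] at hz
        refine hz.2 ((inv_mem_iff).1 (hA z⁻¹ x hx hx1 ?_))
        rwa [inv_inv]] at h1
  rw [← Finset.sum_filter, Finset.sum_const, Finset.sum_const, nsmul_eq_mul, nsmul_eq_mul, mul_one,
    Finset.filter_not, Finset.card_sdiff_of_subset (Finset.filter_subset _ _),
    Nat.cast_sub (Finset.card_le_card (Finset.filter_subset _ _)), ← Fintype.card_subtype,
    ← Fintype.card_subtype, Finset.card_univ] at h1
  have h2 : (Nat.card A : ℂ) * Nat.card A * (∑ i, mult χ l i * mult χ m i : ℤ) =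
      Nat.card S - Nat.card (normalizer (A : Set S)) + Nat.card A *
      Nat.card {z : normalizer (A : Set S) //
        m.comp (A.normalizerMonoidHom z⁻¹).toMonoidHom = l} := by
    rw [h1, Nat.card_eq_fintype_card (α := S), Nat.card_eq_fintype_card
      (α := normalizer (A : Set S)), Nat.card_eq_fintype_card
      (α := {z : normalizer (A : Set S) // m.comp (A.normalizerMonoidHom z⁻¹).toMonoidHom = l})]
    rw [add_comm, mul_comm (Nat.card A : ℂ)]
  exact_mod_cast h2

/-- The trivial character. -/
theorem exists_trivial (h : IsCharTable χ) : ∃ i₀, ∀ s, χ i₀ s = 1 := by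
  set m : I → ℤ := mult χ (1 : (⊤ : Subgroup S) →* ℂˣ) with hm
  have hg : (Nat.card S : ℤ) ≠ 0 := Nat.cast_ne_zero.2 Nat.card_pos.ne'
  have hg' : (Nat.card S : ℂ) ≠ 0 := Nat.cast_ne_zero.2 Nat.card_pos.ne'
  have htop : Nat.card (⊤ : Subgroup S) = Nat.card S := card_top
  have h1 : ∑ i, m i * m i = 1 := by
    have h2 : IsTI (⊤ : Subgroup S) := fun g _ _ _ _ => mem_normalizer_iff.2 (by simp)
    have h3 := h.gram_self h2 1 1
    have h4 : Nat.card {z : normalizer ((⊤ : Subgroup S) : Set S) //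
        (1 : (⊤ : Subgroup S) →* ℂˣ).comp
          ((⊤ : Subgroup S).normalizerMonoidHom z⁻¹).toMonoidHom = 1} =
        Nat.card (normalizer ((⊤ : Subgroup S) : Set S)) :=
      Nat.card_congr (Equiv.subtypeUnivEquiv fun z => rfl)
    have h5 : Nat.card (normalizer ((⊤ : Subgroup S) : Set S)) = Nat.card S := by
      rw [normalizer_eq_top, card_top]
    rw [h4, h5, htop, sub_self, zero_add] at h3
    exact mul_left_cancel₀ (mul_ne_zero hg hg) (h3.trans (mul_one _).symm)
  have h2 : ∀ s, ∑ i, (m i : ℂ) * χ i s = 1 := by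
    intro s
    refine mul_left_cancel₀ hg' ?_
    rw [Finset.mul_sum, ← htop]
    have h3 : ∀ i, (Nat.card (⊤ : Subgroup S) : ℂ) * ((m i : ℂ) * χ i s) =
        ∑ a : (⊤ : Subgroup S), χ i a * χ i s⁻¹⁻¹ := by
      intro i
      rw [← mul_assoc, ← h.mult_spec, Finset.sum_mul]
      simp
    simp only [h3]
    rw [Finset.sum_comm]
    simp only [h.col]
    rw [← Nat.cast_sum, mul_one, htop]
    congr 1
    have h6 : ∑ a : (⊤ : Subgroup S), Nat.card {x : S // x⁻¹ * a * x = s⁻¹} =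
        ∑ a : S, Nat.card {x : S // x⁻¹ * a * x = s⁻¹} :=
      Fintype.sum_equiv topEquiv.toEquiv _ _ fun a => rfl
    rw [h6, ← Nat.card_sigma]
    refine Nat.card_congr
      { toFun := fun y => y.2.1
        invFun := fun x => ⟨x * s⁻¹ * x⁻¹, x, by group⟩
        left_inv := ?_
        right_inv := fun _ => rfl }
    rintro ⟨a, x, hx⟩
    exact Sigma.subtype_ext (show x * s⁻¹ * x⁻¹ = a by rw [← hx]; group) rfl
  choose n hn hn' using h.deg
  obtain ⟨i₀, hi₀⟩ : ∃ i, m i ≠ 0 := by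
    by_contra! h3
    simp [h3] at h1
  have h3 := Finset.add_sum_erase Finset.univ (fun i => m i * m i) (Finset.mem_univ i₀)
  have h4 : 0 < m i₀ * m i₀ := mul_self_pos.2 hi₀
  have h5 : ∑ i ∈ Finset.univ.erase i₀, m i * m i = 0 :=
    le_antisymm (by omega) (Finset.sum_nonneg fun _ _ => mul_self_nonneg _)
  have h6 : ∀ i ∈ Finset.univ.erase i₀, m i = 0 := fun i hi => mul_self_eq_zero.1
    ((Finset.sum_eq_zero_iff_of_nonneg fun _ _ => mul_self_nonneg _).1 h5 i hi)
  have h7 : ∀ s, (m i₀ : ℂ) * χ i₀ s = 1 := by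
    intro s
    rw [← h2 s, ← Finset.add_sum_erase Finset.univ _ (Finset.mem_univ i₀),
      Finset.sum_eq_zero fun i hi => by rw [h6 i hi, Int.cast_zero, zero_mul], add_zero]
  have h8 : m i₀ = 1 := by
    have h9 := h7 1
    rw [hn'] at h9
    have h10 : m i₀ * n i₀ = 1 := by exact_mod_cast h9
    have := hn i₀
    exact Int.eq_one_of_mul_eq_one_right (by nlinarith) h10
  refine ⟨i₀, fun s => ?_⟩
  have h9 := h7 s
  rwa [h8, Int.cast_one, one_mul] at h9

theorem mult_trivial (h : IsCharTable χ) {i₀ : I} (hi₀ : ∀ s, χ i₀ s = 1) {A : Subgroup S}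
    (l : A →* ℂˣ) : mult χ l i₀ = if l = 1 then 1 else 0 := by
  have h1 := h.mult_spec l i₀
  simp only [hi₀, one_mul] at h1
  have h3 : ∑ a : A, ((l a⁻¹ : ℂˣ) : ℂ) = ∑ a : A, ((l a : ℂˣ) : ℂ) :=
    Fintype.sum_equiv (Equiv.inv A) _ _ fun a => rfl
  rw [h3, sum_dual_apply] at h1
  have h4 : (Nat.card A : ℂ) ≠ 0 := Nat.cast_ne_zero.2 Nat.card_pos.ne'
  split_ifs at h1 ⊢ with hl
  · exact_mod_cast (mul_left_cancel₀ h4 ((mul_one _).trans h1)).symm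
  · exact_mod_cast (mul_eq_zero.1 h1.symm).resolve_left h4

end IsCharTable

end

end ParaNil

namespace ParaNil

open Subgroup

section

open scoped Classical

theorem LocalData.mul_comm' {S : Type*} [Group S] {p q : ℕ} {A : Subgroup S}
    (hA : LocalData p q A) (a b : A) : a * b = b * a :=
  Subtype.ext (hA.comm a a.2 b b.2)

variable {S I : Type*} [Group S] [Fintype S] [Fintype I] {χ : I → S → ℂ}

namespace LocalData

variable {p q : ℕ} {A : Subgroup S}

theorem one_lt_card (hA : LocalData p q A) : 1 < Nat.card A := by
  rw [one_lt_card_iff_ne_bot]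
  exact hA.ne_bot

theorem finite_nontrivialDual (hA : LocalData p q A) : Finite (NontrivialDual A) := by
  have := finite_dual hA.mul_comm'
  exact Finite.of_injective NontrivialDual.hom fun _ _ h => NontrivialDual.ext h

theorem gram (h : IsCharTable χ) (hA : LocalData p q A) : ∃ κ : ℤ,
    (∑ i, mult χ (1 : A →* ℂˣ) i * mult χ (1 : A →* ℂˣ) i = κ + q) ∧
    (∀ l : NontrivialDual A, ∑ i, mult χ (1 : A →* ℂˣ) i * mult χ l.hom i = κ) ∧
    ∀ l m : NontrivialDual A, ∑ i, mult χ l.hom i * mult χ m.hom i =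
      κ + if l ∈ MulAction.orbit (normalizer (A : Set S)) m then 1 else 0 := by
  have ha : (Nat.card A : ℤ) ≠ 0 := Nat.cast_ne_zero.2 Nat.card_pos.ne'
  have ha2 := mul_ne_zero ha ha
  obtain ⟨l₀, hl₀⟩ : ∃ l : A →* ℂˣ, l ≠ 1 := by
    by_contra! h1
    have h2 := card_dual hA.mul_comm'
    have h3 : Nat.card (A →* ℂˣ) = 1 := Nat.card_eq_one_iff_exists.2 ⟨1, h1⟩
    have := hA.one_lt_card
    omega
  have h1 : ∀ l : A →* ℂˣ, l ≠ 1 → (Nat.card A : ℤ) * Nat.card A *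
      ∑ i, mult χ (1 : A →* ℂˣ) i * mult χ l i =
      Nat.card S - Nat.card (normalizer (A : Set S)) := by
    intro l hl
    rw [h.gram_self hA.isTI]
    have : IsEmpty {z : normalizer (A : Set S) //
        l.comp (A.normalizerMonoidHom z⁻¹).toMonoidHom = 1} := by
      refine ⟨fun z => hl (MonoidHom.ext fun x => ?_)⟩
      have h2 := DFunLike.congr_fun z.2 (A.normalizerMonoidHom z.1 x)
      have h3 : l (A.normalizerMonoidHom z.1⁻¹ (A.normalizerMonoidHom z.1 x)) = 1 := h2
      rwa [map_inv, MulAut.inv_apply_self] at h3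
    have h0 : Nat.card {z : normalizer (A : Set S) //
        l.comp (A.normalizerMonoidHom z⁻¹).toMonoidHom = 1} = 0 := Nat.card_of_isEmpty
    rw [h0, Nat.cast_zero, mul_zero, add_zero]
  refine ⟨∑ i, mult χ (1 : A →* ℂˣ) i * mult χ l₀ i, ?_, fun l => ?_, fun l m => ?_⟩
  · refine mul_left_cancel₀ ha2 ?_
    rw [mul_add, h1 l₀ hl₀, h.gram_self hA.isTI]
    have h4 : Nat.card {z : normalizer (A : Set S) //
        (1 : A →* ℂˣ).comp (A.normalizerMonoidHom z⁻¹).toMonoidHom = 1} =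
        Nat.card (normalizer (A : Set S)) :=
      Nat.card_congr (Equiv.subtypeUnivEquiv fun z => rfl)
    rw [h4, hA.card_normalizer]
    push_cast
    ring
  · refine mul_left_cancel₀ ha2 ?_
    rw [h1 l₀ hl₀, h1 l.hom l.hom_ne]
  · refine mul_left_cancel₀ ha2 ?_
    rw [mul_add, h1 l₀ hl₀, h.gram_self hA.isTI]
    congr 1
    have h4 : Nat.card {z : normalizer (A : Set S) //
        m.hom.comp (A.normalizerMonoidHom z⁻¹).toMonoidHom = l.hom} =
        Nat.card {z : normalizer (A : Set S) // z • m = l} :=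
      Nat.card_congr (Equiv.subtypeEquivRight fun z =>
        (NontrivialDual.ext_iff (x := z • m) (y := l)).symm)
    rw [h4]
    split_ifs with hlm
    · rw [NontrivialDual.card_smul_eq hA.comm hA.cent hlm, mul_one]
    · have : IsEmpty {z : normalizer (A : Set S) // z • m = l} := ⟨fun z => hlm ⟨z.1, z.2⟩⟩
      have h0 : Nat.card {z : normalizer (A : Set S) // z • m = l} = 0 := Nat.card_of_isEmpty
      rw [h0, Nat.cast_zero, mul_zero, mul_zero]

end LocalData

theorem IsCharTable.mult_smul (h : IsCharTable χ) {A : Subgroup S} (z : normalizer (A : Set S))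
    (l : NontrivialDual A) (i : I) : mult χ (z • l).hom i = mult χ l.hom i := by
  have ha : (Nat.card A : ℂ) ≠ 0 := Nat.cast_ne_zero.2 Nat.card_pos.ne'
  have h1 : (mult χ (z • l).hom i : ℂ) = mult χ l.hom i := by
    refine mul_left_cancel₀ ha ?_
    rw [← h.mult_spec, ← h.mult_spec]
    refine Fintype.sum_equiv (A.normalizerMonoidHom z⁻¹).toEquiv _ _ fun a => ?_
    rw [NontrivialDual.smul_apply, map_inv (A.normalizerMonoidHom z⁻¹)]
    congr 1
    rw [← h.conj i ((z⁻¹ : normalizer (A : Set S)) : S) a]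
    rfl
  exact_mod_cast h1

theorem LocalFamily.multData {K : Type*} [Fintype K] {p q : K → ℕ} {A : K → Subgroup S}
    (hA : LocalFamily p q A) (h : IsCharTable χ) (hS : Odd (Nat.card S)) {i₀ : I}
    (hi₀ : ∀ s, χ i₀ s = 1) {n : I → ℤ} (hn : ∀ i, 0 < n i) (hn' : ∀ i, χ i 1 = n i)
    [∀ k, Fintype (MulAction.orbitRel.Quotient (normalizer (A k : Set S)) (NontrivialDual (A k)))] :
    MultData (Ω := fun k =>
      MulAction.orbitRel.Quotient (normalizer (A k : Set S)) (NontrivialDual (A k)))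
      i₀ n (fun _ x => Quotient.mk _ (Quotient.out x).bar)
      (fun _ o => mult χ (o.elim 1 fun x => (Quotient.out x).hom)) (fun k => q k) := by
  have hmk : ∀ k (x y : NontrivialDual (A k)),
      (Quotient.mk (MulAction.orbitRel (normalizer (A k : Set S)) _) x = Quotient.mk _ y) ↔
        x ∈ MulAction.orbit (normalizer (A k : Set S)) y := fun k x y => Quotient.eq
  have hg : (Nat.card S : ℂ) ≠ 0 := Nat.cast_ne_zero.2 Nat.card_pos.ne'
  constructor
  · have h1 := hA.sum_eq (F := fun s => ∑ i, χ i s * χ i s⁻¹) fun z s => by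
      refine Finset.sum_congr rfl fun i _ => ?_
      rw [show (z * s * z⁻¹)⁻¹ = z * s⁻¹ * z⁻¹ from by group, h.conj, h.conj]
    rw [Finset.sum_comm, Finset.sum_congr rfl fun i _ => h.row i] at h1
    simp only [h.col] at h1
    have h2 : Nat.card {x : S // x⁻¹ * 1 * x = 1} = Nat.card S :=
      Nat.card_congr (Equiv.subtypeUnivEquiv fun x => by simp)
    have h3 : ∀ k, (Nat.card S : ℂ) / Nat.card (normalizer (A k : Set S)) *
        (∑ x : A k, (Nat.card {y : S // y⁻¹ * x * y = x} : ℂ) - Nat.card S) =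
        Nat.card S * Fintype.card
        (MulAction.orbitRel.Quotient (normalizer (A k : Set S)) (NontrivialDual (A k))) := by
      intro k
      have hk := hA.data k
      have h4 : ∀ x ∈ (Finset.univ : Finset (A k)).erase 1,
          (Nat.card {y : S // y⁻¹ * x * y = x} : ℂ) = Nat.card (A k) := by
        intro x hx
        congr 1
        refine Nat.card_congr (Equiv.subtypeEquivRight fun y => ?_)
        rw [mul_assoc, inv_mul_eq_iff_eq_mul]
        refine ⟨fun h5 => hk.cent x x.2 (fun h6 => (Finset.mem_erase.1 hx).1 (Subtype.ext h6)) y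
          h5.symm, fun h5 => hk.comm x x.2 y h5⟩
      have ha : (Nat.card (A k) : ℂ) ≠ 0 := Nat.cast_ne_zero.2 Nat.card_pos.ne'
      have hq : (q k : ℂ) ≠ 0 := Nat.cast_ne_zero.2 hk.hq.ne_zero
      rw [← Finset.add_sum_erase _ _ (Finset.mem_univ (1 : A k)), Finset.sum_congr rfl h4, coe_one,
        h2, add_sub_cancel_left, Finset.sum_const, Finset.card_erase_of_mem (Finset.mem_univ _),
        Finset.card_univ, hk.card_normalizer, nsmul_eq_mul, ← Nat.card_eq_fintype_card,
        ← NontrivialDual.card_quotient hk.comm hk.cent hk.card_normalizer,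
        ← Nat.card_eq_fintype_card, Nat.add_sub_cancel]
      rw [NontrivialDual.card_quotient hk.comm hk.cent hk.card_normalizer]
      push_cast
      field_simp
    rw [h2, Finset.sum_congr rfl fun k _ => h3 k, ← Finset.mul_sum, Finset.sum_const,
      Finset.card_univ, nsmul_eq_mul] at h1
    have h4 : (Fintype.card I : ℂ) = 1 + ∑ k, (Fintype.card (MulAction.orbitRel.Quotient
        (normalizer (A k : Set S)) (NontrivialDual (A k))) : ℂ) := by
      refine mul_left_cancel₀ hg ?_
      rw [mul_comm, h1]
      ring
    exact_mod_cast h4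
  · exact hn
  · intro k x
    conv_rhs => rw [← Quotient.out_eq x]
    rw [hmk]
    obtain ⟨z, hz⟩ := (hmk k _ _).1 (Quotient.out_eq (Quotient.mk _ (Quotient.out x).bar))
    refine ⟨z, ?_⟩
    simp only at hz ⊢
    rw [← hz, ← NontrivialDual.smul_bar, NontrivialDual.bar_bar]
  · intro k x hx
    conv_rhs at hx => rw [← Quotient.out_eq x]
    rw [hmk] at hx
    obtain ⟨z, hz⟩ := hx
    exact NontrivialDual.smul_ne_bar (hA.data k).comm (hA.data k).cent hS z _ hz
  · intro k
    exact (h.mult_trivial hi₀ 1).trans (if_pos rfl)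
  · intro k x
    exact (h.mult_trivial hi₀ _).trans (if_neg (Quotient.out x).hom_ne)
  · intro k x y
    have h1 : ∀ l : A k →* ℂˣ, ((∑ i, n i * mult χ l i : ℤ) : ℂ) = Nat.card S / Nat.card (A k) := by
      intro l
      have ha : (Nat.card (A k) : ℂ) ≠ 0 := Nat.cast_ne_zero.2 Nat.card_pos.ne'
      rw [eq_div_iff ha, mul_comm, ← h.sum_deg_mul_mult l]
      push_cast
      simp only [hn']
    exact_mod_cast (h1 _).trans (h1 _).symm
  · intro k
    obtain ⟨κ, h1, h2, h3⟩ := (hA.data k).gram h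
    refine ⟨κ, h1, fun x => h2 _, fun x y => (h3 _ _).trans ?_⟩
    rw [← hmk, Quotient.out_eq, Quotient.out_eq]
  · intro j k hjk
    have hne : (Nat.card (A j) : ℤ) * Nat.card (A k) ≠ 0 :=
      mul_ne_zero (Nat.cast_ne_zero.2 Nat.card_pos.ne') (Nat.cast_ne_zero.2 Nat.card_pos.ne')
    have h1 := fun l m => h.gram_cross (A := A j) (B := A k) l m fun z x hx hz =>
      hA.disjoint hjk hx (z := z⁻¹) (by rwa [inv_inv])
    refine ⟨∑ i, mult χ (1 : A j →* ℂˣ) i * mult χ (1 : A k →* ℂˣ) i, fun x y => ?_⟩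
    exact mul_left_cancel₀ hne ((h1 _ _).trans (h1 _ _).symm)

end

end ParaNil

namespace ParaNil

open Subgroup

section

open scoped Classical

theorem card_mul_card_le_variance {Λ : Type*} [Fintype Λ] (m : Λ → ℤ) (v : ℤ) :
    (Fintype.card {l // m l = v} : ℤ) * Fintype.card {l // m l ≠ v} ≤
      Fintype.card Λ * ∑ l, m l ^ 2 - (∑ l, m l) ^ 2 := by
  have h1 : ∑ i, ∑ j, (m i - m j) ^ 2 =
      2 * (Fintype.card Λ * ∑ l, m l ^ 2 - (∑ l, m l) ^ 2) := by
    have : ∀ i j, (m i - m j) ^ 2 = m i ^ 2 + m j ^ 2 - 2 * (m i * m j) := fun i j => by ring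
    simp only [this, Finset.sum_sub_distrib, Finset.sum_add_distrib, Finset.sum_const,
      Finset.card_univ, nsmul_eq_mul, ← Finset.mul_sum, ← Finset.sum_mul]
    ring
  have h2 : ∑ i, ∑ j, ((if m i = v then (1 : ℤ) else 0) * (if m j ≠ v then 1 else 0) +
      (if m i ≠ v then 1 else 0) * (if m j = v then 1 else 0)) ≤ ∑ i, ∑ j, (m i - m j) ^ 2 := by
    refine Finset.sum_le_sum fun i _ => Finset.sum_le_sum fun j _ => ?_
    by_cases hi : m i = v <;> by_cases hj : m j = v
    · simp [hi, hj]
    · have : 0 < (v - m j) ^ 2 := by have : v - m j ≠ 0 := fun h => hj (by linarith); positivity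
      rw [if_pos hi, if_pos hj, if_neg (not_not.2 hi), if_neg hj, hi]
      linarith
    · have : 0 < (m i - v) ^ 2 := by have : m i - v ≠ 0 := fun h => hi (by linarith); positivity
      rw [if_neg hi, if_neg (not_not.2 hj), if_pos hi, if_pos hj, hj]
      linarith
    · simp [hi, hj, sq_nonneg]
  simp only [Finset.sum_add_distrib, ← Finset.mul_sum, ← Finset.sum_mul] at h2
  have h3 : ∑ i, (if m i = v then (1 : ℤ) else 0) = Fintype.card {l // m l = v} := by
    rw [Finset.sum_boole, Fintype.card_subtype]
  have h4 : ∑ i, (if m i ≠ v then (1 : ℤ) else 0) = Fintype.card {l // m l ≠ v} := by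
    rw [Finset.sum_boole, Fintype.card_subtype]
  rw [h3, h4, h1] at h2
  linarith

theorem mul_sub_le_variance {Λ : Type*} [Fintype Λ] (m : Λ → ℤ) (v : ℤ) {q : ℕ}
    (h1 : q ≤ Nat.card {l // m l = v}) (h2 : q ≤ Nat.card {l // m l ≠ v}) :
    (q : ℤ) * (Fintype.card Λ - q) ≤ Fintype.card Λ * ∑ l, m l ^ 2 - (∑ l, m l) ^ 2 := by
  refine le_trans ?_ (card_mul_card_le_variance m v)
  rw [Nat.card_eq_fintype_card] at h1 h2
  have h3 : Fintype.card {l // m l = v} + Fintype.card {l // m l ≠ v} = Fintype.card Λ := by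
    rw [Fintype.card_subtype_compl]
    exact Nat.add_sub_cancel' (Fintype.card_subtype_le _)
  rw [← h3]
  push_cast
  zify at h1 h2
  nlinarith [mul_nonneg (sub_nonneg.2 h1) (sub_nonneg.2 h2)]

namespace LocalFamily

variable {S K : Type*} [Group S] {p q : K → ℕ} {A : K → Subgroup S}

theorem exists_ne [Finite S] (h : LocalFamily p q A) (j : K) : ∃ k, k ≠ j ∧ p k = q j := by
  have := Fact.mk (h.data j).hq
  have h1 : q j ∣ Nat.card S := by
    refine dvd_trans ?_ (card_subgroup_dvd_card (normalizer (A j : Set S)))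
    rw [(h.data j).card_normalizer]
    exact dvd_mul_left _ _
  obtain ⟨x, hx⟩ := exists_prime_orderOf_dvd_card' (q j) h1
  have hx1 : x ≠ 1 := fun h2 => (h.data j).hq.ne_one (by rw [← hx, h2, orderOf_one])
  obtain ⟨k, z, hz⟩ := h.cover x hx1
  have h2 : x ^ p k = 1 := by
    have h2 := (h.data k).pow _ hz
    rwa [conj_pow, mul_inv_eq_one, mul_eq_left] at h2
  have h3 : p k = q j := by
    have h4 := orderOf_dvd_of_pow_eq_one h2
    rw [hx] at h4
    exact ((Nat.prime_dvd_prime_iff_eq (h.data j).hq (h.data k).hp).1 h4).symm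
  exact ⟨k, fun h4 => (h.data j).hpq (h4 ▸ h3), h3⟩

theorem coprime_card [Finite S] (h : LocalFamily p q A) {j k : K} (hjk : j ≠ k) :
    (Nat.card (A j)).Coprime (Nat.card (A k)) := by
  have := Fact.mk (h.data j).hp
  have := Fact.mk (h.data k).hp
  exact IsPGroup.coprime_card_of_ne _ (p k) (fun h1 => hjk (h.injective h1)) _ _
    (h.isPGroup j) (h.isPGroup k)

theorem card_ne [Finite S] (h : LocalFamily p q A) {j k : K} (hjk : j ≠ k) :
    Nat.card (A j) ≠ Nat.card (A k) := by
  intro h1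
  have h2 := h.coprime_card hjk
  rw [h1, Nat.coprime_self] at h2
  have := Fintype.ofFinite S
  exact (h.data k).one_lt_card.ne' h2

variable [Fintype K]

theorem class_eq [Finite S] (h : LocalFamily p q A) :
    1 / (Nat.card S : ℝ) + ∑ k, ((Nat.card (MulAction.orbitRel.Quotient
      (normalizer (A k : Set S)) (NontrivialDual (A k))) : ℝ) / Nat.card (A k)) = 1 := by
  have := Fintype.ofFinite S
  have h1 := h.sum_eq (F := fun _ => 1) fun _ _ => rfl
  have hS : (Nat.card S : ℝ) ≠ 0 := Nat.cast_ne_zero.2 Nat.card_pos.ne'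
  have h2 : ∀ k, (Nat.card S : ℂ) / Nat.card (normalizer (A k : Set S)) *
      (∑ _x : A k, (1 : ℂ) - 1) = ((Nat.card S * ((Nat.card (MulAction.orbitRel.Quotient
      (normalizer (A k : Set S)) (NontrivialDual (A k))) : ℝ) / Nat.card (A k)) : ℝ) : ℂ) := by
    intro k
    have hk := h.data k
    have ha : (Nat.card (A k) : ℂ) ≠ 0 := Nat.cast_ne_zero.2 Nat.card_pos.ne'
    have hq : (q k : ℂ) ≠ 0 := Nat.cast_ne_zero.2 hk.hq.ne_zero
    have h3 : (Nat.card (A k) : ℂ) = (Nat.card (MulAction.orbitRel.Quotient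
        (normalizer (A k : Set S)) (NontrivialDual (A k))) : ℂ) * q k + 1 := by
      exact_mod_cast (NontrivialDual.card_quotient hk.comm hk.cent hk.card_normalizer).symm
    rw [Finset.sum_const, Finset.card_univ, ← Nat.card_eq_fintype_card, nsmul_one,
      hk.card_normalizer]
    push_cast
    have h4 : (Nat.card (A k) : ℂ) - 1 = (Nat.card (MulAction.orbitRel.Quotient
        (normalizer (A k : Set S)) (NontrivialDual (A k))) : ℂ) * q k := by rw [h3]; ring
    rw [h4]
    field_simp
  rw [Finset.sum_congr rfl fun k _ => h2 k, Finset.sum_const, Finset.card_univ, nsmul_one,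
    ← Nat.card_eq_fintype_card] at h1
  have h3 : (Nat.card S : ℝ) = 1 + ∑ k, Nat.card S * ((Nat.card (MulAction.orbitRel.Quotient
      (normalizer (A k : Set S)) (NontrivialDual (A k))) : ℝ) / Nat.card (A k)) := by
    exact_mod_cast h1
  rw [← Finset.mul_sum] at h3
  refine mul_left_cancel₀ hS ?_
  rw [mul_add, mul_one_div_cancel hS, mul_one]
  exact h3.symm

variable [Fintype S] {I : Type*} [Fintype I] {χ : I → S → ℂ}

theorem row_eq (hA : LocalFamily p q A) (h : IsCharTable χ)
    [∀ k, Fintype (A k →* ℂˣ)] {t : I} {n : ℤ} (hn : χ t 1 = n) :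
    (n ^ 2 : ℝ) / Nat.card S + ∑ k, (((Nat.card (A k) * ∑ l : A k →* ℂˣ, mult χ l t ^ 2 -
      (∑ l : A k →* ℂˣ, mult χ l t) ^ 2 : ℤ) : ℝ) / (Nat.card (A k) * q k)) = 1 := by
  have h1 := hA.sum_eq (F := fun s => χ t s * χ t s⁻¹) fun z s => by
    rw [show (z * s * z⁻¹)⁻¹ = z * s⁻¹ * z⁻¹ from by group, h.conj, h.conj]
  have hS : (Nat.card S : ℝ) ≠ 0 := Nat.cast_ne_zero.2 Nat.card_pos.ne'
  have h2 : ∀ k, (Nat.card S : ℂ) / Nat.card (normalizer (A k : Set S)) *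
      (∑ x : A k, χ t x * χ t (x : S)⁻¹ - n * n) =
      ((Nat.card S * (((Nat.card (A k) * ∑ l : A k →* ℂˣ, mult χ l t ^ 2 -
      (∑ l : A k →* ℂˣ, mult χ l t) ^ 2 : ℤ) : ℝ) / (Nat.card (A k) * q k)) : ℝ) : ℂ) := by
    intro k
    have hk := hA.data k
    rw [← h.sum_sq hk.mul_comm', ← hn, ← h.sum_mult (A := A k) hk.mul_comm' t, hk.card_normalizer]
    push_cast
    ring
  rw [inv_one, hn, Finset.sum_congr rfl fun k _ => h2 k, h.row] at h1
  have h3 : (Nat.card S : ℝ) = n * n + ∑ k, Nat.card S *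
      (((Nat.card (A k) * ∑ l : A k →* ℂˣ, mult χ l t ^ 2 -
      (∑ l : A k →* ℂˣ, mult χ l t) ^ 2 : ℤ) : ℝ) / (Nat.card (A k) * q k)) := by
    exact_mod_cast h1
  rw [← Finset.mul_sum] at h3
  refine mul_left_cancel₀ hS ?_
  rw [mul_add, mul_div_cancel₀ _ hS, mul_one, sq]
  exact h3.symm

end LocalFamily

end

end ParaNil

namespace ParaNil

open Subgroup

section

open scoped Classical

theorem one_le_of_estimates {g a l q out r : ℝ} (hl : 2 ≤ l) (hq : 2 ≤ q)
    (ha : a = l * q + 1) (hg : a * (a + 2) ≤ g) (hr : r ≤ (q - 1) / (a + 2))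
    (hout : out + (a - q) / a < 1) : 1 / g + (l / a + (r + out)) < 1 := by
  have ha0 : 0 < a := by rw [ha]; positivity
  have h1 : 1 / g ≤ 1 / (a * (a + 2)) := one_div_le_one_div_of_le (by positivity) hg
  have h2 : 1 / (a * (a + 2)) + (l / a + (q - 1) / (a + 2)) ≤ (a - q) / a := by
    rw [← sub_nonneg]
    have h3 : (a - q) / a - (1 / (a * (a + 2)) + (l / a + (q - 1) / (a + 2))) =
        ((l - 2) * (q - 1) * (a + 2) + 2 * (q - 1) - 1) / (a * (a + 2)) := by
      field_simp
      rw [ha]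
      ring
    rw [h3]
    refine div_nonneg ?_ (by positivity)
    nlinarith [mul_nonneg (mul_nonneg (sub_nonneg.2 hl) (by linarith : 0 ≤ q - 1))
      (by positivity : 0 ≤ a + 2)]
  linarith

namespace LocalFamily

variable {S K : Type*} [Group S] [Finite S] [Finite K] [Nonempty K] {p q : K → ℕ}
  {A : K → Subgroup S}

theorem not_odd_card (hA : LocalFamily p q A) : ¬ Odd (Nat.card S) := by
  intro hS
  have := Fintype.ofFinite S
  have := Fintype.ofFinite K
  obtain ⟨m, χ, h⟩ := exists_isCharTable S
  obtain ⟨i₀, hi₀⟩ := h.exists_trivial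
  choose n hn hn' using h.deg
  have hfin : ∀ k, Finite (A k →* ℂˣ) := fun k => finite_dual (hA.data k).mul_comm'
  have hfin' := fun k => (hA.data k).finite_nontrivialDual
  let _ : ∀ k, Fintype (A k →* ℂˣ) := fun k => Fintype.ofFinite _
  let _ : ∀ k, Fintype (MulAction.orbitRel.Quotient (normalizer (A k : Set S))
    (NontrivialDual (A k))) := fun k => Fintype.ofFinite _
  obtain ⟨j, hj⟩ := Finite.exists_min fun k => Nat.card (A k)
  have hdata := fun k => hA.data k
  have hcq := fun k => NontrivialDual.card_quotient (hdata k).comm (hdata k).cent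
    (hdata k).card_normalizer
  have hM := hA.multData h hS hi₀ (n := fun i => (n i : ℤ))
    (fun i => Int.natCast_pos.2 (hn i)) (fun i => by rw [hn']; norm_cast)
  have : Nonempty (MulAction.orbitRel.Quotient (normalizer (A j : Set S))
      (NontrivialDual (A j))) := by
    by_contra h1
    rw [not_nonempty_iff] at h1
    have h2 := hcq j
    rw [Nat.card_of_isEmpty, zero_mul, zero_add] at h2
    exact (hdata j).one_lt_card.ne h2
  obtain ⟨o⟩ := this
  obtain ⟨t, T, hto, hjT, hT, hout⟩ := hM.exists_pos_constituent j o
  have hrow := hA.row_eq h (t := t) (n := n t) (by rw [hn']; norm_cast)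
  have hcls := hA.class_eq
  set ℓ : K → ℕ := fun k => Nat.card (MulAction.orbitRel.Quotient
    (normalizer (A k : Set S)) (NontrivialDual (A k))) with hℓ
  set V : K → ℤ := fun k => Nat.card (A k) * ∑ l : A k →* ℂˣ, mult χ l t ^ 2 -
      (∑ l : A k →* ℂˣ, mult χ l t) ^ 2 with hV
  have hcard : ∀ k, (Fintype.card (A k →* ℂˣ) : ℤ) = Nat.card (A k) := fun k => by
    rw [← Nat.card_eq_fintype_card, card_dual (hdata k).mul_comm']
  have hV0 : ∀ k, 0 ≤ V k := by
    intro k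
    have h1 := mul_sub_le_variance (fun l : A k →* ℂˣ => mult χ l t) 0 (q := 0)
      (Nat.zero_le _) (Nat.zero_le _)
    rw [hcard] at h1
    simpa [hV] using h1
  have hVout : ∀ k ∉ T, k ≠ j → (Nat.card (A k) : ℤ) - 1 ≤ V k := by
    intro k hkT hkj
    obtain ⟨x, hx⟩ := hout k hkT hkj
    have h1 := mul_sub_le_variance (fun l : A k →* ℂˣ => mult χ l t) (mult χ (1 : A k →* ℂˣ) t)
      (q := 1) (Nat.succ_le_of_lt (Finite.card_pos_iff.2 ⟨1, rfl⟩))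
      (Nat.succ_le_of_lt (Finite.card_pos_iff.2 ⟨(Quotient.out x).hom, hx⟩))
    rw [hcard] at h1
    simpa [hV] using h1
  have horb : ∀ {P : ℤ → Prop} (l : NontrivialDual (A j)), P (mult χ l.hom t) →
      q j ≤ Nat.card {l : A j →* ℂˣ // P (mult χ l t)} := by
    intro P l hl
    rw [← NontrivialDual.card_orbit (hdata j).comm (hdata j).cent (hdata j).card_normalizer l]
    refine Nat.card_le_card_of_injective (fun y => ⟨y.1.hom, ?_⟩) fun y z hyz => ?_
    · obtain ⟨z, hz⟩ := y.2
      rw [← hz]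
      exact (h.mult_smul z l t).symm ▸ hl
    · exact Subtype.ext (NontrivialDual.ext (congrArg Subtype.val hyz))
  have hVj : (q j : ℤ) * (Nat.card (A j) - q j) ≤ V j := by
    have h1 := mul_sub_le_variance (fun l : A j →* ℂˣ => mult χ l t)
      (mult χ (Quotient.out o).hom t) (q := q j)
      (horb (P := fun v => v = mult χ (Quotient.out o).hom t) (Quotient.out o) rfl)
      (horb (P := fun v => v ≠ mult χ (Quotient.out o).hom t) _ hto.symm)
    rw [hcard] at h1
    exact h1
  have hodd : ∀ k, Odd (Nat.card (A k)) := fun k =>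
    Odd.of_dvd_nat hS (card_subgroup_dvd_card (A k))
  have hge : ∀ k ≠ j, Nat.card (A j) + 2 ≤ Nat.card (A k) := by
    intro k hk
    have h1 := hj k
    have h2 := hA.card_ne hk
    obtain ⟨u, hu⟩ := hodd k
    obtain ⟨v, hv⟩ := hodd j
    omega
  have hapos : ∀ k, (0 : ℝ) < Nat.card (A k) := fun k => Nat.cast_pos.2 Nat.card_pos
  have hqpos : ∀ k, (0 : ℝ) < q k := fun k => Nat.cast_pos.2 (hdata k).hq.pos
  have hSpos : (0 : ℝ) < Nat.card S := Nat.cast_pos.2 Nat.card_pos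
  have hcqR : ∀ k, (ℓ k : ℝ) * q k + 1 = Nat.card (A k) := fun k => by exact_mod_cast hcq k
  have hl2 : 2 ≤ ℓ j := by
    have h1 := hM.invol_ne j o
    rw [hℓ]
    simp only
    rw [Nat.card_eq_fintype_card]
    exact Fintype.one_lt_card_iff.2 ⟨_, _, h1⟩
  obtain ⟨k₀, hk₀, -⟩ := hA.exists_ne j
  have hg : Nat.card (A j) * (Nat.card (A j) + 2) ≤ Nat.card S :=
    (Nat.mul_le_mul_left _ (hge k₀ hk₀)).trans (Nat.le_of_dvd Nat.card_pos
      ((hA.coprime_card hk₀.symm).mul_dvd_of_dvd_of_dvd (card_subgroup_dvd_card _)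
        (card_subgroup_dvd_card _)))
  have hsplit : ∀ F : K → ℝ, ∑ k, F k = F j + (∑ k ∈ T, F k +
      ∑ k ∈ (Finset.univ.erase j).filter (· ∉ T), F k) := by
    intro F
    rw [← Finset.add_sum_erase _ _ (Finset.mem_univ j),
      ← Finset.sum_filter_add_sum_filter_not (Finset.univ.erase j) (· ∈ T)]
    congr 3
    ext k
    simp only [Finset.mem_filter, Finset.mem_erase, Finset.mem_univ, and_true]
    exact ⟨fun h => h.2, fun h => ⟨fun h2 => hjT (h2 ▸ h), h⟩⟩
  rw [hsplit] at hcls hrow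
  have hn2 : (0 : ℝ) < (n t : ℤ) ^ 2 / Nat.card S := by
    have : (0 : ℝ) < ((n t : ℤ) : ℝ) := by exact_mod_cast hn t
    positivity
  have h1 : ((Nat.card (A j) : ℝ) - q j) / Nat.card (A j) ≤
      (V j : ℝ) / (Nat.card (A j) * q j) := by
    rw [div_le_div_iff₀ (hapos j) (mul_pos (hapos j) (hqpos j))]
    have h2 : (q j : ℝ) * (Nat.card (A j) - q j) ≤ V j := by exact_mod_cast hVj
    nlinarith [hapos j]
  have h2 : 0 ≤ ∑ k ∈ T, (V k : ℝ) / (Nat.card (A k) * q k) :=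
    Finset.sum_nonneg fun k _ => div_nonneg (by exact_mod_cast hV0 k)
      (mul_pos (hapos k) (hqpos k)).le
  have h3 : ∑ k ∈ (Finset.univ.erase j).filter (· ∉ T), (ℓ k : ℝ) / Nat.card (A k) ≤
      ∑ k ∈ (Finset.univ.erase j).filter (· ∉ T), (V k : ℝ) / (Nat.card (A k) * q k) := by
    refine Finset.sum_le_sum fun k hk => ?_
    rw [Finset.mem_filter, Finset.mem_erase] at hk
    have h4 : (Nat.card (A k) : ℝ) - 1 ≤ V k := by exact_mod_cast hVout k hk.2 hk.1.1
    rw [← hcqR k, add_sub_cancel_right] at h4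
    rw [div_le_div_iff₀ (hapos k) (mul_pos (hapos k) (hqpos k))]
    nlinarith [hapos k]
  have h4 : ∑ k ∈ T, (ℓ k : ℝ) / Nat.card (A k) ≤ ((q j : ℝ) - 1) / (Nat.card (A j) + 2) := by
    have h5 : ∑ k ∈ T, (ℓ k : ℝ) ≤ (q j : ℝ) - 1 := by
      have h6 : ∑ k ∈ T, (ℓ k : ℤ) ≤ q j - 1 := by
        simpa only [hℓ, Nat.card_eq_fintype_card] using hT
      exact_mod_cast h6
    have h7 : (0 : ℝ) < Nat.card (A j) + 2 := by linarith [hapos j]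
    calc _ ≤ ∑ k ∈ T, (ℓ k : ℝ) / (Nat.card (A j) + 2) := by
          refine Finset.sum_le_sum fun k hk => ?_
          have h8 : (Nat.card (A j) : ℝ) + 2 ≤ Nat.card (A k) := by
            exact_mod_cast hge k fun h9 => hjT (h9 ▸ hk)
          exact div_le_div_of_nonneg_left (Nat.cast_nonneg _) h7 h8
      _ = (∑ k ∈ T, (ℓ k : ℝ)) / (Nat.card (A j) + 2) := (Finset.sum_div _ _ _).symm
      _ ≤ _ := div_le_div_of_nonneg_right h5 h7.le
  refine (one_le_of_estimates (g := Nat.card S) (by exact_mod_cast hl2)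
    (by exact_mod_cast (hdata j).hq.two_le) (hcqR j).symm (by exact_mod_cast hg) h4
    (out := ∑ k ∈ (Finset.univ.erase j).filter (· ∉ T), (ℓ k : ℝ) / Nat.card (A k)) ?_).ne hcls
  linarith

end LocalFamily

theorem Setting.exists_localFamily {S : Type*} [Group S] (h : Setting S) :
    ∃ (p q : {p // p ∈ (Nat.card S).primeFactors} → ℕ)
      (A : {p // p ∈ (Nat.card S).primeFactors} → Subgroup S), LocalFamily p q A ∧
      ∀ k, p k = k := by
  have := h.finite
  have h1 : ∀ k : {p // p ∈ (Nat.card S).primeFactors}, ∃ (q : ℕ) (A : Subgroup S),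
      LocalData k.1 q A ∧ IsPGroup k A ∧ ∃ P : Sylow k.1 S, (P : Subgroup S) = A := by
    intro k
    have hk := Nat.mem_primeFactors.1 k.2
    have := Fact.mk hk.1
    obtain ⟨P⟩ : Nonempty (Sylow k.1 S) := inferInstance
    obtain ⟨q, hq⟩ := h.exists_localData P (P.ne_bot_of_dvd_card hk.2.1)
    exact ⟨q, P, hq, P.isPGroup', P, rfl⟩
  choose q A hA hAp P hP using h1
  refine ⟨fun k => k.1, q, A, ⟨hA, Subtype.val_injective, hAp, fun s hs => ?_⟩, fun _ => rfl⟩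
  obtain ⟨p, hp, Q, hQ, hsQ⟩ := h.exists_sylow_mem hs
  have hpd : p ∣ Nat.card S := by
    refine dvd_trans ?_ (card_subgroup_dvd_card (Q : Subgroup S))
    obtain ⟨n, hn⟩ := IsPGroup.iff_card.1 Q.isPGroup'
    rw [hn]
    refine dvd_pow_self p fun h0 => hQ ?_
    rw [h0, pow_zero] at hn
    exact card_eq_one.1 hn
  let k : {p // p ∈ (Nat.card S).primeFactors} :=
    ⟨p, Nat.mem_primeFactors.2 ⟨hp.out, hpd, Nat.card_pos.ne'⟩⟩
  obtain ⟨z, hz⟩ := MulAction.exists_smul_eq S Q (P k)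
  refine ⟨k, z, ?_⟩
  rw [← hP k]
  change z * s * z⁻¹ ∈ P k
  rw [← hz]
  exact Subgroup.smul_mem_pointwise_smul s (MulAut.conj z) (Q : Subgroup S) hsQ

theorem Setting.two_dvd_card {S : Type*} [Group S] (h : Setting S) : 2 ∣ Nat.card S := by
  have := h.finite
  have := h.simple
  obtain ⟨p, q, A, hA, -⟩ := h.exists_localFamily
  obtain ⟨s, hs⟩ := exists_ne (1 : S)
  obtain ⟨k, -⟩ := hA.cover s hs
  have : Nonempty {p // p ∈ (Nat.card S).primeFactors} := ⟨k⟩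
  have h1 := hA.not_odd_card
  rw [Nat.not_odd_iff_even] at h1
  exact h1.two_dvd

end

end ParaNil

namespace ParaNil

open Subgroup

theorem eq_three_and_eq_five {r n m : ℕ} {B : Finset ℕ} (hr : r.Prime) (hm : r + 1 = 2 ^ m)
    (hn : n ≠ 1) (hB : B.card ≤ 2) (hp : ∀ p ∈ B, p.Prime) (hp2 : ∀ p ∈ B, p ≠ 2)
    (hpn : ∀ p ∈ B, p = r ∨ p ∣ n)
    (h : 2 * r * n = 2 * r + (r + 1) * ∑ p ∈ B, (p - 1)) : r = 3 ∧ n = 5 := by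
  have hr2 := hr.two_le
  have hp3 : ∀ p ∈ B, 3 ≤ p := fun p hpB => by
    have := (hp p hpB).two_le
    have := hp2 p hpB
    omega
  have hcop : r.Coprime (r + 1) := by simp
  have hdvd : r ∣ ∑ p ∈ B, (p - 1) := by
    refine hcop.dvd_of_dvd_mul_left ((Nat.dvd_add_right (Dvd.intro_left 2 rfl)).1 (h ▸ ?_))
    exact (Dvd.intro_left 2 rfl).mul_right n
  have key : ∀ p, p.Prime → 3 ≤ p → p ∣ n → r ∣ (p - 1) + (r - 1) →
      2 * r * n = 2 * r + (r + 1) * ((p - 1) + (r - 1)) → r = 3 ∧ n = 5 := by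
    intro p hpp hp3 hd' hd h
    obtain ⟨k, rfl⟩ : ∃ k, p = k + 3 := ⟨p - 3, by omega⟩
    obtain ⟨j, rfl⟩ : ∃ j, r = j + 2 := ⟨r - 2, by omega⟩
    have h1 : j + 2 ∣ k + 1 := by
      have h2 : (k + 3 - 1) + (j + 2 - 1) = (k + 1) + (j + 2) := by omega
      rw [h2] at hd
      exact (Nat.dvd_add_left dvd_rfl).1 hd
    have h2 : (k + 3) ∣ (j + 4) * (j + 1) := by
      have h3 : (k + 3) ∣ (j + 3) * (k + 3) + (j + 4) * (j + 1) := by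
        have h4 : (j + 3) * (k + 3) + (j + 4) * (j + 1) = 2 * (j + 2) * n := by
          rw [h]
          have : (k + 3 - 1) + (j + 2 - 1) = k + j + 3 := by omega
          rw [this]
          ring
        rw [h4]
        exact hd'.mul_left _
      exact (Nat.dvd_add_right (Dvd.intro_left _ rfl)).1 h3
    have h3 := Nat.le_of_dvd (by omega) h1
    have h4 : k = j + 1 := by
      rcases hpp.dvd_mul.1 h2 with h5 | h5
      · have := Nat.le_of_dvd (by omega) h5
        omega
      · have := Nat.le_of_dvd (by omega) h5
        omega
    subst h4
    have h5 : n = j + 4 := by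
      have h6 : (j + 1 + 3 - 1) + (j + 2 - 1) = 2 * (j + 2) := by omega
      rw [h6] at h
      have h7 : 2 * (j + 2) * n = 2 * (j + 2) * (j + 4) := by rw [h]; ring
      exact Nat.eq_of_mul_eq_mul_left (by omega) h7
    have h6 : 3 ∣ (j + 2) ∨ 3 ∣ j + 4 := by
      have h7 : ¬ 3 ∣ j + 3 := by
        rw [show j + 3 = 2 ^ m from hm]
        intro h8
        exact absurd (Nat.prime_three.dvd_of_dvd_pow h8) (by norm_num)
      omega
    rcases h6 with h6 | h6
    · have := (Nat.prime_dvd_prime_iff_eq Nat.prime_three hr).1 h6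
      omega
    · have := (Nat.prime_dvd_prime_iff_eq Nat.prime_three hpp).1 h6
      omega
  have hcase : B.card = 0 ∨ B.card = 1 ∨ B.card = 2 := by omega
  rcases hcase with h0 | h1 | h2
  · rw [Finset.card_eq_zero] at h0
    subst h0
    rw [Finset.sum_empty, mul_zero, add_zero] at h
    exact absurd (Nat.eq_of_mul_eq_mul_left (by omega) (h.trans (mul_one _).symm)) hn
  · obtain ⟨p, rfl⟩ := Finset.card_eq_one.1 h1
    rw [Finset.sum_singleton] at h hdvd
    have h3 := hp3 p (by simp)
    have h4 := Nat.le_of_dvd (by omega) hdvd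
    rcases hpn p (by simp) with rfl | h5
    · omega
    · obtain ⟨k, rfl⟩ : ∃ k, p = k + 3 := ⟨p - 3, by omega⟩
      obtain ⟨j, rfl⟩ : ∃ j, r = j + 2 := ⟨r - 2, by omega⟩
      have h6 : (k + 3) ∣ (j + 3) * (k + 3) + (j + 1) := by
        have h7 : (j + 3) * (k + 3) + (j + 1) = 2 * (j + 2) * n := by
          rw [h, show k + 3 - 1 = k + 2 by omega]
          ring
        rw [h7]
        exact h5.mul_left _
      have := Nat.le_of_dvd (by omega) ((Nat.dvd_add_right (Dvd.intro_left _ rfl)).1 h6)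
      omega
  · obtain ⟨a, b, hab, rfl⟩ := Finset.card_eq_two.1 h2
    rw [Finset.sum_pair hab] at h hdvd
    have ha := hp3 a (by simp)
    have hb := hp3 b (by simp)
    have ha' := hp a (by simp)
    have hb' := hp b (by simp)
    rcases hpn a (by simp) with h3 | h3
    · rcases hpn b (by simp) with h4 | h4
      · exact absurd (h3.trans h4.symm) hab
      · subst h3
        exact key b hb' hb h4 (by rwa [add_comm]) (by rw [h]; ring)
    · rcases hpn b (by simp) with h4 | h4
      · subst h4
        exact key a ha' ha h3 hdvd h
      · exfalso
        have h5 : a * b ∣ n := ((Nat.coprime_primes ha' hb').2 hab).mul_dvd_of_dvd_of_dvd h3 h4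
        have hn0 : n ≠ 0 := by
          rintro rfl
          omega
        have h6 := Nat.le_of_dvd (Nat.pos_of_ne_zero hn0) h5
        obtain ⟨k, rfl⟩ : ∃ k, a = k + 3 := ⟨a - 3, by omega⟩
        obtain ⟨j, rfl⟩ : ∃ j, b = j + 3 := ⟨b - 3, by omega⟩
        have h7 : 2 * r * ((k + 3) * (j + 3)) ≤ 2 * r * n := Nat.mul_le_mul_left _ h6
        rw [h, show (k + 3 - 1) + (j + 3 - 1) = k + j + 4 by omega] at h7
        nlinarith [Nat.zero_le (r * (k * j)), Nat.zero_le (r * k), Nat.zero_le (r * j),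
          Nat.mul_le_mul_right k hr2, Nat.mul_le_mul_right j hr2]

section

open scoped Classical

variable {S : Type*} [Group S]

theorem LocalData.exists_conj_eq [Finite S] {r : ℕ} {P : Subgroup S} (hP : LocalData 2 r P)
    {s t : S} (hs : s ∈ P) (hs1 : s ≠ 1) (ht : t ^ 2 = 1) (htP : t ∉ P) :
    ∃ g, g * s * g⁻¹ = t := by
  have hs2 := hP.pow s hs
  have hsi : s⁻¹ = s := inv_eq_of_mul_eq_one_left (by rw [← sq, hs2])
  have hti : t⁻¹ = t := inv_eq_of_mul_eq_one_left (by rw [← sq, ht])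
  have hsw : s * (s * t) * s⁻¹ = (s * t)⁻¹ := by rw [mul_inv_rev, hti, hsi, ← mul_assoc, ← sq, hs2, one_mul]
  have htw : t * (s * t) * t⁻¹ = (s * t)⁻¹ := by rw [mul_inv_rev, hti, hsi, mul_assoc, mul_assoc, ← sq, ht, mul_one]
  obtain ⟨m, hm⟩ | ⟨m, hm⟩ := Nat.even_or_odd (orderOf (s * t))
  · exfalso
    have h0 : orderOf (s * t) ≠ 0 := (orderOf_pos _).ne'
    have hz1 : (s * t) ^ m ≠ 1 := fun h => by
      have := Nat.le_of_dvd (by omega) (orderOf_dvd_of_pow_eq_one h)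
      omega
    have hz2 : ((s * t)⁻¹) ^ m = (s * t) ^ m := by
      rw [inv_pow, inv_eq_iff_mul_eq_one, ← pow_add, ← hm, pow_orderOf_eq_one]
    have hzs : Commute ((s * t) ^ m) s := by
      have h1 : s * (s * t) ^ m * s⁻¹ = (s * t) ^ m := by rw [← conj_pow, hsw, hz2]
      exact (mul_inv_eq_iff_eq_mul.1 h1).symm
    have hzt : Commute t ((s * t) ^ m) := by
      have h1 : t * (s * t) ^ m * t⁻¹ = (s * t) ^ m := by rw [← conj_pow, htw, hz2]
      exact mul_inv_eq_iff_eq_mul.1 h1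
    exact htP (hP.cent _ (hP.cent s hs hs1 _ hzs) hz1 t hzt)
  · refine ⟨(s * t) ^ m, ?_⟩
    have h1 : s * ((s * t) ^ m)⁻¹ = (s * t) ^ m * s := by
      have h2 : s * ((s * t) ^ m)⁻¹ * s⁻¹ = (s * t) ^ m := by
        rw [← inv_pow, ← conj_pow, ← conj_inv, hsw, inv_inv]
      exact mul_inv_eq_iff_eq_mul.1 h2
    rw [mul_assoc, h1, ← mul_assoc, ← pow_add]
    have h3 : (s * t) ^ (m + m) = (s * t)⁻¹ := by
      rw [eq_inv_iff_mul_eq_one, ← pow_succ, ← two_mul, ← hm, pow_orderOf_eq_one]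
    rw [h3, mul_inv_rev, hti, hsi, mul_assoc, ← sq, hs2, mul_one]

theorem LocalData.card_eq_add_one [Finite S] {r : ℕ} {P : Subgroup S} (hP : LocalData 2 r P)
    (hN : normalizer (P : Set S) ≠ ⊤) : Nat.card P = r + 1 := by
  have := Fintype.ofFinite S
  obtain ⟨t, ht, htP⟩ : ∃ t : S, t ^ 2 = 1 ∧ t ∉ P := by
    by_contra! h
    refine hN (normalizer_eq_top_iff.2 ⟨fun u hu g => h _ ?_⟩)
    rw [conj_pow, hP.pow u hu, mul_one, mul_inv_cancel]
  have hone := hP.one_lt_card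
  obtain ⟨u, hu⟩ : ∃ u : P, u ≠ 1 := by
    have := Finite.one_lt_card_iff_nontrivial.1 hone
    exact exists_ne 1
  have hu1 : (u : S) ≠ 1 := fun h => hu (Subtype.ext h)
  have hc : ∀ v : {v : P // v ≠ 1}, ∃ g, g * u * g⁻¹ = (v : S) := by
    intro v
    have hv1 : ((v : P) : S) ≠ 1 := fun h => v.2 (Subtype.ext h)
    obtain ⟨a, ha⟩ := hP.exists_conj_eq u.2 hu1 ht htP
    obtain ⟨b, hb⟩ := hP.exists_conj_eq v.1.2 hv1 ht htP
    refine ⟨b⁻¹ * a, ?_⟩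
    have : b⁻¹ * a * u * (b⁻¹ * a)⁻¹ = b⁻¹ * (a * u * a⁻¹) * b := by group
    rw [this, ha, ← hb]
    group
  choose c hc using hc
  have hw : ∀ w : P, (w : S) * u * (w : S)⁻¹ = u := fun w =>
    mul_inv_eq_iff_eq_mul.2 (hP.comm w w.2 u u.2)
  have hcw : ∀ (v : {v : P // v ≠ 1}) (w : P), c v * w * u * (c v * w)⁻¹ = v := by
    intro v w
    have : c v * w * u * (c v * w)⁻¹ = c v * (w * u * (w : S)⁻¹) * (c v)⁻¹ := by group
    rw [this, hw, hc]
  have h1 : Nat.card ({v : P // v ≠ 1} × P) ≤ Nat.card (normalizer (P : Set S)) := by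
    refine Nat.card_le_card_of_injective (fun x => ⟨c x.1 * x.2, hP.isTI _ u u.2 hu1 ?_⟩) ?_
    · rw [hcw]
      exact x.1.1.2
    · rintro ⟨v, w⟩ ⟨v', w'⟩ h
      have h2 : c v * w = c v' * w' := congrArg Subtype.val h
      have h3 : v = v' := by
        have h4 := hcw v w
        rw [h2, hcw] at h4
        exact Subtype.ext (Subtype.ext h4.symm)
      subst h3
      rw [mul_left_cancel h2 |> Subtype.ext]
  rw [Nat.card_prod, hP.card_normalizer, mul_comm] at h1
  have h2 := Nat.le_of_mul_le_mul_left h1 Nat.card_pos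
  have h3 : Nat.card {v : P // v ≠ 1} = Nat.card P - 1 := by
    rw [Nat.card_eq_fintype_card, Nat.card_eq_fintype_card, Fintype.card_subtype_compl,
      Fintype.card_subtype_eq]
  have h4 := Nat.le_of_dvd (by omega) hP.dvd
  omega

/-- In a dihedral local normalizer, exactly the elements outside `A` are inverting involutions. -/
theorem LocalData.exists_inverting {p : ℕ} {A : Subgroup S} (hA : LocalData p 2 A) :
    ∃ y ∈ normalizer (A : Set S), y ∉ A ∧ y ^ 2 = 1 ∧ (∀ u ∈ A, y * u * y⁻¹ = u⁻¹) ∧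
      ∀ g ∈ normalizer (A : Set S), g ∉ A → ∃ u ∈ A, g = u * y := by
  obtain ⟨y, hyN, hy1, hy2, hgen⟩ := hA.gen
  have hyA : y ∉ A := fun h => hy1 (eq_one_of_pow_coprime
    ((Nat.coprime_primes hA.hq hA.hp).2 hA.hpq.symm) hy2 (hA.pow y h))
  refine ⟨y, hyN, hyA, hy2, fun u hu => ?_, fun g hg hgA => ?_⟩
  · have h1 : y * u * y⁻¹ ∈ A := (mem_normalizer_iff.1 hyN u).1 hu
    have h2 : y * (y * u * y⁻¹ * u) * y⁻¹ = y * u * y⁻¹ * u := by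
      have h3 : y * (y * u * y⁻¹ * u) * y⁻¹ = y ^ 2 * u * (y ^ 2)⁻¹ * (y * u * y⁻¹) := by
        simp only [sq, mul_inv_rev, mul_assoc, inv_mul_cancel_left]
      rw [h3, hy2, one_mul, inv_one, mul_one]
      exact hA.comm u hu _ h1
    by_contra h3
    refine hyA (hA.cent _ (mul_mem h1 hu) (fun h4 => h3 (eq_inv_of_mul_eq_one_left h4)) y ?_)
    exact mul_inv_eq_iff_eq_mul.1 h2
  · obtain ⟨u, hu, k, rfl⟩ := hgen g hg
    refine ⟨u, hu, ?_⟩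
    obtain ⟨j, rfl | rfl⟩ := Int.even_or_odd' k
    · rw [zpow_mul, zpow_ofNat, hy2, one_zpow, mul_one] at hgA
      exact absurd hu hgA
    · rw [zpow_add_one, zpow_mul, zpow_ofNat, hy2, one_zpow, one_mul]

theorem LocalData.card_eq_of_two [Finite S] {p : ℕ} {A : Subgroup S} (hA : LocalData p 2 A) :
    Nat.card A = p := by
  obtain ⟨y, -, -, -, hy, hgen⟩ := hA.exists_inverting
  obtain ⟨u, hu, hu1⟩ : ∃ u ∈ A, u ≠ 1 := by
    by_contra! h
    exact hA.ne_bot ((eq_bot_iff_forall _).2 h)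
  have h1 : zpowers u ≤ A := zpowers_le.2 hu
  have h2 : ∀ g ∈ A, ∀ t ∈ A, g * t * g⁻¹ = t := fun g hg t ht =>
    mul_inv_eq_iff_eq_mul.2 (hA.comm g hg t ht)
  have h3 := (hA.irred (zpowers u) h1 fun g hg t ht => ?_).resolve_left
    (fun h => hu1 (zpowers_eq_bot.1 h))
  · rw [← h3, Nat.card_zpowers]
    have := Fact.mk hA.hp
    exact orderOf_eq_prime (hA.pow u hu) hu1
  · by_cases hgA : g ∈ A
    · rwa [h2 g hgA t (h1 ht)]
    · obtain ⟨v, hv, rfl⟩ := hgen g hg hgA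
      have h4 : v * y * t * (v * y)⁻¹ = v * (y * t * y⁻¹) * v⁻¹ := by group
      rw [h4, hy t (h1 ht), h2 v hv _ (inv_mem (h1 ht))]
      exact inv_mem ht

end

end ParaNil

namespace ParaNil

open Subgroup

section

open scoped Classical

namespace LocalFamily

variable {S K : Type*} [Group S] {p q : K → ℕ} {A : K → Subgroup S}

theorem sum_eq_of_const [Fintype S] [Fintype K] (h : LocalFamily p q A) {F : S → ℂ}
    (hF : ∀ z s, F (z * s * z⁻¹) = F s) (c : K → ℂ) (hc : ∀ k, ∀ x ∈ A k, x ≠ 1 → F x = c k) :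
    ∑ s, F s = F 1 + ∑ k, (Nat.card S : ℂ) / (Nat.card (A k) * q k) *
      ((Nat.card (A k) - 1) * c k) := by
  rw [h.sum_eq hF]
  congr 1
  refine Finset.sum_congr rfl fun k _ => ?_
  rw [(h.data k).card_normalizer, Nat.cast_mul]
  congr 1
  have h1 : ∀ x ∈ (Finset.univ : Finset (A k)).erase 1, F x = c k := fun x hx =>
    hc k x x.2 fun h1 => (Finset.mem_erase.1 hx).1 (Subtype.ext h1)
  rw [← Finset.add_sum_erase _ _ (Finset.mem_univ (1 : A k)), coe_one, add_sub_cancel_left,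
    Finset.sum_congr rfl h1, Finset.sum_const, nsmul_eq_mul,
    Finset.card_erase_of_mem (Finset.mem_univ _), Finset.card_univ, ← Nat.card_eq_fintype_card,
    Nat.cast_sub Nat.card_pos, Nat.cast_one]

theorem mem_of_sq_of_two {r : ℕ} {P : Subgroup S} (hP : LocalData 2 r P) {x s : S} (hx : x ∈ P)
    (hx1 : x ≠ 1) (hs : s ^ 2 = 1) (hsx : (s * x) ^ 2 = 1) : s ∈ P := by
  refine hP.cent x hx hx1 s ?_
  have hx2 := hP.pow x hx
  have h1 : (s * x)⁻¹ = s * x := inv_eq_of_mul_eq_one_left (by rw [← sq, hsx])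
  have h2 : s⁻¹ = s := inv_eq_of_mul_eq_one_left (by rw [← sq, hs])
  have h3 : x⁻¹ = x := inv_eq_of_mul_eq_one_left (by rw [← sq, hx2])
  rw [mul_inv_rev, h2, h3] at h1
  exact h1.symm

theorem inv_of_sq {x s : S} (hs : s ^ 2 = 1) (hsx : (s * x) ^ 2 = 1) : s * x * s⁻¹ = x⁻¹ := by
  have h2 : s⁻¹ = s := inv_eq_of_mul_eq_one_left (by rw [← sq, hs])
  rw [h2, eq_inv_iff_mul_eq_one, mul_assoc, ← sq, hsx]

theorem mem_normalizer_of_sq {p r : ℕ} {B : Subgroup S} (hB : LocalData p r B) {x s : S}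
    (hx : x ∈ B) (hx1 : x ≠ 1) (hs : s ^ 2 = 1) (hsx : (s * x) ^ 2 = 1) :
    s ∈ normalizer (B : Set S) :=
  hB.isTI s x hx hx1 (by rw [inv_of_sq hs hsx]; exact inv_mem hx)

variable [Fintype S]

/-- The number of involutions of a finite group. -/
noncomputable def involutions (S : Type*) [Group S] [Fintype S] : ℕ :=
  (Finset.univ.filter fun s : S => s ^ 2 = 1 ∧ s ≠ 1).card

/-- The number of involutions `s` with `s * w` of order at most two. -/
noncomputable def inverting (w : S) : ℕ :=
  (Finset.univ.filter fun s : S => (s ^ 2 = 1 ∧ s ≠ 1) ∧ (s * w) ^ 2 = 1).card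

theorem inverting_conj (z s : S) : inverting (z * s * z⁻¹) = inverting s := by
  refine (Finset.card_bij (fun t _ => z * t * z⁻¹) ?_ ?_ ?_).symm
  · intro t ht
    simp only [Finset.mem_filter, Finset.mem_univ, true_and] at ht ⊢
    refine ⟨⟨by rw [conj_pow, ht.1.1, mul_one, mul_inv_cancel], fun h => ht.1.2 ?_⟩, ?_⟩
    · rwa [mul_inv_eq_one, mul_eq_left] at h
    · rw [show z * t * z⁻¹ * (z * s * z⁻¹) = z * (t * s) * z⁻¹ by group, conj_pow, ht.2, mul_one,
        mul_inv_cancel]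
  · intro t _ t' _ h
    simpa using h
  · intro t ht
    simp only [Finset.mem_filter, Finset.mem_univ, true_and] at ht
    refine ⟨z⁻¹ * t * z, ?_, by group⟩
    simp only [Finset.mem_filter, Finset.mem_univ, true_and]
    have h1 : z⁻¹ * t * z = z⁻¹ * t * z⁻¹⁻¹ := by group
    refine ⟨⟨by rw [h1, conj_pow, ht.1.1, mul_one, mul_inv_cancel], fun h => ht.1.2 ?_⟩, ?_⟩
    · rwa [h1, mul_inv_eq_one, mul_eq_left] at h
    · rw [show z⁻¹ * t * z * s = z⁻¹ * (t * (z * s * z⁻¹)) * z⁻¹⁻¹ by group, conj_pow, ht.2,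
        mul_one, mul_inv_cancel]

theorem inverting_one : inverting (1 : S) = involutions S := by
  rw [inverting, involutions]
  congr 1
  ext s
  simp only [Finset.mem_filter, Finset.mem_univ, true_and, mul_one]
  tauto

theorem sum_inverting : ∑ w : S, inverting w = involutions S * (involutions S + 1) := by
  have h1 : (Finset.univ.filter fun s : S => s ^ 2 = 1).card = involutions S + 1 := by
    have h2 : (Finset.univ.filter fun s : S => s ^ 2 = 1) =
        insert 1 (Finset.univ.filter fun s : S => s ^ 2 = 1 ∧ s ≠ 1) := by
      ext s
      by_cases hs : s = 1 <;> simp [hs]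
    rw [h2, Finset.card_insert_of_notMem (by simp), involutions]
  simp only [inverting, Finset.card_filter]
  rw [Finset.sum_comm]
  have h3 : ∀ s : S, ∑ w : S, (if (s ^ 2 = 1 ∧ s ≠ 1) ∧ (s * w) ^ 2 = 1 then 1 else 0) =
      if s ^ 2 = 1 ∧ s ≠ 1 then involutions S + 1 else 0 := by
    intro s
    split_ifs with hs
    · rw [← h1, Finset.card_filter]
      simp only [hs, ne_eq, not_false_eq_true, and_self, true_and]
      exact Equiv.sum_comp (Equiv.mulLeft s) fun w : S => if w ^ 2 = 1 then 1 else 0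
    · simp [hs]
  rw [Finset.sum_congr rfl fun s _ => h3 s, ← Finset.sum_filter, Finset.sum_const, smul_eq_mul]
  rfl

theorem inverting_of_two {r : ℕ} {P : Subgroup S} (hP : LocalData 2 r P)
    (hc : Nat.card P = r + 1) {x : S} (hx : x ∈ P) (hx1 : x ≠ 1) : inverting x = r := by
  have h1 : inverting x = Nat.card (sharp P) := by
    rw [inverting, ← Fintype.card_subtype, ← Nat.card_eq_fintype_card]
    refine Nat.card_congr (Equiv.subtypeEquivRight fun s => ⟨fun h => ⟨?_, h.1.2⟩, fun h => ?_⟩)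
    · exact mem_of_sq_of_two hP hx hx1 h.1.1 h.2
    · exact ⟨⟨hP.pow s h.1, h.2⟩, hP.pow _ (mul_mem h.1 hx)⟩
  have := card_sharp P
  omega

theorem inverting_of_ne {p r : ℕ} {B : Subgroup S} (hB : LocalData p r B) (hp : IsPGroup p B)
    (hp2 : p ≠ 2) (hr : r ≠ 2) {x : S} (hx : x ∈ B) (hx1 : x ≠ 1) : inverting x = 0 := by
  rw [inverting, Finset.card_eq_zero, Finset.filter_eq_empty_iff]
  rintro s - ⟨⟨hs, hs1⟩, hsx⟩
  have hN := mem_normalizer_of_sq hB hx hx1 hs hsx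
  have h1 : orderOf s = 2 := orderOf_eq_prime hs hs1
  have h2 : 2 ∣ Nat.card B * r := by
    rw [← hB.card_normalizer, ← h1]
    exact orderOf_dvd_natCard _ hN
  have := Fact.mk hB.hp
  rcases Nat.prime_two.dvd_mul.1 h2 with h3 | h3
  · obtain ⟨n, hn⟩ := IsPGroup.iff_card.1 hp
    rw [hn] at h3
    exact hp2 ((Nat.prime_dvd_prime_iff_eq Nat.prime_two hB.hp).1
      (Nat.prime_two.dvd_of_dvd_pow h3)).symm
  · exact hr ((Nat.prime_dvd_prime_iff_eq Nat.prime_two hB.hq).1 h3).symm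

theorem inverting_of_eq {p : ℕ} {B : Subgroup S} (hB : LocalData p 2 B) {x : S} (hx : x ∈ B)
    (hx1 : x ≠ 1) : inverting x = Nat.card B := by
  obtain ⟨y, hyN, hyB, hy2, hy, hgen⟩ := hB.exists_inverting
  have hyi : y⁻¹ = y := inv_eq_of_mul_eq_one_left (by rw [← sq, hy2])
  have huy : ∀ u ∈ B, (u * y) ^ 2 = 1 := fun u hu => by
    have h1 := hy u hu
    rw [hyi] at h1
    rw [sq, mul_assoc, ← mul_assoc y, h1, mul_inv_cancel]
  have hmem : ∀ u : B, (((u : S) * y) ^ 2 = 1 ∧ (u : S) * y ≠ 1) ∧ ((u : S) * y * x) ^ 2 = 1 := by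
    refine fun u => ⟨⟨huy u u.2, fun h => ?_⟩, ?_⟩
    · exact hyB ((eq_inv_of_mul_eq_one_right h) ▸ inv_mem u.2)
    · have h1 : (u : S) * y * x = u * x⁻¹ * y := by
        rw [← hy x hx]
        group
      rw [h1]
      exact huy _ (mul_mem u.2 (inv_mem hx))
  rw [inverting, ← Fintype.card_subtype, ← Nat.card_eq_fintype_card]
  refine (Nat.card_congr (Equiv.ofBijective (fun u : B => ⟨u * y, hmem u⟩) ⟨?_, ?_⟩)).symm
  · intro u v h
    exact Subtype.ext (mul_right_cancel (congrArg Subtype.val h))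
  · rintro ⟨s, ⟨hs, hs1⟩, hsx⟩
    have hN := mem_normalizer_of_sq hB hx hx1 hs hsx
    obtain ⟨u, hu, rfl⟩ := hgen s hN fun h => hs1 (eq_one_of_pow_coprime
      ((Nat.coprime_primes hB.hq hB.hp).2 hB.hpq.symm) hs (hB.pow s h))
    exact ⟨⟨u, hu⟩, rfl⟩

variable [Fintype K]

theorem involutions_eq (h : LocalFamily p q A) {k₂ : K} (hk : p k₂ = 2) {n : ℕ}
    (hc : Nat.card (A k₂) = q k₂ + 1) (hn : Nat.card S = (q k₂ + 1) * q k₂ * n) :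
    involutions S = q k₂ * n := by
  have h1 := h.sum_eq_of_const (F := fun s => if s ^ 2 = 1 ∧ s ≠ 1 then 1 else 0)
    (fun z s => by
      have h1 : (z * s * z⁻¹) ^ 2 = 1 ↔ s ^ 2 = 1 := by
        rw [conj_pow, mul_inv_eq_one, mul_eq_left]
      have h2 : z * s * z⁻¹ = 1 ↔ s = 1 := by rw [mul_inv_eq_one, mul_eq_left]
      simp only [h1, ne_eq, h2])
    (fun k => if k = k₂ then 1 else 0) fun k x hx hx1 => ?_
  · rw [Finset.sum_eq_single k₂ (fun k _ hk' => by rw [if_neg hk']; ring) (by simp), if_pos rfl,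
      Finset.sum_boole, if_neg (by simp), hc, hn, zero_add] at h1
    have hq : (q k₂ : ℂ) ≠ 0 := Nat.cast_ne_zero.2 (h.data k₂).hq.ne_zero
    have hq1 : (q k₂ : ℂ) + 1 ≠ 0 := by exact_mod_cast Nat.succ_ne_zero (q k₂)
    have h2 : (involutions S : ℂ) = q k₂ * n := by
      rw [involutions, h1]
      push_cast
      field_simp
      ring
    exact_mod_cast h2
  · by_cases hkk : k = k₂
    · subst hkk
      have := (h.data k).pow x hx
      rw [hk] at this
      simp [this, hx1]
    · rw [if_neg hkk, if_neg]
      rintro ⟨h2, -⟩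
      exact hx1 (eq_one_of_pow_coprime ((Nat.coprime_primes Nat.prime_two (h.data k).hp).2
        fun h3 => hkk (h.injective (h3.symm.trans hk.symm))) h2 ((h.data k).pow x hx))

theorem count_eq (h : LocalFamily p q A) {k₂ : K} (hk : p k₂ = 2) {n : ℕ} (hn0 : n ≠ 0)
    (hc : Nat.card (A k₂) = q k₂ + 1) (hn : Nat.card S = (q k₂ + 1) * q k₂ * n) :
    2 * q k₂ * n = 2 * q k₂ + (q k₂ + 1) *
      ∑ k ∈ Finset.univ.filter (fun k => q k = 2), (p k - 1) := by
  have h1 := h.sum_eq_of_const (F := fun s => (inverting s : ℂ))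
    (fun z s => by rw [inverting_conj])
    (fun k => if k = k₂ then (q k₂ : ℂ) else if q k = 2 then (p k : ℂ) else 0)
    fun k x hx hx1 => ?_
  · have hq2 : q k₂ ≠ 2 := fun h2 => (h.data k₂).hpq (hk.trans h2.symm)
    have hq : (q k₂ : ℂ) ≠ 0 := Nat.cast_ne_zero.2 (h.data k₂).hq.ne_zero
    have hq1 : (q k₂ : ℂ) + 1 ≠ 0 := by exact_mod_cast Nat.succ_ne_zero (q k₂)
    have hnC : (n : ℂ) ≠ 0 := Nat.cast_ne_zero.2 hn0
    have h2 : ∑ k ∈ Finset.univ.erase k₂, (Nat.card S : ℂ) / (Nat.card (A k) * q k) *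
        ((Nat.card (A k) - 1) *
          (if k = k₂ then (q k₂ : ℂ) else if q k = 2 then (p k : ℂ) else 0)) =
        Nat.card S / 2 * ((∑ k ∈ Finset.univ.filter (fun k => q k = 2), (p k - 1) : ℕ) : ℂ) := by
      rw [Nat.cast_sum, Finset.mul_sum, Finset.sum_filter]
      rw [← Finset.sum_erase (a := k₂) Finset.univ (by rw [if_neg hq2])]
      refine Finset.sum_congr rfl fun k hk' => ?_
      rw [if_neg (Finset.mem_erase.1 hk').1]
      split_ifs with hqk
      · have hd := h.data k
        rw [hqk] at hd ⊢
        have hp0 : (p k : ℂ) ≠ 0 := Nat.cast_ne_zero.2 hd.hp.ne_zero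
        rw [hd.card_eq_of_two, Nat.cast_sub hd.hp.one_le]
        push_cast
        field_simp
      · ring
    rw [← Finset.add_sum_erase _ _ (Finset.mem_univ k₂), h2, if_pos rfl, inverting_one, hc,
      ← Nat.cast_sum, sum_inverting, h.involutions_eq hk hc hn, hn] at h1
    have h3 : (2 * q k₂ * n : ℂ) = 2 * q k₂ + (q k₂ + 1) *
        ((∑ k ∈ Finset.univ.filter (fun k => q k = 2), (p k - 1) : ℕ) : ℂ) := by
      push_cast at h1 ⊢
      field_simp at h1
      linear_combination h1
    exact_mod_cast h3
  · split_ifs with hkk hqk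
    · subst hkk
      have hd := h.data k
      rw [hk] at hd
      rw [inverting_of_two hd hc hx hx1]
    · have hd := h.data k
      rw [hqk] at hd
      rw [inverting_of_eq hd hx hx1, hd.card_eq_of_two]
    · rw [inverting_of_ne (h.data k) (h.isPGroup k)
        (fun h3 => hkk (h.injective (h3.trans hk.symm))) hqk hx hx1, Nat.cast_zero]

theorem card_filter_le_two (h : LocalFamily p q A) :
    (Finset.univ.filter fun k => q k = 2).card ≤ 2 := by
  by_contra! h3
  have h1 := h.class_eq
  have h2 : ∀ k ∈ Finset.univ.filter (fun k => q k = 2), (1 : ℝ) / 3 ≤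
      (Nat.card (MulAction.orbitRel.Quotient (normalizer (A k : Set S))
        (NontrivialDual (A k))) : ℝ) / Nat.card (A k) := by
    intro k hk
    have hd := h.data k
    have hcq := NontrivialDual.card_quotient hd.comm hd.cent hd.card_normalizer
    rw [(Finset.mem_filter.1 hk).2] at hcq
    have hlt := hd.one_lt_card
    have h4 : (0 : ℝ) < Nat.card (A k) := by exact_mod_cast Nat.card_pos
    rw [div_le_div_iff₀ (by norm_num) h4]
    have h5 : Nat.card (A k) ≤ Nat.card (MulAction.orbitRel.Quotient (normalizer (A k : Set S))
        (NontrivialDual (A k))) * 3 := by omega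
    rw [one_mul]
    exact_mod_cast h5
  have h4 := Finset.card_nsmul_le_sum _ _ _ h2
  have h5 : ∑ k ∈ Finset.univ.filter (fun k => q k = 2),
      (Nat.card (MulAction.orbitRel.Quotient (normalizer (A k : Set S))
        (NontrivialDual (A k))) : ℝ) / Nat.card (A k) ≤ ∑ k,
      (Nat.card (MulAction.orbitRel.Quotient (normalizer (A k : Set S))
        (NontrivialDual (A k))) : ℝ) / Nat.card (A k) :=
    Finset.sum_le_sum_of_subset_of_nonneg (Finset.filter_subset _ _) fun k _ _ => by positivity
  have h6 : (3 : ℝ) ≤ (Finset.univ.filter fun k => q k = 2).card := by exact_mod_cast h3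
  have h7 : (0 : ℝ) < 1 / Nat.card S := one_div_pos.2 (Nat.cast_pos.2 Nat.card_pos)
  rw [nsmul_eq_mul] at h4
  linarith

end LocalFamily

theorem Setting.card_eq_sixty {S : Type*} [Group S] (h : Setting S) : Nat.card S = 60 := by
  have := h.finite
  have := h.simple
  have := Fintype.ofFinite S
  obtain ⟨p, q, A, hA, hp⟩ := h.exists_localFamily
  have := Fintype.ofFinite {p // p ∈ (Nat.card S).primeFactors}
  let k₂ : {p // p ∈ (Nat.card S).primeFactors} :=
    ⟨2, Nat.mem_primeFactors.2 ⟨Nat.prime_two, h.two_dvd_card, Nat.card_pos.ne'⟩⟩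
  have hk₂ : p k₂ = 2 := hp k₂
  have hd := hA.data k₂
  rw [hk₂] at hd
  have hAn : Group.IsNilpotent (A k₂) := by
    have := Fact.mk (hA.data k₂).hp
    exact (hA.isPGroup k₂).isNilpotent
  have hN := h.normalizer_ne_top hd.ne_bot (h.ne_top_of_isNilpotent hAn)
  have hc := hd.card_eq_add_one hN
  set n := (normalizer (A k₂ : Set S)).index with hn
  have hn1 : n ≠ 1 := fun h1 => hN (index_eq_one.1 h1)
  have hn0 : n ≠ 0 := index_ne_zero_of_finite
  have hg : Nat.card S = (q k₂ + 1) * q k₂ * n := by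
    rw [← hc, ← hd.card_normalizer, hn, card_mul_index]
  have hcount := hA.count_eq hk₂ hn0 hc hg
  obtain ⟨m, hm⟩ := IsPGroup.iff_card.1 (hk₂ ▸ hA.isPGroup k₂ : IsPGroup 2 (A k₂))
  rw [hc] at hm
  have hinj : Set.InjOn p (Finset.univ.filter fun k => q k = 2) := hA.injective.injOn
  obtain ⟨hr, hn5⟩ := eq_three_and_eq_five (B := (Finset.univ.filter fun k => q k = 2).image p)
    hd.hq hm hn1 (Finset.card_image_le.trans hA.card_filter_le_two)
    (fun p' hp' => by
      obtain ⟨k, -, rfl⟩ := Finset.mem_image.1 hp'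
      exact (hA.data k).hp)
    (fun p' hp' => by
      obtain ⟨k, hk, rfl⟩ := Finset.mem_image.1 hp'
      have h1 := (Finset.mem_filter.1 hk).2
      exact fun h2 => (hA.data k).hpq (h2.trans h1.symm))
    (fun p' hp' => by
      obtain ⟨k, hk, rfl⟩ := Finset.mem_image.1 hp'
      have h1 := (Finset.mem_filter.1 hk).2
      have h2 : p k ∣ (q k₂ + 1) * q k₂ * n := by
        rw [← hg, hp]
        exact (Nat.mem_primeFactors.1 k.2).2.1
      rcases (hA.data k).hp.dvd_mul.1 h2 with h3 | h3
      · rcases (hA.data k).hp.dvd_mul.1 h3 with h4 | h4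
        · rw [hm] at h4
          have h5 := (Nat.prime_dvd_prime_iff_eq (hA.data k).hp Nat.prime_two).1
            ((hA.data k).hp.dvd_of_dvd_pow h4)
          exact absurd (h5.trans h1.symm) (hA.data k).hpq
        · exact Or.inl ((Nat.prime_dvd_prime_iff_eq (hA.data k).hp hd.hq).1 h4)
      · exact Or.inr h3)
    (by rw [Finset.sum_image hinj]; exact hcount)
  rw [hg, hr, hn5]

end

end ParaNil

namespace ParaNil

open Subgroup

theorem exists_mulEquiv_alternatingGroup {S : Type*} [Group S] (hS : Nat.card S = 60)
    {f : S →* Equiv.Perm (Fin 5)} (hf : Function.Injective f) :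
    Nonempty (S ≃* alternatingGroup (Fin 5)) := by
  have h1 : Nat.card f.range = 60 := by rw [← hS]; exact Nat.card_congr (f.ofInjective hf).symm.toEquiv
  have h2 : f.range.index = 2 := by
    have h3 := f.range.card_mul_index
    rw [h1, Nat.card_perm, Nat.card_fin] at h3
    have h4 : Nat.factorial 5 = 120 := rfl
    omega
  exact ⟨(f.ofInjective hf).trans (MulEquiv.subgroupCongr
    (Equiv.Perm.eq_alternatingGroup_of_index_eq_two h2))⟩

theorem exists_hom_perm_of_index {S : Type*} [Group S] {H : Subgroup S} {n : ℕ} (hn : n ≠ 0)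
    (hH : H.index = n) : ∃ f : S →* Equiv.Perm (Fin n), f.ker = H.normalCore := by
  have : Finite (S ⧸ H) := Nat.finite_of_card_ne_zero (by rwa [← index_eq_card, hH])
  let e : (S ⧸ H) ≃ Fin n := Finite.equivFinOfCardEq (by rw [← index_eq_card, hH])
  refine ⟨e.permCongrHom.toMonoidHom.comp (MulAction.toPermHom S (S ⧸ H)), ?_⟩
  rw [normalCore_eq_ker]
  exact MonoidHom.ker_mulEquiv_comp (MulAction.toPermHom S (S ⧸ H)) e.permCongrHom

namespace Setting

variable {S : Type*} [Group S]

theorem localData_two [Fact (Nat.Prime 2)] (h : Setting S) (P : Sylow 2 S) :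
    LocalData 2 3 (P : Subgroup S) ∧ Nat.card P = 4 := by
  have := h.finite
  have hc : Nat.card P = 4 := by
    rw [P.card_eq_multiplicity, h.card_eq_sixty, show 60 = 2 ^ 2 * 15 from rfl,
      Nat.factorization_mul (by simp) (by simp), Nat.Prime.factorization_pow Nat.prime_two]
    simp [Nat.factorization_eq_zero_of_not_dvd]
  have hP : (P : Subgroup S) ≠ ⊥ := fun h1 => by
    rw [h1, card_bot] at hc
    omega
  obtain ⟨q, hq⟩ := h.exists_localData P hP
  have h1 := hq.dvd
  rw [hc] at h1
  have h2 : q = 3 := (Nat.prime_dvd_prime_iff_eq hq.hq Nat.prime_three).1 h1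
  exact ⟨h2 ▸ hq, hc⟩

theorem exists_localData_five (h : Setting S) :
    ∃ P : Subgroup S, LocalData 5 2 P ∧ Nat.card P = 5 := by
  have := h.finite
  have := Fact.mk Nat.prime_five
  obtain ⟨P⟩ := (inferInstance : Nonempty (Sylow 5 S))
  have hc : Nat.card P = 5 := by
    rw [P.card_eq_multiplicity, h.card_eq_sixty, show 60 = 5 * 12 from rfl,
      Nat.factorization_mul (by simp) (by simp), Nat.Prime.factorization Nat.prime_five]
    simp [Nat.factorization_eq_zero_of_not_dvd]
  have hP : (P : Subgroup S) ≠ ⊥ := fun h1 => by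
    rw [h1, card_bot] at hc
    omega
  obtain ⟨q, hq⟩ := h.exists_localData P hP
  have h1 := hq.dvd
  rw [hc] at h1
  have h2 : q = 2 := (Nat.prime_dvd_prime_iff_eq hq.hq Nat.prime_two).1
    (hq.hq.dvd_of_dvd_pow (show q ∣ 2 ^ 2 from h1))
  exact ⟨P, h2 ▸ hq, hc⟩

theorem nonempty_mulEquiv (h : Setting S) : Nonempty (S ≃* alternatingGroup (Fin 5)) := by
  have := h.finite
  have := h.simple
  have := Fact.mk Nat.prime_two
  obtain ⟨P⟩ := (inferInstance : Nonempty (Sylow 2 S))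
  obtain ⟨hP, hc⟩ := h.localData_two P
  have h1 := (normalizer ((P : Subgroup S) : Set S)).card_mul_index
  rw [hP.card_normalizer, hc, h.card_eq_sixty] at h1
  have h2 : (normalizer ((P : Subgroup S) : Set S)).index = 5 := by omega
  obtain ⟨f, hf⟩ := exists_hom_perm_of_index (by norm_num) h2
  refine exists_mulEquiv_alternatingGroup h.card_eq_sixty ((MonoidHom.ker_eq_bot_iff f).1 ?_)
  rcases (inferInstance : f.ker.Normal).eq_bot_or_eq_top with h3 | h3
  · exact h3
  · rw [hf] at h3
    have h4 := (normalizer ((P : Subgroup S) : Set S)).normalCore_le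
    rw [h3, top_le_iff] at h4
    rw [h4, index_top] at h2
    omega

end Setting

end ParaNil

namespace ParaNil

open Subgroup

theorem exists_transfer_kernel {G Q : Type*} [Group G] [Group Q] (T : Subgroup G) [T.FiniteIndex]
    (φ : G →* Q) (hT : ∀ s ∈ T, ∀ t ∈ T, Commute (φ s) (φ t)) :
    ∃ K : Subgroup G, commutator G ≤ K ∧
      ∀ g, (∀ h, Commute g h) → (g ∈ K ↔ φ g ^ T.index = 1) := by
  let _ : CommGroup (T.map φ) :=
    { (inferInstance : Group (T.map φ)) with
      mul_comm := by
        rintro ⟨_, s, hs, rfl⟩ ⟨_, t, ht, rfl⟩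
        exact Subtype.ext (hT s hs t ht) }
  let τ : G →* T.map φ := MonoidHom.transfer (φ.subgroupMap T)
  refine ⟨τ.ker, Abelianization.commutator_subset_ker τ, fun g hg => ?_⟩
  have key : ∀ (k : ℕ) (g₀ : G), g₀⁻¹ * g ^ k * g₀ ∈ T → g₀⁻¹ * g ^ k * g₀ = g ^ k :=
    fun k g₀ _ => by rw [mul_assoc, ((hg g₀).pow_left k).eq, inv_mul_cancel_left]
  rw [MonoidHom.mem_ker, MonoidHom.transfer_eq_pow _ g key, ← map_pow, Subtype.ext_iff]
  rfl

section

variable {N S : Type*} [Group N] [Group S]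

theorem exists_ne_one_of_ne_bot {A : Subgroup S} (hA : A ≠ ⊥) : ∃ a ∈ A, a ≠ 1 := by
  by_contra! h
  exact hA ((eq_bot_iff_forall A).2 h)

theorem LocalData.isPGroup {p q : ℕ} {A : Subgroup S} (hA : LocalData p q A) : IsPGroup p A :=
  fun a => ⟨1, Subtype.ext (by simpa using hA.pow a a.2)⟩

theorem LocalData.exists_schmidtData_comap [Finite N] [Finite S] {π : N →* S}
    (hπ : Function.Surjective π) (hN : ProperNilOrMinimal N) {r s : ℕ} {A : Subgroup S}
    (hA : LocalData r s A) (hA1 : normalizer (A : Set S) ≠ ⊤) :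
    ∃ P x, SchmidtData ((normalizer (A : Set S)).comap π) r s P x := by
  set H := (normalizer (A : Set S)).comap π with hH
  have hmap : H.map π = normalizer (A : Set S) := map_comap_eq_self_of_surjective hπ _
  obtain ⟨a, ha, ha1⟩ := exists_ne_one_of_ne_bot hA.ne_bot
  have hc := (Nat.coprime_primes hA.hq hA.hp).2 hA.hpq.symm
  obtain ⟨t, htN, ht1, hts, -⟩ := hA.gen
  have hta : ¬ Commute t a := fun h =>
    ht1 (eq_one_of_pow_coprime hc hts (hA.pow t (hA.cent a ha ha1 t h)))
  have hnot : ¬ Group.IsNilpotent H := by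
    intro hnil
    have h1 := isNilpotent_map π hnil
    rw [hmap] at h1
    exact hta (commute_of_coprime h1 htN (le_normalizer ha) hts (hA.pow a ha) hc)
  have hne : H ≠ ⊤ := fun h => hA1 (by rw [← hmap, h, map_top_of_surjective π hπ])
  obtain ⟨p, q, P, x, hs⟩ := exists_schmidtData ((hN H hne).resolve_left hnot)
  have hmem : ∀ l : ℕ, l.Prime → l ∣ Nat.card (normalizer (A : Set S)) → l = p ∨ l = q := by
    intro l hl hdvd
    have := Fact.mk hl
    have h1 : l ∣ Nat.card H := hdvd.trans (by rw [← hmap]; exact card_map_dvd H π)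
    obtain ⟨y, hy⟩ := exists_prime_orderOf_dvd_card' l h1
    refine hs.prime_eq hl y.2 (fun h => ?_) ⟨1, ?_⟩
    · rw [Subtype.ext (a1 := y) (a2 := 1) h, orderOf_one] at hy
      exact hl.one_lt.ne hy
    · rw [pow_one, ← hy]
      exact_mod_cast congrArg Subtype.val (pow_orderOf_eq_one y)
  have hrA : r ∣ Nat.card A := by
    have := Fact.mk hA.hp
    obtain ⟨n, hn⟩ := IsPGroup.iff_card.1 hA.isPGroup
    rw [hn]
    refine dvd_pow_self r fun h0 => hA.ne_bot ?_
    rw [h0, pow_zero] at hn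
    exact card_eq_one.1 hn
  have hr := hmem r hA.hp (by rw [hA.card_normalizer]; exact hrA.mul_right s)
  have hs' := hmem s hA.hq (by rw [hA.card_normalizer]; exact dvd_mul_left s _)
  have hrs := hA.hpq
  rcases hr with rfl | rfl
  · rcases hs' with rfl | rfl
    · exact absurd rfl hrs
    · exact ⟨P, x, hs⟩
  · rcases hs' with rfl | rfl
    · exfalso
      have hPA : ∀ u ∈ P, π u = 1 := by
        intro u hu
        have huN : π u ∈ normalizer (A : Set S) := hs.le hu
        obtain ⟨b, rfl⟩ := hπ a
        have hb : b ∈ H := le_normalizer (H := A) ha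
        obtain ⟨i, hi⟩ := hs.isPGroup.exists_pow_eq_one
          (P.mul_mem hu (hs.normal b hb u⁻¹ (inv_mem hu)))
        have h1 : π (u * (b * u⁻¹ * b⁻¹)) ^ s ^ i = 1 := by rw [← map_pow, hi, map_one]
        have h2 : π (u * (b * u⁻¹ * b⁻¹)) ∈ A := by
          have h3 : π (u * (b * u⁻¹ * b⁻¹)) = π u * π b * (π u)⁻¹ * (π b)⁻¹ := by
            simp [mul_assoc]
          rw [h3]
          exact mul_mem ((mem_normalizer_iff.1 huN _).1 ha) (inv_mem ha)
        have h4 := eq_one_of_pow_coprime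
          (hc.symm.pow_right i) (hA.pow _ h2) h1
        have h5 : Commute (π u) (π b) := by
          have h6 : π (u * (b * u⁻¹ * b⁻¹)) = (π u * π b) * (π b * π u)⁻¹ := by
            simp [mul_assoc]
          rw [h6, mul_inv_eq_one] at h4
          exact h4
        obtain ⟨j, hj⟩ := hs.isPGroup.exists_pow_eq_one hu
        exact eq_one_of_pow_coprime (hc.symm.pow_right j)
          (hA.pow _ (hA.cent _ ha ha1 _ h5)) (by rw [← map_pow, hj, map_one])
      have h1 : ∀ g ∈ normalizer (A : Set S), ∃ k : ℤ, g = π x ^ k := by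
        intro g hg
        rw [← hmap] at hg
        obtain ⟨y, hy, rfl⟩ := hg
        obtain ⟨u, hu, k, rfl⟩ := hs.gen y hy
        exact ⟨k, by rw [map_mul, hPA u hu, one_mul, map_zpow]⟩
      obtain ⟨m, rfl⟩ := h1 t htN
      obtain ⟨n, rfl⟩ := h1 a (le_normalizer ha)
      exact hta ((Commute.refl _).zpow_zpow m n)
    · exact absurd rfl hrs

end

end ParaNil

namespace ParaNil

open Subgroup

section

variable {N S : Type*} [Group N] [Group S]

theorem SchmidtData.commute_of_mem_normal {Y : Subgroup N} {p q : ℕ} {P : Subgroup N} {x : N}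
    (h : SchmidtData Y p q P x) {Z : Subgroup N} [Z.Normal] (hZ : IsPGroup q Z) {z y : N}
    (hz : z ∈ Z) (hzY : z ∈ Y) (hy : y ∈ Y) : Commute z y := by
  have hpq : ∀ i j : ℕ, (p ^ i).Coprime (q ^ j) := fun i j => h.coprime.pow i j
  have hZP : ∀ w ∈ Z, w ∈ Y → ∀ u ∈ P, Commute w u := by
    intro w hw hwY u hu
    have h1 : w * u * w⁻¹ * u⁻¹ ∈ P := mul_mem (h.normal w hwY u hu) (inv_mem hu)
    have h2 : w * u * w⁻¹ * u⁻¹ ∈ Z := by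
      rw [mul_assoc w, mul_assoc]
      exact mul_mem hw (by simpa [mul_assoc] using Normal.conj_mem inferInstance _ (inv_mem hw) u)
    obtain ⟨i, hi⟩ := h.isPGroup.exists_pow_eq_one h1
    obtain ⟨j, hj⟩ := hZ.exists_pow_eq_one h2
    have h3 := eq_one_of_pow_coprime (hpq i j) hi hj
    rwa [mul_inv_eq_one, mul_inv_eq_iff_eq_mul] at h3
  obtain ⟨u, hu, k, hk⟩ := h.gen z hzY
  obtain ⟨m, hm⟩ := h.pow
  by_cases hqk : (q : ℤ) ∣ k
  · obtain ⟨l, rfl⟩ := hqk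
    have hxc : ∀ y ∈ Y, Commute (x ^ ((q : ℤ) * l)) y := fun y hy => by
      rw [zpow_mul, zpow_natCast]
      exact (h.central y hy).zpow_left l
    obtain ⟨j, hj⟩ := hZ.exists_pow_eq_one hz
    have hu1 : u = 1 := by
      obtain ⟨i, hi⟩ := h.isPGroup.exists_pow_eq_one hu
      have h1 : u = z * (x ^ ((q : ℤ) * l))⁻¹ := by rw [hk, mul_inv_cancel_right]
      have h2 : (x ^ ((q : ℤ) * l)) ^ q ^ m = 1 := by
        rw [← zpow_natCast, ← zpow_mul, mul_comm, zpow_mul, zpow_natCast, hm, one_zpow]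
      have h3 : u ^ q ^ (j + m) = 1 := by
        rw [h1, ((hxc z hzY).symm.inv_right).mul_pow, inv_pow, pow_add, pow_mul, hj, one_pow,
          one_mul, mul_comm (q ^ j), pow_mul, h2, one_pow, inv_one]
      exact eq_one_of_pow_coprime (hpq i _) hi h3
    rw [hk, hu1, one_mul]
    exact hxc y hy
  · exfalso
    have hpr : Prime (q : ℤ) := Nat.prime_iff_prime_int.1 h.hq
    have hcop : IsCoprime k ((q : ℤ) ^ m) :=
      ((hpr.coprime_iff_not_dvd.2 hqk).symm).pow_right
    obtain ⟨a, b, hab⟩ := hcop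
    have hx : (x ^ k) ^ a = x := by
      have h1 : x ^ (a * k + b * (q : ℤ) ^ m) = x := by rw [hab, zpow_one]
      rw [zpow_add, mul_comm b, zpow_mul x (_ ^ m), ← Nat.cast_pow, zpow_natCast, hm, one_zpow,
        mul_one, mul_comm, zpow_mul] at h1
      exact h1
    have h2 : (QuotientGroup.mk' Z) (x ^ k) = QuotientGroup.mk' Z u⁻¹ := by
      have h3 : QuotientGroup.mk' Z z = 1 := (QuotientGroup.eq_one_iff z).2 hz
      rw [hk, map_mul] at h3
      rw [map_inv]
      exact eq_inv_of_mul_eq_one_right h3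
    obtain ⟨i, hi⟩ := h.isPGroup.exists_pow_eq_one (inv_mem hu)
    have h4 : QuotientGroup.mk' Z (x ^ k) = 1 := by
      refine eq_one_of_pow_coprime (hpq i m) ?_ ?_
      · rw [h2, ← map_pow, hi, map_one]
      · rw [← map_pow, ← zpow_natCast, ← zpow_mul, mul_comm, zpow_mul, zpow_natCast, hm, one_zpow,
          map_one]
    have h5 : x ∈ Z := by
      rw [← hx]
      exact zpow_mem ((QuotientGroup.eq_one_iff _).1 h4) a
    obtain ⟨v, hv, hvx⟩ := h.not_comm
    exact hvx (hZP x h5 h.mem v hv)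

theorem LocalData.exists_klein {A : Subgroup S} (hA : LocalData 2 3 A) (hc : Nat.card A = 4)
    {a : S} (ha : a ∈ A) (ha1 : a ≠ 1) :
    ∃ x, x * a * x⁻¹ ∈ A ∧ x * (x * a * x⁻¹) * x⁻¹ = a * (x * a * x⁻¹) ∧
      ∀ u ∈ A, u = 1 ∨ u = a ∨ u = x * a * x⁻¹ ∨ u = a * (x * a * x⁻¹) := by
  obtain ⟨x, hxN, hx1, hx3, -⟩ := hA.gen
  have hfix : ∀ u ∈ A, u ≠ 1 → ¬ Commute x u := fun u hu hu1 h =>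
    hx1 (eq_one_of_pow_coprime (by norm_num) hx3 (hA.pow x (hA.cent u hu hu1 x h)))
  have hx2 : x = (x ^ 2) ^ 2 := by
    rw [← pow_mul, show 2 * 2 = 3 + 1 from rfl, pow_add, hx3, one_mul, pow_one]
  set b := x * a * x⁻¹ with hb
  have hbA : b ∈ A := (mem_normalizer_iff.1 hxN a).1 ha
  have hb1 : b ≠ 1 := fun h => ha1 (by rwa [hb, mul_inv_eq_one, mul_eq_left] at h)
  have hba : b ≠ a := fun h => hfix a ha ha1 (mul_inv_eq_iff_eq_mul.1 h)
  have ha2 := hA.pow a ha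
  have hai : a⁻¹ = a := inv_eq_of_mul_eq_one_left (by rw [← sq, ha2])
  have hab1 : a * b ≠ 1 := fun h => hba (by rw [eq_inv_of_mul_eq_one_right h, hai])
  have hall : ∀ u ∈ A, u = 1 ∨ u = a ∨ u = b ∨ u = a * b := by
    classical
    have := Nat.finite_of_card_ne_zero (α := A) (by omega)
    have := Fintype.ofFinite A
    have h1 : ({1, ⟨a, ha⟩, ⟨b, hbA⟩, ⟨a * b, mul_mem ha hbA⟩} : Finset A) = Finset.univ := by
      refine Finset.eq_univ_of_card _ ?_
      rw [← Nat.card_eq_fintype_card, hc]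
      rw [Finset.card_insert_of_notMem, Finset.card_insert_of_notMem, Finset.card_insert_of_notMem,
        Finset.card_singleton]
      · simpa [Subtype.ext_iff] using ha1
      · simp [Subtype.ext_iff, hba.symm, hb1]
      · simp [Subtype.ext_iff, ha1.symm, hb1.symm, hab1.symm]
    intro u hu
    have h2 : (⟨u, hu⟩ : A) ∈ Finset.univ := Finset.mem_univ _
    rw [← h1] at h2
    simpa [Subtype.ext_iff] using h2
  refine ⟨x, hbA, ?_, hall⟩
  rcases hall _ ((mem_normalizer_iff.1 hxN b).1 hbA) with h | h | h | h
  · rw [mul_inv_eq_one, mul_eq_left] at h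
    exact absurd h hb1
  · exfalso
    have h1 : Commute (x ^ 2) a := by
      rw [commute_iff_eq, ← mul_inv_eq_iff_eq_mul]
      nth_rw 2 [← h]
      rw [hb, sq]
      group
    exact hfix a ha ha1 (hx2 ▸ h1.pow_left 2)
  · exact absurd (mul_inv_eq_iff_eq_mul.1 h) (hfix b hbA hb1)
  · exact h

end

end ParaNil

namespace ParaNil

open Subgroup

section

variable {N S : Type*} [Group N] [Group S] [Finite N] {π : N →* S}

theorem Setting.isPGroup_ker (h : Setting S) (hπ : Function.Surjective π)
    (hN : ProperNilOrMinimal N) : IsPGroup 2 π.ker := by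
  have := h.finite
  have := h.simple
  have := Fact.mk Nat.prime_two
  obtain ⟨P⟩ := (inferInstance : Nonempty (Sylow 2 S))
  obtain ⟨hP, -⟩ := h.localData_two P
  obtain ⟨Q, hQ, -⟩ := h.exists_localData_five
  have hne : ∀ {p q : ℕ} {A : Subgroup S}, LocalData p q A → normalizer (A : Set S) ≠ ⊤ :=
    fun {p q A} hA => h.normalizer_ne_top hA.ne_bot (h.ne_top_of_isNilpotent
      (have := Fact.mk hA.hp; hA.isPGroup.isNilpotent))
  obtain ⟨P', x, hs⟩ := hP.exists_schmidtData_comap hπ hN (hne hP)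
  obtain ⟨Q', y, ht⟩ := hQ.exists_schmidtData_comap hπ hN (hne hQ)
  refine IsPGroup.of_card (n := _) (Nat.eq_prime_pow_of_unique_prime_dvd Nat.card_pos.ne' ?_)
  intro l hl hdvd
  have := Fact.mk hl
  obtain ⟨z, hz⟩ := exists_prime_orderOf_dvd_card' l hdvd
  have hz1 : (z : N) ≠ 1 := fun h => by
    rw [Subtype.ext (a1 := z) (a2 := 1) h, orderOf_one] at hz
    exact hl.one_lt.ne hz
  have hzl : (z : N) ^ l ^ 1 = 1 := by
    rw [pow_one, ← hz]
    exact_mod_cast congrArg Subtype.val (pow_orderOf_eq_one z)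
  have hmem : ∀ A : Subgroup S, (z : N) ∈ A.comap π := fun A => by
    rw [mem_comap, π.mem_ker.1 z.2]
    exact one_mem A
  have h1 := hs.prime_eq hl (hmem _) hz1 ⟨1, hzl⟩
  have h2 := ht.prime_eq hl (hmem _) hz1 ⟨1, hzl⟩
  omega

theorem Setting.ker_le_center (h : Setting S) (hπ : Function.Surjective π)
    (hN : ProperNilOrMinimal N) : π.ker ≤ center N := by
  have := h.finite
  have := h.simple
  obtain ⟨Q, hQ, -⟩ := h.exists_localData_five
  obtain ⟨Q', y, ht⟩ := hQ.exists_schmidtData_comap hπ hN (h.normalizer_ne_top hQ.ne_bot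
    (h.ne_top_of_isNilpotent (have := Fact.mk hQ.hp; hQ.isPGroup.isNilpotent)))
  set Y := (normalizer (Q : Set S)).comap π
  have hY : Y ≤ centralizer (π.ker : Set N) := fun y hy z hz =>
    ht.commute_of_mem_normal (h.isPGroup_ker hπ hN) hz
      (by rw [mem_comap, π.mem_ker.1 hz]; exact one_mem _) hy
  have hker : π.ker ≤ Y := fun z hz => by
    rw [mem_comap, π.mem_ker.1 hz]
    exact one_mem _
  have h1 : ((centralizer (π.ker : Set N)).map π).Normal := Normal.map inferInstance π hπ
  have h2 : centralizer (π.ker : Set N) = ⊤ := by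
    rcases h1.eq_bot_or_eq_top with h2 | h2
    · obtain ⟨a, ha, ha1⟩ := exists_ne_one_of_ne_bot hQ.ne_bot
      obtain ⟨b, rfl⟩ := hπ a
      refine absurd ?_ ha1
      rw [← mem_bot, ← h2]
      exact ⟨b, hY (le_normalizer (H := Q) ha), rfl⟩
    · rw [← comap_map_eq_self (hker.trans hY), h2, comap_top]
  intro z hz
  rw [mem_center_iff]
  intro g
  have h3 : g ∈ centralizer (π.ker : Set N) := h2 ▸ mem_top g
  exact (mem_centralizer_iff.1 h3 z hz).symm

theorem Setting.exists_ker_le (h : Setting S) (hπ : Function.Surjective π)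
    (hN : ProperNilOrMinimal N) (hperf : commutator N = ⊤) {g : N} (hg : π g ≠ 1)
    (hg2 : π g ^ 2 = 1) :
    ∃ c, c ^ 2 = 1 ∧ (∀ z ∈ π.ker, z = 1 ∨ z = c) ∧ (g ^ 2 = 1 → c = 1) := by
  have := h.finite
  have := Fact.mk Nat.prime_two
  obtain ⟨P, hgP⟩ := ParaNil.exists_sylow_mem (p := 2) (k := 1) hg2
  obtain ⟨hP, hcard⟩ := h.localData_two P
  obtain ⟨x, hbP, hxb, hall⟩ := hP.exists_klein hcard hgP hg
  obtain ⟨y, rfl⟩ := hπ x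
  have hcen : ∀ z ∈ π.ker, ∀ w, Commute z w := fun z hz w =>
    (mem_center_iff.1 (h.ker_le_center hπ hN hz) w).symm
  set b := y * g * y⁻¹ with hb
  have hπb : π b = π y * π g * (π y)⁻¹ := by simp [hb]
  rw [← hπb] at hbP hxb hall
  set c := g * b * g⁻¹ * b⁻¹ with hc
  have hgb : Commute (π g) (π b) := hP.comm _ hgP _ hbP
  have hck : c ∈ π.ker := by
    rw [MonoidHom.mem_ker, hc, map_mul, map_mul, map_mul, map_inv, map_inv, hgb.eq,
      mul_inv_cancel_right, mul_inv_cancel]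
  have hgb' : g * b = c * (b * g) := by rw [hc]; group
  have hc2 : c ^ 2 = 1 := by
    have h1 : g ^ 2 * b = c ^ 2 * (b * g ^ 2) := by
      calc g ^ 2 * b = g * (g * b) := by rw [sq, mul_assoc]
        _ = g * (c * (b * g)) := by rw [hgb']
        _ = c * (g * b) * g := by rw [← mul_assoc, ← (hcen c hck g).eq]; group
        _ = c * (c * (b * g)) * g := by rw [hgb']
        _ = c ^ 2 * (b * g ^ 2) := by rw [sq, sq]; group
    have h2 : g ^ 2 ∈ π.ker := by rw [MonoidHom.mem_ker, map_pow, hg2]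
    rw [(hcen _ h2 b).eq, eq_comm, mul_eq_right] at h1
    exact h1
  have hnormal : (zpowers c).Normal := by
    refine ⟨fun w hw v => ?_⟩
    obtain ⟨k, rfl⟩ := mem_zpowers_iff.1 hw
    rw [← ((hcen c hck v).zpow_left k).eq, mul_inv_cancel_right]
    exact hw
  let φ := QuotientGroup.mk' (zpowers c)
  have hφ1 : ∀ {w}, φ w = 1 ↔ w ∈ zpowers c := fun {w} => QuotientGroup.eq_one_iff w
  have hφc : Commute (φ g) (φ b) := by
    have h1 : φ c = 1 := hφ1.2 (mem_zpowers c)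
    rw [commute_iff_eq, ← map_mul, hgb', map_mul, h1, one_mul, map_mul]
  set T := (P : Subgroup S).comap π with hT
  have hT1 : ∀ v, Commute v (φ g) → Commute v (φ b) → ∀ t ∈ T, Commute v (φ t) := by
    intro v hvg hvb t ht
    have hk : ∀ w, π t = π w → Commute v (φ w) → Commute v (φ t) := fun w hw hvw => by
      obtain ⟨v, rfl⟩ := QuotientGroup.mk'_surjective _ v
      have h2 : t = (t * w⁻¹) * w := by group
      rw [h2, map_mul]
      exact ((hcen _ (by rw [MonoidHom.mem_ker, map_mul, map_inv, hw, mul_inv_cancel])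
        v).symm.map φ).mul_right hvw
    rcases hall _ ht with h2 | h2 | h2 | h2
    · exact hk 1 (by rw [h2, map_one]) (by simp)
    · exact hk g h2 hvg
    · exact hk b h2 hvb
    · exact hk (g * b) (by rw [h2, map_mul π g b]) (by rw [map_mul]; exact hvg.mul_right hvb)
  have hTc : ∀ s ∈ T, ∀ t ∈ T, Commute (φ s) (φ t) := fun s hs =>
    hT1 _ (hT1 _ (Commute.refl _) hφc s hs).symm (hT1 _ hφc.symm (Commute.refl _) s hs).symm
  have hTi : T.index = 15 := by
    rw [hT, index_comap_of_surjective _ hπ]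
    have h1 := (P : Subgroup S).card_mul_index
    rw [hcard, h.card_eq_sixty] at h1
    omega
  obtain ⟨K, hK, hKT⟩ := exists_transfer_kernel T φ hTc
  have hker : ∀ z ∈ π.ker, z = 1 ∨ z = c := by
    intro z hz
    have h1 := (hKT z (hcen z hz)).1 (hK (hperf ▸ mem_top z))
    rw [hTi, ← map_pow, hφ1] at h1
    have hcz : ∀ w ∈ zpowers c, w = 1 ∨ w = c := by
      intro w hw
      obtain ⟨k, rfl⟩ := mem_zpowers_iff.1 hw
      rcases Int.even_or_odd' k with ⟨m, rfl | rfl⟩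
      · left
        rw [zpow_mul]
        norm_cast
        rw [hc2, one_zpow]
      · right
        rw [zpow_add, zpow_mul]
        norm_cast
        rw [hc2, one_zpow, one_mul, pow_one]
    obtain ⟨i, hi⟩ := (h.isPGroup_ker hπ hN).exists_pow_eq_one hz
    have h2 : z ^ 2 = 1 := by
      refine eq_one_of_pow_coprime (m := 15) (n := 2 ^ i) (Nat.Coprime.pow_right i (by norm_num))
        ?_ (by rw [← pow_mul, mul_comm, pow_mul, hi, one_pow])
      rw [← pow_mul, mul_comm, pow_mul]
      rcases hcz _ h1 with h3 | h3
      · rw [h3, one_pow]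
      · rw [h3, hc2]
    have h3 : z ^ 15 = z := by
      rw [show 15 = 2 * 7 + 1 from rfl, pow_add, pow_mul, h2, one_pow, one_mul, pow_one]
    exact hcz z (h3 ▸ h1)
  refine ⟨c, hc2, hker, fun hgsq => ?_⟩
  have hbsq : b ^ 2 = 1 := by rw [hb, conj_pow, hgsq, mul_one, mul_inv_cancel]
  have h1 : (y * b * y⁻¹) ^ 2 = 1 := by rw [conj_pow, hbsq, mul_one, mul_inv_cancel]
  have h2 : y * b * y⁻¹ * (g * b)⁻¹ ∈ π.ker := by
    rw [MonoidHom.mem_ker, map_mul, map_mul, map_mul, map_inv, hxb, map_inv, map_mul π g b,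
      mul_inv_cancel]
  obtain ⟨k, hk, hkb⟩ : ∃ k ∈ π.ker, y * b * y⁻¹ = k * (g * b) := ⟨_, h2, by group⟩
  have hk2 : k ^ 2 = 1 := by
    rcases hker k hk with rfl | rfl
    · rw [one_pow]
    · exact hc2
  rw [hkb, (hcen k hk _).mul_pow, hk2, one_mul] at h1
  have h3 := LocalFamily.inv_of_sq hgsq h1
  rw [hc, h3, inv_eq_of_mul_eq_one_left (by rw [← sq, hbsq]), ← sq, hbsq]

end

end ParaNil

namespace ParaNil

open Subgroup

/-- A central extension of `S` by a group of order two in which no lift of an involution of `S` is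
an involution. -/
structure Cover {N S : Type*} [Group N] [Group S] (π : N →* S) (z : N) : Prop where
  surjective : Function.Surjective π
  ne_one : z ≠ 1
  map_eq_one : π z = 1
  eq_or_eq : ∀ g, π g = 1 → g = 1 ∨ g = z
  sq_eq : ∀ g, π g ≠ 1 → π g ^ 2 = 1 → g ^ 2 = z

theorem Setting.exists_cover {N S : Type*} [Group N] [Group S] [Finite N] {π : N →* S}
    (h : Setting S) (hπ : Function.Surjective π) (hN : ProperNilOrMinimal N)
    (hperf : commutator N = ⊤) (hinj : ¬ Function.Injective π) : ∃ z, Cover π z := by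
  have := h.finite
  have := Fact.mk Nat.prime_two
  rw [← MonoidHom.ker_eq_bot_iff] at hinj
  obtain ⟨z, hz, hz1⟩ := exists_ne_one_of_ne_bot hinj
  have hsq : ∀ g, π g ≠ 1 → π g ^ 2 = 1 → (∀ w ∈ π.ker, w = 1 ∨ w = z) ∧ g ^ 2 = z := by
    intro g hg hg2
    obtain ⟨c, -, hc, hgc⟩ := h.exists_ker_le hπ hN hperf hg hg2
    have hcz : z = c := (hc z hz).resolve_left hz1
    subst hcz
    refine ⟨hc, (hc _ ?_).resolve_left fun h1 => hz1 (hgc h1)⟩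
    rw [MonoidHom.mem_ker, map_pow, hg2]
  obtain ⟨P⟩ := (inferInstance : Nonempty (Sylow 2 S))
  obtain ⟨hP, -⟩ := h.localData_two P
  obtain ⟨a, ha, ha1⟩ := exists_ne_one_of_ne_bot hP.ne_bot
  obtain ⟨b, rfl⟩ := hπ a
  exact ⟨z, hπ, hz1, hz, fun g hg => (hsq b ha1 (hP.pow _ ha)).1 g hg,
    fun g h1 h2 => (hsq g h1 h2).2⟩

namespace Cover

variable {N N' S : Type*} [Group N] [Group N'] [Group S] {π : N →* S} {π' : N' →* S} {z : N}
  {z' : N'}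

theorem sq_eq_one (h : Cover π z) : z ^ 2 = 1 := by
  refine (h.eq_or_eq (z ^ 2) (by rw [map_pow, h.map_eq_one, one_pow])).resolve_right fun h1 => ?_
  rw [sq, mul_eq_left] at h1
  exact h.ne_one h1

theorem commute (h : Cover π z) (g : N) : Commute z g := by
  have h1 := (h.eq_or_eq (g * z * g⁻¹) (by simp [h.map_eq_one])).resolve_left fun h1 =>
    h.ne_one (by rwa [mul_inv_eq_one, mul_eq_left] at h1)
  exact (mul_inv_eq_iff_eq_mul.1 h1).symm

theorem card_eq (h : Cover π z) : Nat.card N = 2 * Nat.card S := by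
  have h1 : Nat.card π.ker = 2 := by
    rw [Nat.card_eq_two_iff]
    refine ⟨1, ⟨z, h.map_eq_one⟩, fun h1 => h.ne_one (congrArg Subtype.val h1).symm, ?_⟩
    rw [Set.eq_univ_iff_forall]
    rintro ⟨g, hg⟩
    rcases h.eq_or_eq g hg with rfl | rfl
    · exact Or.inl rfl
    · exact Or.inr rfl
  rw [← π.ker.card_mul_index, h1, index_ker, MonoidHom.range_eq_top.2 h.surjective, card_top]

/-- The elements lying over an elementary abelian `2`-subgroup have square in the kernel. -/
theorem sq_eq_or (h : Cover π z) {g : N} (hg : π g ^ 2 = 1) :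
    (π g = 1 → g ^ 2 = 1) ∧ (π g ≠ 1 → g ^ 2 = z) := by
  refine ⟨fun h1 => ?_, fun h1 => h.sq_eq g h1 hg⟩
  rcases h.eq_or_eq g h1 with rfl | rfl
  · rw [one_pow]
  · exact h.sq_eq_one

theorem nonempty_mulEquiv [Finite N] [Finite N'] (hS : Setting S) (h : Cover π z)
    (h' : Cover π' z') (hperf : commutator N = ⊤) : Nonempty (N ≃* N') := by
  have := hS.finite
  have := Fact.mk Nat.prime_two
  obtain ⟨P⟩ := (inferInstance : Nonempty (Sylow 2 S))
  obtain ⟨hP, hcard⟩ := hS.localData_two P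
  let E : Subgroup (N × N') :=
    (π.comp (MonoidHom.fst N N')).eqLocus (π'.comp (MonoidHom.snd N N'))
  let f : E →* N := (MonoidHom.fst N N').comp E.subtype
  let f' : E →* N' := (MonoidHom.snd N N').comp E.subtype
  have hE : ∀ e : E, π (f e) = π' (f' e) := fun e => e.2
  have hext : ∀ e e' : E, f e = f e' → f' e = f' e' → e = e' := fun e e' h1 h2 =>
    Subtype.ext (Prod.ext h1 h2)
  have hf : Function.Surjective f := fun a => by
    obtain ⟨b, hb⟩ := h'.surjective (π a)
    exact ⟨⟨(a, b), hb.symm⟩, rfl⟩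
  let d : E := ⟨(z, z'), h.map_eq_one.trans h'.map_eq_one.symm⟩
  have hd : ∀ e, Commute d e := fun e =>
    hext _ _ (h.commute (f e)) (h'.commute (f' e))
  have hd2 : d ^ 2 = 1 := hext _ _ h.sq_eq_one h'.sq_eq_one
  have hdz : ∀ e ∈ zpowers d, e = 1 ∨ e = d := by
    intro e he
    obtain ⟨k, rfl⟩ := mem_zpowers_iff.1 he
    rcases Int.even_or_odd' k with ⟨m, rfl | rfl⟩
    · left
      rw [zpow_mul]
      norm_cast
      rw [hd2, one_zpow]
    · right
      rw [zpow_add, zpow_mul]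
      norm_cast
      rw [hd2, one_zpow, one_mul, pow_one]
  have hnormal : (zpowers d).Normal := by
    refine ⟨fun w hw v => ?_⟩
    obtain ⟨k, rfl⟩ := mem_zpowers_iff.1 hw
    rw [← ((hd v).zpow_left k).eq, mul_inv_cancel_right]
    exact hw
  let φ := QuotientGroup.mk' (zpowers d)
  have hφ1 : ∀ {w}, φ w = 1 ↔ w ∈ zpowers d := fun {w} => QuotientGroup.eq_one_iff w
  set T := (P : Subgroup S).comap (π.comp f) with hT
  have hTsq : ∀ t ∈ T, φ t ^ 2 = 1 := by
    intro t ht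
    rw [← map_pow, hφ1]
    have h1 := h.sq_eq_or (hP.pow _ ht)
    have h2 := h'.sq_eq_or (g := f' t) (by rw [← hE]; exact hP.pow _ ht)
    rw [← hE] at h2
    by_cases h3 : π (f t) = 1
    · rw [hext (t ^ 2) 1 ((map_pow f t 2).trans (h1.1 h3)) ((map_pow f' t 2).trans (h2.1 h3))]
      exact one_mem _
    · rw [hext (t ^ 2) d ((map_pow f t 2).trans (h1.2 h3)) ((map_pow f' t 2).trans (h2.2 h3))]
      exact mem_zpowers d
  have hTc : ∀ s ∈ T, ∀ t ∈ T, Commute (φ s) (φ t) := by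
    intro s hs t ht
    have h1 := LocalFamily.inv_of_sq (hTsq s hs) (by
      rw [← map_mul]; exact hTsq _ (mul_mem hs ht))
    have h2 : (φ t)⁻¹ = φ t := inv_eq_of_mul_eq_one_left (by rw [← sq, hTsq t ht])
    rw [h2, mul_inv_eq_iff_eq_mul] at h1
    exact h1
  have hTi : T.index = 15 := by
    have hs : Function.Surjective (π.comp f) := h.surjective.comp hf
    rw [hT, index_comap_of_surjective _ hs]
    have h1 := (P : Subgroup S).card_mul_index
    rw [hcard, hS.card_eq_sixty] at h1
    omega
  obtain ⟨K, hK, hKT⟩ := exists_transfer_kernel T φ hTc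
  have hnot : ∀ e : E, e ^ 2 = 1 → (∀ g, Commute e g) → e ≠ 1 → e ≠ d → e ∉ commutator E := by
    intro e he hec he1 hed hmem
    have h1 := (hKT e hec).1 (hK hmem)
    rw [hTi, ← map_pow, hφ1, show 15 = 2 * 7 + 1 from rfl, pow_add, pow_mul, he, one_pow, one_mul,
      pow_one] at h1
    exact (hdz e h1).elim he1 hed
  have hinj : Function.Injective (f.comp (commutator E).subtype) := by
    rw [injective_iff_map_eq_one]
    rintro ⟨e, he⟩ h1
    have h2 : f e = 1 := h1
    refine Subtype.ext ?_
    rcases h'.eq_or_eq (f' e) (by rw [← hE, h2, map_one]) with h3 | h3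
    · exact hext _ _ h2 h3
    · refine absurd he (hnot e (hext _ _ ?_ ?_) (fun g => hext _ _ ?_ ?_) ?_ ?_)
      · rw [map_pow, h2, one_pow, map_one]
      · rw [map_pow, h3, h'.sq_eq_one, map_one]
      · rw [map_mul, map_mul, h2, one_mul, mul_one]
      · rw [map_mul, map_mul, h3, (h'.commute _).eq]
      · rintro rfl
        exact h'.ne_one (h3.symm.trans (map_one f'))
      · rintro rfl
        exact h.ne_one h2
  have hinj' : Function.Injective (f'.comp (commutator E).subtype) := by
    rw [injective_iff_map_eq_one]
    rintro ⟨e, he⟩ h1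
    have h2 : f' e = 1 := h1
    refine Subtype.ext ?_
    rcases h.eq_or_eq (f e) (by rw [hE, h2, map_one]) with h3 | h3
    · exact hext _ _ h3 h2
    · refine absurd he (hnot e (hext _ _ ?_ ?_) (fun g => hext _ _ ?_ ?_) ?_ ?_)
      · rw [map_pow, h3, h.sq_eq_one, map_one]
      · rw [map_pow, h2, one_pow, map_one]
      · rw [map_mul, map_mul, h3, (h.commute _).eq]
      · rw [map_mul, map_mul, h2, one_mul, mul_one]
      · rintro rfl
        exact h.ne_one (h3.symm.trans (map_one f))
      · rintro rfl
        exact h'.ne_one h2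
  have hsurj : Function.Surjective (f.comp (commutator E).subtype) := by
    rw [← MonoidHom.range_eq_top, MonoidHom.range_comp, range_subtype]
    rw [_root_.commutator, map_commutator, map_top_of_surjective f hf]
    exact hperf
  have hbij' : Function.Bijective (f'.comp (commutator E).subtype) := by
    rw [Nat.bijective_iff_injective_and_card]
    exact ⟨hinj', by rw [Nat.card_congr (Equiv.ofBijective _ ⟨hinj, hsurj⟩), h.card_eq,
      h'.card_eq]⟩
  exact ⟨(MulEquiv.ofBijective _ ⟨hinj, hsurj⟩).symm.trans (MulEquiv.ofBijective _ hbij')⟩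

end Cover

end ParaNil

namespace ParaNil

open Subgroup

/-- Whether a matrix of determinant one over the field with five elements is monomial. -/
def Monomial (g : Matrix.SpecialLinearGroup (Fin 2) (ZMod 5)) : Prop :=
  (g.1 0 1 = 0 ∧ g.1 1 0 = 0) ∨ (g.1 0 0 = 0 ∧ g.1 1 1 = 0)

instance : DecidablePred Monomial := fun g => by unfold Monomial; infer_instance

/-- The diagonal matrix with entries `2` and `3`. -/
def diagTwo : Matrix.SpecialLinearGroup (Fin 2) (ZMod 5) := ⟨!![2, 0; 0, 3], by decide⟩

/-- The rotation matrix of order four. -/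
def rotation : Matrix.SpecialLinearGroup (Fin 2) (ZMod 5) := ⟨!![0, 1; -1, 0], by decide⟩

/-- An elementary transvection. -/
def transvection : Matrix.SpecialLinearGroup (Fin 2) (ZMod 5) := ⟨!![1, 1; 0, 1], by decide⟩

/-- The monomial matrices; they form a quaternion group of order eight. -/
def monomialSubgroup : Subgroup (Matrix.SpecialLinearGroup (Fin 2) (ZMod 5)) where
  carrier := {g | Monomial g}
  one_mem' := by change Monomial 1; decide +kernel
  mul_mem' := by
    intro a b (ha : Monomial a) (hb : Monomial b)
    change Monomial (a * b)
    revert a b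
    decide +kernel
  inv_mem' := by
    intro a (ha : Monomial a)
    change Monomial a⁻¹
    revert a
    decide +kernel

theorem mem_normalizer_monomialSubgroup {g : Matrix.SpecialLinearGroup (Fin 2) (ZMod 5)} :
    g ∈ normalizer (monomialSubgroup : Set (Matrix.SpecialLinearGroup (Fin 2) (ZMod 5))) ↔
      Monomial (g * diagTwo * g⁻¹) ∧ Monomial (g * rotation * g⁻¹) := by
  have hgen : ∀ n, Monomial n → ∃ (a : Fin 4) (b : Fin 2), n = diagTwo ^ a.1 * rotation ^ b.1 := by
    decide +kernel
  constructor
  · intro h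
    have h1 : Monomial diagTwo := by decide +kernel
    have h2 : Monomial rotation := by decide +kernel
    exact ⟨(mem_normalizer_iff.1 h _).1 h1, (mem_normalizer_iff.1 h _).1 h2⟩
  · rintro ⟨h1, h2⟩
    refine mem_normalizer_of_conj_mem fun n hn => ?_
    obtain ⟨a, b, rfl⟩ := hgen n hn
    rw [← MulAut.conj_apply, map_mul, map_pow, map_pow]
    exact mul_mem (monomialSubgroup.pow_mem h1 _) (monomialSubgroup.pow_mem h2 _)

theorem card_specialLinearGroup : Nat.card (Matrix.SpecialLinearGroup (Fin 2) (ZMod 5)) = 120 := by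
  rw [Nat.card_eq_fintype_card]
  decide +kernel

theorem index_normalizer_monomialSubgroup : (normalizer
    (monomialSubgroup : Set (Matrix.SpecialLinearGroup (Fin 2) (ZMod 5)))).index = 5 := by
  have h1 := (normalizer
    (monomialSubgroup : Set (Matrix.SpecialLinearGroup (Fin 2) (ZMod 5)))).card_mul_index
  have h2 : Nat.card {g : Matrix.SpecialLinearGroup (Fin 2) (ZMod 5) //
      Monomial (g * diagTwo * g⁻¹) ∧ Monomial (g * rotation * g⁻¹)} = 24 := by
    rw [Nat.card_eq_fintype_card]
    decide +kernel
  rw [← Nat.card_congr (Equiv.subtypeEquivRight fun g => mem_normalizer_monomialSubgroup)] at h2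
  rw [card_specialLinearGroup] at h1
  have h3 : 24 * (normalizer
    (monomialSubgroup : Set (Matrix.SpecialLinearGroup (Fin 2) (ZMod 5)))).index = 120 := by
    rw [← h1, ← h2]
  omega

theorem mem_normalCore_iff {g : Matrix.SpecialLinearGroup (Fin 2) (ZMod 5)} :
    g ∈ (normalizer (monomialSubgroup :
      Set (Matrix.SpecialLinearGroup (Fin 2) (ZMod 5)))).normalCore ↔ g = 1 ∨ g = -1 := by
  constructor
  · intro h
    have h1 : ∀ g : Matrix.SpecialLinearGroup (Fin 2) (ZMod 5), (∀ k : Fin 3,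
        Monomial (transvection ^ k.1 * g * (transvection ^ k.1)⁻¹ * diagTwo *
          (transvection ^ k.1 * g * (transvection ^ k.1)⁻¹)⁻¹) ∧
        Monomial (transvection ^ k.1 * g * (transvection ^ k.1)⁻¹ * rotation *
          (transvection ^ k.1 * g * (transvection ^ k.1)⁻¹)⁻¹)) → g = 1 ∨ g = -1 := by
      decide +kernel
    exact h1 g fun k => mem_normalizer_monomialSubgroup.1 (h (transvection ^ k.1))
  · rintro (rfl | rfl)
    · exact one_mem _
    · intro b
      rw [mul_neg_one, neg_mul, mul_inv_cancel]
      exact mem_normalizer_monomialSubgroup.2 (by decide +kernel)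

theorem exists_cover_specialLinearGroup : ∃ π : Matrix.SpecialLinearGroup (Fin 2) (ZMod 5) →*
    alternatingGroup (Fin 5), Cover π (-1) := by
  obtain ⟨f, hf⟩ := exists_hom_perm_of_index (by norm_num) index_normalizer_monomialSubgroup
  have hker : ∀ g, f g = 1 ↔ g = 1 ∨ g = -1 := fun g => by
    rw [← MonoidHom.mem_ker, hf, mem_normalCore_iff]
  have hne : (-1 : Matrix.SpecialLinearGroup (Fin 2) (ZMod 5)) ≠ 1 := by decide +kernel
  have hkc : Nat.card f.ker = 2 := by
    rw [Nat.card_eq_two_iff]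
    refine ⟨1, ⟨-1, (hker _).2 (Or.inr rfl)⟩, fun h => hne (congrArg Subtype.val h).symm, ?_⟩
    refine Set.eq_univ_of_forall fun g => ?_
    rcases (hker g).1 g.2 with h | h
    · exact Or.inl (Subtype.ext h)
    · exact Or.inr (Subtype.ext h)
  have hr : f.range = alternatingGroup (Fin 5) := by
    refine Equiv.Perm.eq_alternatingGroup_of_index_eq_two ?_
    have h1 := f.ker.card_mul_index
    rw [hkc, index_ker, card_specialLinearGroup] at h1
    have h2 := f.range.card_mul_index
    rw [Nat.card_perm, Nat.card_fin, show Nat.factorial 5 = 120 from rfl] at h2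
    have h3 : Nat.card f.range = 60 := by omega
    rw [h3] at h2
    omega
  let e := MulEquiv.subgroupCongr hr
  have he : ∀ g, e.toMonoidHom.comp f.rangeRestrict g = 1 ↔ g = 1 ∨ g = -1 := fun g => by
    rw [← hker, ← f.coe_rangeRestrict, MonoidHom.comp_apply, MulEquiv.coe_toMonoidHom,
      EmbeddingLike.map_eq_one_iff, OneMemClass.coe_eq_one]
  have hsq : ∀ g : Matrix.SpecialLinearGroup (Fin 2) (ZMod 5), g ^ 2 = 1 → g = 1 ∨ g = -1 := by
    decide +kernel
  refine ⟨e.toMonoidHom.comp f.rangeRestrict, e.surjective.comp f.rangeRestrict_surjective, hne,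
    (he _).2 (Or.inr rfl), fun g => (he g).1, fun g hg hg2 => ?_⟩
  rw [← map_pow, he] at hg2
  exact hg2.resolve_left fun h => hg ((he g).2 (hsq g h))

end ParaNil

namespace ParaNil

open Subgroup

theorem exists_normal_isSimpleGroup_quotient (N : Type*) [Group N] [Finite N] [Nontrivial N] :
    ∃ (Z : Subgroup N) (_ : Z.Normal), IsSimpleGroup (N ⧸ Z) := by
  have : Nonempty {Z : Subgroup N // Z.Normal ∧ Z ≠ ⊤} := ⟨⊥, inferInstance, bot_ne_top⟩
  obtain ⟨⟨Z, hZ, hZt⟩, hmax⟩ :=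
    Finite.exists_max (fun Z : {Z : Subgroup N // Z.Normal ∧ Z ≠ ⊤} => Nat.card Z.1)
  refine ⟨Z, hZ, ?_⟩
  have : Nontrivial (N ⧸ Z) := QuotientGroup.nontrivial_iff.2 hZt
  refine ⟨fun K hK => or_iff_not_imp_right.2 fun hKt => ?_⟩
  have hsurj := QuotientGroup.mk'_surjective Z
  have hle : Z ≤ K.comap (QuotientGroup.mk' Z) := fun z hz => by
    rw [mem_comap, QuotientGroup.mk'_apply, (QuotientGroup.eq_one_iff z).2 hz]
    exact one_mem K
  have hne : K.comap (QuotientGroup.mk' Z) ≠ ⊤ := fun h => hKt (by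
    rw [← map_comap_eq_self_of_surjective hsurj K, h, map_top_of_surjective _ hsurj])
  have heq := eq_of_le_of_card_ge hle (hmax ⟨_, hK.comap _, hne⟩)
  rw [← map_comap_eq_self_of_surjective hsurj K, ← heq, Subgroup.map_eq_bot_iff, QuotientGroup.ker_mk']

/-- A finite perfect group all of whose proper subgroups are nilpotent or minimal non-nilpotent has
an image as in `Setting`, and it is determined by it. -/
theorem exists_setting (N : Type*) [Group N] [Finite N] [Nontrivial N]
    (hperf : commutator N = ⊤) (hN : ProperNilOrMinimal N) :
    ∃ (Z : Subgroup N) (_ : Z.Normal), Setting (N ⧸ Z) := by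
  obtain ⟨Z, hZ, hs⟩ := exists_normal_isSimpleGroup_quotient N
  have hsurj := QuotientGroup.mk'_surjective Z
  refine ⟨Z, hZ, inferInstance, hs, ?_, hN.of_surjective _ hsurj⟩
  rw [_root_.commutator, ← map_top_of_surjective _ hsurj, ← map_commutator]
  exact congrArg _ hperf

theorem nonempty_mulEquiv_of_commutator_eq_top {N : Type*} [Group N] [Finite N] [Nontrivial N]
    (hperf : commutator N = ⊤) (hN : ProperNilOrMinimal N) :
    Nonempty (N ≃* alternatingGroup (Fin 5)) ∨
      Nonempty (N ≃* Matrix.SpecialLinearGroup (Fin 2) (ZMod 5)) := by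
  obtain ⟨Z, hZ, hS⟩ := exists_setting N hperf hN
  obtain ⟨e⟩ := hS.nonempty_mulEquiv
  have hsurj := QuotientGroup.mk'_surjective Z
  by_cases hinj : Function.Injective (QuotientGroup.mk' Z)
  · exact Or.inl ⟨(MulEquiv.ofBijective _ ⟨hinj, hsurj⟩).trans e⟩
  · right
    obtain ⟨z, hz⟩ := hS.exists_cover hsurj hN hperf hinj
    obtain ⟨π, hπ⟩ := exists_cover_specialLinearGroup
    have hπ' : Cover (e.symm.toMonoidHom.comp π) (-1) := by
      have h1 : ∀ g, e.symm.toMonoidHom.comp π g = 1 ↔ π g = 1 := fun g => by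
        rw [MonoidHom.comp_apply, MulEquiv.coe_toMonoidHom, EmbeddingLike.map_eq_one_iff]
      refine ⟨e.symm.surjective.comp hπ.surjective, hπ.ne_one, (h1 _).2 hπ.map_eq_one,
        fun g hg => hπ.eq_or_eq g ((h1 g).1 hg), fun g hg hg2 => hπ.sq_eq g (hg ∘ (h1 g).2) ?_⟩
      rw [← map_pow] at hg2 ⊢
      exact (h1 _).1 hg2
    exact hz.nonempty_mulEquiv hS hπ' hperf

/-- A Sylow `2`-subgroup has a non-nilpotent proper normalizer. -/
theorem exists_sylow_normalizer {N : Type*} [Group N] [Finite N] [Nontrivial N]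
    (hperf : commutator N = ⊤) (hN : ProperNilOrMinimal N) :
    ∃ T : Sylow 2 N, normalizer ((T : Subgroup N) : Set N) ≠ ⊤ ∧
      ¬ Group.IsNilpotent (normalizer ((T : Subgroup N) : Set N)) := by
  obtain ⟨Z, hZ, hS⟩ := exists_setting N hperf hN
  have := Fact.mk Nat.prime_two
  have := hS.simple
  obtain ⟨P⟩ := (inferInstance : Nonempty (Sylow 2 (N ⧸ Z)))
  obtain ⟨hP, hcard⟩ := hS.localData_two P
  have hsurj := QuotientGroup.mk'_surjective Z
  have h2 : IsPGroup 2 ((P : Subgroup (N ⧸ Z)).comap (QuotientGroup.mk' Z)) :=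
    P.2.comap_of_ker_isPGroup _ (hS.isPGroup_ker hsurj hN)
  have hi : ((P : Subgroup (N ⧸ Z)).comap (QuotientGroup.mk' Z)).index = 15 := by
    rw [index_comap_of_surjective _ hsurj]
    have h1 := (P : Subgroup (N ⧸ Z)).card_mul_index
    rw [hcard, hS.card_eq_sixty] at h1
    omega
  have hnorm : normalizer ((P : Subgroup (N ⧸ Z)) : Set (N ⧸ Z)) ≠ ⊤ :=
    hS.normalizer_ne_top hP.ne_bot (hS.ne_top_of_isNilpotent hP.isPGroup.isNilpotent)
  let T : Sylow 2 N := h2.toSylow (by rw [hi]; norm_num)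
  have hT : normalizer ((T : Subgroup N) : Set N) =
      (normalizer ((P : Subgroup (N ⧸ Z)) : Set (N ⧸ Z))).comap (QuotientGroup.mk' Z) :=
    (comap_normalizer_eq_of_surjective _ hsurj).symm
  refine ⟨T, ?_, ?_⟩
  · rw [hT]
    intro h
    refine hnorm ?_
    rw [← map_comap_eq_self_of_surjective hsurj (normalizer _), h, map_top_of_surjective _ hsurj]
  · rw [hT]
    intro h
    refine hS.not_isNilpotent_normalizer P hP.ne_bot ?_
    rw [← map_comap_eq_self_of_surjective hsurj (normalizer _)]
    exact isNilpotent_map _ h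

end ParaNil

namespace ParaNil

open Subgroup commutatorElement

variable {G : Type*} [Group G]

theorem isSolvable_of_forall_normal (h : ∀ H : Subgroup G, H.Normal) : Group.IsSolvable G := by
  have hconj : ∀ g x : G, ∃ k : ℤ, MulAut.conj g x = x ^ k := fun g x => by
    obtain ⟨k, hk⟩ := mem_zpowers_iff.1 ((h (zpowers x)).conj_mem x (mem_zpowers x) g)
    exact ⟨k, hk.symm⟩
  have hcomm : ∀ g k x : G, MulAut.conj g (MulAut.conj k x) = MulAut.conj k (MulAut.conj g x) := by
    intro g k x
    obtain ⟨a, ha⟩ := hconj g x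
    obtain ⟨b, hb⟩ := hconj k x
    rw [ha, hb, map_zpow, map_zpow, ha, hb, ← zpow_mul, ← zpow_mul, mul_comm]
  have hle : _root_.commutator G ≤ center G := by
    rw [_root_.commutator, commutator_le]
    intro g _ k _
    rw [mem_center_iff]
    intro x
    have h1 := hcomm g k (g⁻¹ * k⁻¹ * x * k * g)
    simp only [MulAut.conj_apply] at h1
    rw [commutatorElement_def, eq_comm, ← mul_inv_eq_iff_eq_mul]
    refine Eq.trans ?_ (h1.trans ?_) <;> group
  have : Group.IsNilpotent G :=
    Subgroup.isNilpotent_of_ker_le_center (Abelianization.of (G := G)) (by rwa [Abelianization.ker_of])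
  infer_instance

section Fitting

variable {A B : Subgroup G}

theorem mem_upperCentralSeries_of_forall [A.Normal] [B.Normal] (hAB : A ⊔ B = ⊤) {m n : ℕ}
    (hmn : m ≤ n) {z : G} (hA : ∀ a ∈ A, ⁅z, a⁆ ∈ Subgroup.upperCentralSeries G m)
    (hB : ∀ b ∈ B, ⁅z, b⁆ ∈ Subgroup.upperCentralSeries G n) : z ∈ Subgroup.upperCentralSeries G (n + 1) := by
  rw [Subgroup.mem_upperCentralSeries_succ_iff]
  intro g
  obtain ⟨a, ha, b, hb, rfl⟩ := mem_sup_of_normal_right.1 (hAB ▸ mem_top g)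
  rw [show ⁅z, a * b⁆ = ⁅z, a⁆ * (a * ⁅z, b⁆ * a⁻¹) by simp only [commutatorElement_def]; group]
  exact mul_mem (Subgroup.upperCentralSeries_mono G hmn (hA a ha))
    (Normal.conj_mem inferInstance _ (hB b hb) a)

theorem exists_map_upperCentralSeries_le [hA : A.Normal] [hB : B.Normal] (hAB : A ⊔ B = ⊤)
    (hnB : Group.IsNilpotent B) (i : ℕ) :
    ∃ m, (Subgroup.upperCentralSeries A i).map A.subtype ≤ Subgroup.upperCentralSeries G m := by
  obtain ⟨c, hc⟩ := hnB.nilpotent'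
  induction i with
  | zero => exact ⟨0, by rw [Subgroup.upperCentralSeries_zero, Subgroup.map_bot]; exact bot_le⟩
  | succ i ih =>
    obtain ⟨m, hm⟩ := ih
    have hstep : ∀ z ∈ (Subgroup.upperCentralSeries A (i + 1)).map A.subtype, ∀ a ∈ A,
        ⁅z, a⁆ ∈ Subgroup.upperCentralSeries G m := by
      rintro _ ⟨z, hz, rfl⟩ a ha
      exact hm ⟨_, Subgroup.mem_upperCentralSeries_succ_iff.1 hz ⟨a, ha⟩, rfl⟩
    have hcomm : ∀ z ∈ (Subgroup.upperCentralSeries A (i + 1)).map A.subtype, ∀ g,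
        ⁅z, g⁆ ∈ (Subgroup.upperCentralSeries A (i + 1)).map A.subtype := by
      intro z hz g
      rw [commutatorElement_def, mul_assoc, mul_assoc]
      refine mul_mem hz ?_
      rw [← mul_assoc]
      exact Normal.conj_mem inferInstance _ (inv_mem hz) g
    have hmem : ∀ j, ∀ z ∈ (Subgroup.upperCentralSeries A (i + 1)).map A.subtype,
        z ∈ (Subgroup.upperCentralSeries B j).map B.subtype → z ∈ Subgroup.upperCentralSeries G (m + j) := by
      intro j
      induction j with
      | zero =>
        rintro z - hz
        rw [Subgroup.upperCentralSeries_zero, Subgroup.map_bot, mem_bot] at hz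
        exact hz ▸ one_mem _
      | succ j ihj =>
        intro z hz hzB
        refine mem_upperCentralSeries_of_forall hAB (Nat.le_add_right m j) (hstep z hz)
          fun b hb => ihj _ (hcomm z hz b) ?_
        obtain ⟨w, hw, rfl⟩ := hzB
        exact ⟨_, Subgroup.mem_upperCentralSeries_succ_iff.1 hw ⟨b, hb⟩, rfl⟩
    refine ⟨m + c + 1, fun z hz => mem_upperCentralSeries_of_forall hAB (Nat.le_add_right m c)
      (hstep z hz) fun b hb => hmem c _ (hcomm z hz b) ?_⟩
    rw [hc, ← MonoidHom.range_eq_map, range_subtype, commutatorElement_def]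
    exact mul_mem (hB.conj_mem _ hb z) (inv_mem hb)

/-- **Fitting's theorem**: the product of two normal nilpotent subgroups is nilpotent. -/
theorem isNilpotent_of_sup_eq_top [A.Normal] [B.Normal] (hAB : A ⊔ B = ⊤)
    (hnA : Group.IsNilpotent A) (hnB : Group.IsNilpotent B) : Group.IsNilpotent G := by
  obtain ⟨i, hi⟩ := hnA.nilpotent'
  obtain ⟨j, hj⟩ := hnB.nilpotent'
  obtain ⟨m, hm⟩ := exists_map_upperCentralSeries_le hAB hnB i
  obtain ⟨n, hn⟩ := exists_map_upperCentralSeries_le (sup_comm A B ▸ hAB) hnA j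
  rw [hi, ← MonoidHom.range_eq_map, range_subtype] at hm
  rw [hj, ← MonoidHom.range_eq_map, range_subtype] at hn
  refine ⟨max m n, top_le_iff.1 (hAB ▸ sup_le ?_ ?_)⟩
  · exact hm.trans (Subgroup.upperCentralSeries_mono G (le_max_left m n))
  · exact hn.trans (Subgroup.upperCentralSeries_mono G (le_max_right m n))

end Fitting

theorem commutatorElement_mul_center {z w : G} (hz : z ∈ center G) (hw : w ∈ center G) (a b : G) :
    ⁅a * z, b * w⁆ = ⁅a, b⁆ := by
  have h1 : ∀ c g u : G, u ∈ center G → ⁅c * u, g⁆ = ⁅c, g⁆ := fun c g u hu => by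
    rw [commutatorElement_def, mul_inv_rev, mul_assoc c, ← mem_center_iff.1 hu g,
      commutatorElement_def]
    group
  rw [h1 a _ z hz, ← commutatorElement_inv, h1 b _ w hw, commutatorElement_inv]

theorem finite_commutatorSet (h : (center G).FiniteIndex) : Finite (commutatorSet G) := by
  let f : (G ⧸ center G) × (G ⧸ center G) → G := fun p => ⁅p.1.out, p.2.out⁆
  refine Set.Finite.subset (Set.finite_range f) ?_
  rintro _ ⟨a, b, rfl⟩
  refine ⟨(QuotientGroup.mk a, QuotientGroup.mk b), ?_⟩
  obtain ⟨⟨z, hz⟩, h1⟩ := QuotientGroup.mk_out_eq_mul (center G) a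
  obtain ⟨⟨w, hw⟩, h2⟩ := QuotientGroup.mk_out_eq_mul (center G) b
  change ⁅Quotient.out (QuotientGroup.mk a), Quotient.out (QuotientGroup.mk b)⁆ = _
  rw [h1, h2, commutatorElement_mul_center hz hw]

theorem finiteIndex_map {G' : Type*} [Group G'] {f : G →* G'} (hf : Function.Surjective f)
    {H : Subgroup G} (hH : H.FiniteIndex) : (H.map f).FiniteIndex :=
  ⟨ne_zero_of_dvd_ne_zero hH.index_ne_zero (index_map_dvd H hf)⟩

theorem map_commutator_eq {G' : Type*} [Group G'] {f : G →* G'} (hf : Function.Surjective f) :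
    (_root_.commutator G).map f = _root_.commutator G' := by
  rw [_root_.commutator, _root_.commutator, map_commutator, map_top_of_surjective _ hf]

theorem finite_of_finiteIndex_commutator [Group.IsNilpotent G]
    (h : (_root_.commutator G).FiniteIndex) : Finite G := by
  revert h
  refine Group.nilpotent_center_quotient_ind
    (P := fun G _ _ => (_root_.commutator G).FiniteIndex → Finite G) G ?_ ?_
  · intro G _ _ _
    infer_instance
  · intro G _ _ ih h
    have hsurj := QuotientGroup.mk'_surjective (center G)
    have h1 : (_root_.commutator (G ⧸ center G)).FiniteIndex :=
      map_commutator_eq hsurj ▸ finiteIndex_map hsurj h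
    have := ih h1
    have : (center G).FiniteIndex := finiteIndex_of_finite_quotient
    have := finite_commutatorSet this
    exact Nat.finite_of_card_ne_zero (by
      rw [← (_root_.commutator G).card_mul_index]
      exact mul_ne_zero Nat.card_pos.ne' h.index_ne_zero)

end ParaNil

namespace ParaNil

open Subgroup commutatorElement

theorem exists_surjective_int (A : Type*) [CommGroup A] [Group.FG A] [Infinite A] :
    ∃ f : A →* Multiplicative ℤ, Function.Surjective f := by
  obtain ⟨ι, j, _, _, p, hp, e, ⟨iso⟩⟩ := CommGroup.equiv_free_prod_prod_multiplicative_zmod A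
  rcases isEmpty_or_nonempty j with hj | ⟨⟨i⟩⟩
  · exfalso
    have : ∀ i, NeZero (p i ^ e i) := fun i => ⟨pow_ne_zero _ (hp i).ne_zero⟩
    have : ∀ i, Finite (Multiplicative (ZMod (p i ^ e i))) := fun i =>
      inferInstanceAs (Finite (ZMod (p i ^ e i)))
    have : Finite A := Finite.of_equiv _ iso.symm.toEquiv
    exact not_finite A
  · exact ⟨((Pi.evalMonoidHom (fun _ : j => Multiplicative ℤ) i).comp (MonoidHom.fst _ _)).comp
      iso.toMonoidHom,
      ((Function.surjective_eval i).comp Prod.fst_surjective).comp iso.surjective⟩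

variable {X : Type*} [Group X]

/-- A minimal non-nilpotent group does not map onto the infinite cyclic group. -/
theorem _root_.MinimalNonNilpotent.not_surjective_int (hX : MinimalNonNilpotent X)
    (f : X →* Multiplicative ℤ) : ¬ Function.Surjective f := by
  intro hf
  obtain ⟨t, ht⟩ := hf (Multiplicative.ofAdd 1)
  let K : ℤ → Subgroup X := fun n => (zpowers (Multiplicative.ofAdd n)).comap f
  have hK : ∀ n x, x ∈ K n ↔ ∃ k : ℤ, k * n = (f x).toAdd := fun n x => by
    rw [mem_comap, mem_zpowers_iff]
    exact exists_congr fun k => by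
      rw [← ofAdd_zsmul, smul_eq_mul]
      rfl
  have hnil : ∀ n : ℤ, 1 < n → Group.IsNilpotent (K n) := fun n hn => hX.2 _ fun h => by
    obtain ⟨k, hk⟩ := (hK n t).1 (h ▸ mem_top t)
    rw [ht, toAdd_ofAdd] at hk
    exact absurd (Int.isUnit_iff.1 (IsUnit.of_mul_eq_one _ ((mul_comm n k).trans hk))) (by omega)
  have : ∀ n, (K n).Normal := fun n => inferInstance
  refine hX.1 (isNilpotent_of_sup_eq_top (A := K 2) (B := K 3) ?_ (hnil 2 (by norm_num))
    (hnil 3 (by norm_num)))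
  have hft : ∀ n : ℤ, (f (t ^ n)).toAdd = n := fun n => by
    rw [map_zpow, ht, ← ofAdd_zsmul, toAdd_ofAdd, smul_eq_mul, mul_one]
  refine eq_top_iff.2 fun x _ => mem_sup_of_normal_right.2 ⟨x * t ^ (3 * (f x).toAdd), (hK _ _).2
    ⟨2 * (f x).toAdd, ?_⟩, t ^ (-(3 * (f x).toAdd)), (hK _ _).2 ⟨-(f x).toAdd, ?_⟩, ?_⟩
  · rw [map_mul, toAdd_mul, hft]
    ring
  · rw [hft]
    ring
  · rw [zpow_neg, mul_inv_cancel_right]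

theorem _root_.MinimalNonNilpotent.finiteIndex_commutator [Group.FG X]
    (hX : MinimalNonNilpotent X) : (_root_.commutator X).FiniteIndex := by
  by_contra h
  have : Infinite (Abelianization X) := not_finite_iff_infinite.1 fun h1 =>
    h (finiteIndex_iff_finite_quotient.2 h1)
  have hsurj : Function.Surjective (Abelianization.of (G := X)) := QuotientGroup.mk'_surjective _
  have : Group.FG (Abelianization X) := Group.fg_of_surjective hsurj
  obtain ⟨f, hf⟩ := exists_surjective_int (Abelianization X)
  exact hX.not_surjective_int (f.comp Abelianization.of) (hf.comp hsurj)

end ParaNil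

namespace ParaNil

open Subgroup commutatorElement
open scoped IsMulCommutative

variable {X : Type*} [Group X] {A : Subgroup X} {x : X}

/-- The endomorphism `a ↦ ⁅x, a⁆` of an abelian normal subgroup. -/
def commutatorHom (A : Subgroup X) [A.Normal] [IsMulCommutative A] (x : X) : A →* A :=
  (MulAut.conjNormal x : A ≃* A).toMonoidHom * (MonoidHom.id A)⁻¹

theorem coe_commutatorHom [A.Normal] [IsMulCommutative A] (a : A) :
    (commutatorHom A x a : X) = ⁅x, (a : X)⁆ := rfl

theorem commutator_le_map_range [A.Normal] [IsMulCommutative A]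
    (hgen : ∀ H : Subgroup X, A ≤ H → x ∈ H → H = ⊤) :
    _root_.commutator X ≤ (commutatorHom A x).range.map A.subtype := by
  have hcommA : ∀ a ∈ A, ∀ b ∈ A, a * b = b * a := fun a ha b hb =>
    congrArg Subtype.val (mul_comm (⟨a, ha⟩ : A) ⟨b, hb⟩)
  set D := (commutatorHom A x).range.map A.subtype with hD
  have hDA : D ≤ A := map_subtype_le _
  have hxD : ∀ a ∈ A, ⁅x, a⁆ ∈ D := fun a ha => ⟨_, ⟨⟨a, ha⟩, rfl⟩, rfl⟩
  have hDn : D.Normal := by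
    rw [← normalizer_eq_top_iff]
    refine hgen _ (fun a ha => ?_) ?_
    · refine mem_normalizer_iff.2 fun h => ?_
      have hconj : ∀ y ∈ A, a * y * a⁻¹ = y := fun y hy => by
        rw [hcommA a ha y hy, mul_inv_cancel_right]
      refine ⟨fun h1 => (hconj h (hDA h1)).symm ▸ h1, fun h1 => ?_⟩
      have h2 : h ∈ A := by
        simpa [mul_assoc] using mul_mem (mul_mem (inv_mem ha) (hDA h1)) ha
      rwa [hconj h h2] at h1
    · refine mem_normalizer_iff.2 fun h => ⟨?_, ?_⟩
      · rintro ⟨_, ⟨⟨a, ha⟩, rfl⟩, rfl⟩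
        convert hxD (x * a * x⁻¹) (Normal.conj_mem inferInstance a ha x) using 1
        rw [subtype_apply, coe_commutatorHom, commutatorElement_def, commutatorElement_def]
        group
      · rintro ⟨_, ⟨⟨a, ha⟩, rfl⟩, h1⟩
        have h2 := Normal.conj_mem inferInstance a ha x⁻¹
        rw [inv_inv] at h2
        convert hxD (x⁻¹ * a * x) h2 using 1
        rw [subtype_apply, coe_commutatorHom, commutatorElement_def] at h1
        rw [← mul_right_inj x, ← mul_left_inj x⁻¹, ← h1, commutatorElement_def]
        group
  let π := QuotientGroup.mk' D
  have hπ : ∀ a ∈ A, π x * π a = π a * π x := fun a ha => by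
    rw [← commutatorElement_eq_one_iff_mul_comm, ← map_commutatorElement]
    exact (QuotientGroup.eq_one_iff _).2 (hxD a ha)
  have hx : (centralizer {π x}).comap π = ⊤ := hgen _ (fun a ha => by
    rw [mem_comap, mem_centralizer_singleton_iff]; exact (hπ a ha).symm) (by
    rw [mem_comap, mem_centralizer_singleton_iff])
  have hA : ∀ a ∈ A, (centralizer {π a}).comap π = ⊤ := fun a ha => hgen _ (fun b hb => by
    rw [mem_comap, mem_centralizer_singleton_iff, ← map_mul, ← map_mul, hcommA a ha b hb]) (by
    rw [mem_comap, mem_centralizer_singleton_iff]; exact hπ a ha)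
  have hcen : (center (X ⧸ D)).comap π = ⊤ := by
    have hcen : ∀ z, (centralizer {π z}).comap π = ⊤ → z ∈ (center (X ⧸ D)).comap π := by
      refine fun z hz => mem_center_iff.2 fun q => ?_
      obtain ⟨g, rfl⟩ := QuotientGroup.mk'_surjective D q
      exact mem_centralizer_singleton_iff.1 (mem_comap.1 (hz ▸ mem_top g))
    exact hgen _ (fun a ha => hcen a (hA a ha)) (hcen x hx)
  rw [_root_.commutator, commutator_le]
  intro g _ k _
  rw [← QuotientGroup.eq_one_iff]
  have := mem_center_iff.1 (mem_comap.1 (hcen ▸ mem_top k)) (π g)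
  exact (map_commutatorElement π g k).trans (commutatorElement_eq_one_iff_mul_comm.2 this)

theorem not_finiteIndex_commutator [A.Normal] [IsMulCommutative A]
    (hgen : ∀ H : Subgroup X, A ≤ H → x ∈ H → H = ⊤) (hfg : Group.FG A) (hinf : Infinite A)
    (hnil : ∀ H : Subgroup X, H ≠ ⊤ → Group.IsNilpotent H) :
    ¬ (_root_.commutator X).FiniteIndex := by
  intro h
  obtain ⟨f, hf⟩ := exists_surjective_int A
  obtain ⟨t, ht⟩ := hf (Multiplicative.ofAdd 1)
  have hpow : ∀ (a : A) (n : ℕ), (f (a ^ n)).toAdd = n * (f a).toAdd := fun a n => by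
    rw [map_pow, toAdd_pow, nsmul_eq_mul]
  have ht1 : (f t).toAdd = 1 := by rw [ht, toAdd_ofAdd]
  set δ := commutatorHom A x with hδ
  set m := (_root_.commutator X).index with hm
  have hm0 : m ≠ 0 := h.index_ne_zero
  have hδm : ∀ a : A, ∃ b, δ b = a ^ m := fun a => by
    obtain ⟨_, ⟨b, rfl⟩, h2⟩ := commutator_le_map_range hgen
      (pow_index_mem (_root_.commutator X) (a : X))
    exact ⟨b, Subtype.ext h2⟩
  by_cases hcase : ∃ n ≠ 0, zpowers x ⊔ (powMonoidHom (α := A) n).range.map A.subtype ≠ ⊤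
  · obtain ⟨n, hn, hH⟩ := hcase
    obtain ⟨c, hc⟩ := (Subgroup.isNilpotent_iff_lowerCentralSeries _).1 (hnil _ hH)
    set H := zpowers x ⊔ (powMonoidHom (α := A) n).range.map A.subtype
    have hxH : x ∈ H := le_sup_left (a := zpowers x) (mem_zpowers x)
    have hlow : ∀ k (a : A), (δ^[k] (a ^ n) : X) ∈ H.lowerCentralSeries k := by
      intro k a
      induction k with
      | zero => exact (le_sup_right : _ ≤ H) ⟨_, ⟨a, rfl⟩, rfl⟩
      | succ k ih =>
        rw [Function.iterate_succ_apply', coe_commutatorHom, ← commutatorElement_inv]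
        exact inv_mem (commutator_mem_commutator ih hxH)
    have hiter : ∀ k (a : A), ∃ b, δ^[k] b = a ^ m ^ k := by
      intro k
      induction k with
      | zero => exact fun a => ⟨a, by rw [pow_zero, pow_one]; rfl⟩
      | succ k ih =>
        intro a
        obtain ⟨b, hb⟩ := ih a
        obtain ⟨d, hd⟩ := hδm b
        refine ⟨d, ?_⟩
        rw [Function.iterate_succ_apply, hd, iterate_map_pow, hb, ← pow_mul, pow_succ]
    obtain ⟨b, hb⟩ := hiter c t
    have h1 := hlow c b
    rw [hc, mem_bot, OneMemClass.coe_eq_one, iterate_map_pow, hb, ← pow_mul] at h1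
    have h2 := hpow t (m ^ c * n)
    rw [h1, ht1, map_one, toAdd_one, mul_one] at h2
    exact mul_ne_zero (pow_ne_zero c hm0) hn (by exact_mod_cast h2.symm)
  · push Not at hcase
    obtain ⟨b, hb⟩ := hδm t
    have hn : ((powMonoidHom (α := A) (2 * m)).range.map A.subtype).Normal := by
      refine ⟨?_⟩
      rintro _ ⟨_, ⟨d, rfl⟩, rfl⟩ g
      refine ⟨_, ⟨MulAut.conjNormal g d, rfl⟩, ?_⟩
      change ((MulAut.conjNormal g d ^ (2 * m) : A) : X) = g * ((d ^ (2 * m) : A) : X) * g⁻¹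
      rw [← map_pow, MulAut.conjNormal_apply]
    obtain ⟨y, hy, _, ⟨_, ⟨d, rfl⟩, rfl⟩, hbd⟩ := mem_sup_of_normal_right.1
      (hcase (2 * m) (mul_ne_zero two_ne_zero hm0) ▸ mem_top (b : X))
    obtain ⟨k, rfl⟩ := mem_zpowers_iff.1 hy
    have h1 : δ b = (MulAut.conjNormal (x ^ k) (δ d)) ^ (2 * m) := by
      refine Subtype.ext ?_
      have h2 : δ (d ^ (2 * m)) = δ d ^ (2 * m) := map_pow _ _ _
      rw [coe_commutatorHom, ← hbd, ← map_pow, ← h2, MulAut.conjNormal_apply, coe_commutatorHom]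
      change ⁅x, x ^ k * ((d ^ (2 * m) : A) : X)⁆ = _
      simp only [commutatorElement_def]
      group
    rw [hb] at h1
    have h2 := congrArg (fun a => (f a).toAdd) h1
    simp only [hpow, ht1] at h2
    push_cast at h2
    have h3 : (m : ℤ) ≠ 0 := by exact_mod_cast hm0
    rw [mul_one, mul_comm (2 : ℤ), mul_assoc] at h2
    have h4 := mul_left_cancel₀ h3 ((mul_one _).trans h2)
    omega

end ParaNil

namespace ParaNil

open Subgroup commutatorElement
open scoped IsMulCommutative

variable {X : Type*} [Group X]

theorem eq_top_of_index_prime {M : Subgroup X} (hM : M.index.Prime) {x : X} (hx : x ∉ M)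
    {H : Subgroup X} (hMH : M ≤ H) (hxH : x ∈ H) : H = ⊤ := by
  have : M.FiniteIndex := ⟨hM.ne_zero⟩
  rcases (Nat.dvd_prime hM).1 (index_dvd_of_le hMH) with h | h
  · exact index_eq_one.1 h
  · exact absurd (h ▸ index_strictAnti (lt_of_le_of_ne hMH fun h1 => hx (h1 ▸ hxH)))
      (lt_irrefl _)

theorem exists_normal_prime_index_of_finiteIndex (hX : ∀ H : Subgroup X, H ≠ ⊤ → Group.IsNilpotent H)
    {K : Subgroup X} (hK : K ≠ ⊤) (hKi : K.FiniteIndex) :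
    ∃ M : Subgroup X, M.Normal ∧ M.index.Prime := by
  set C := K.normalCore
  have hC : C ≠ ⊤ := fun h => hK (top_le_iff.1 (h ▸ K.normalCore_le))
  have hsurj := QuotientGroup.mk'_surjective C
  have : Finite (X ⧸ C) := finiteIndex_iff_finite_quotient.1 inferInstance
  have : Nontrivial (X ⧸ C) := QuotientGroup.nontrivial_iff.2 hC
  have : Group.IsSolvable (X ⧸ C) := by
    refine isSolvable_of_forall_isNilpotent _ (X ⧸ C) rfl fun H hH => ?_
    have h1 : H.comap (QuotientGroup.mk' C) ≠ ⊤ := fun h => hH (by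
      rw [← map_comap_eq_self_of_surjective hsurj H, h, map_top_of_surjective _ hsurj])
    have h2 := isNilpotent_map (QuotientGroup.mk' C) (hX _ h1)
    rwa [map_comap_eq_self_of_surjective hsurj] at h2
  obtain ⟨M, hM, hMi⟩ := exists_normal_prime_index (X ⧸ C)
  exact ⟨M.comap (QuotientGroup.mk' C), inferInstance, by
    rwa [index_comap_of_surjective _ hsurj]⟩

theorem _root_.MinimalNonNilpotent.finite [Group.FG X] (hX : MinimalNonNilpotent X)
    {K : Subgroup X} (hK : K ≠ ⊤) (hKi : K.FiniteIndex) : Finite X := by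
  obtain ⟨M, hM, hMi⟩ := exists_normal_prime_index_of_finiteIndex hX.2 hK hKi
  have hMtop : M ≠ ⊤ := fun h => hMi.one_lt.ne' (index_eq_one.2 h)
  have hMfin : M.FiniteIndex := ⟨hMi.ne_zero⟩
  have hMnil : Group.IsNilpotent M := hX.2 M hMtop
  obtain ⟨x, hx⟩ : ∃ x, x ∉ M := by
    by_contra! h
    exact hMtop (eq_top_iff.2 fun y _ => h y)
  by_contra hfin
  have hMinf : ¬ Finite M := fun h => hfin ((finite_iff_finite_and_finiteIndex M).2 ⟨h, hMfin⟩)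
  have hcomm : ¬ (_root_.commutator M).FiniteIndex := fun h =>
    hMinf (finite_of_finiteIndex_commutator h)
  have hCeq : (_root_.commutator M).map M.subtype = ⁅M, M⁆ := map_subtype_commutator M
  have hCn : (⁅M, M⁆).Normal := inferInstance
  set π := QuotientGroup.mk' ⁅M, M⁆
  have hsurj : Function.Surjective π := QuotientGroup.mk'_surjective _
  have hAn : (M.map π).Normal := hM.map π hsurj
  have hAc : IsMulCommutative (M.map π) := by
    refine ⟨⟨?_⟩⟩
    rintro ⟨_, a, ha, rfl⟩ ⟨_, b, hb, rfl⟩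
    refine Subtype.ext ?_
    change π a * π b = π b * π a
    rw [← commutatorElement_eq_one_iff_mul_comm, ← map_commutatorElement]
    exact (QuotientGroup.eq_one_iff _).2 (commutator_mem_commutator ha hb)
  have hAfg : Group.FG (M.map π) :=
    Group.fg_of_surjective (π.subgroupMap_surjective M)
  have hAinf : Infinite (M.map π) := not_finite_iff_infinite.1 fun h => hcomm (by
    have h1 : (π.subgroupMap M).ker.FiniteIndex := finiteIndex_ker _
    refine finiteIndex_of_le (H := (π.subgroupMap M).ker) fun a ha => ?_
    have h2 : π a = 1 := congrArg Subtype.val (MonoidHom.mem_ker.1 ha)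
    have h3 := (QuotientGroup.eq_one_iff _).1 h2
    rw [← hCeq] at h3
    obtain ⟨b, hb, hba⟩ := h3
    exact Subtype.ext hba ▸ hb)
  refine not_finiteIndex_commutator (A := M.map π) (x := π x) (fun H h1 h2 => ?_) hAfg hAinf
    (fun H hH => ?_) ?_
  · rw [← map_comap_eq_self_of_surjective hsurj H,
      eq_top_of_index_prime hMi hx (map_le_iff_le_comap.1 h1) (mem_comap.2 h2),
      map_top_of_surjective _ hsurj]
  · have h1 : H.comap π ≠ ⊤ := fun h => hH (by
      rw [← map_comap_eq_self_of_surjective hsurj H, h, map_top_of_surjective _ hsurj])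
    have h2 := isNilpotent_map π (hX.2 _ h1)
    rwa [map_comap_eq_self_of_surjective hsurj] at h2
  · exact map_commutator_eq hsurj ▸ finiteIndex_map hsurj hX.finiteIndex_commutator

end ParaNil

namespace ParaNil

open Subgroup

variable {G : Type*} [Group G]

theorem finite_of_maximal [Group.FG G] (hG : LocallyGraded G) {X : Subgroup G} (hX : Finite X)
    (hmax : ∀ H, X < H → H = ⊤) : Finite G := by
  by_contra hfin
  have claim : ∀ n : ℕ, ∃ K : Subgroup G, K.Normal ∧ K.FiniteIndex ∧ n ≤ K.index := by
    intro n
    induction n with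
    | zero => exact ⟨⊤, inferInstance, inferInstance, Nat.zero_le _⟩
    | succ n ih =>
      obtain ⟨K, hK, hKi, hn⟩ := ih
      have hK1 : K ≠ ⊥ := fun h => hfin
        ((finite_iff_finite_and_finiteIndex K).2 ⟨h ▸ inferInstance, hKi⟩)
      obtain ⟨L, hL, hLi⟩ := hG K hK1 inferInstance
      have h1 : (L.map K.subtype).FiniteIndex := ⟨by
        rw [index_map_subtype]
        exact mul_ne_zero hLi.index_ne_zero hKi.index_ne_zero⟩
      refine ⟨(L.map K.subtype).normalCore, inferInstance, inferInstance, hn.trans_lt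
        (index_strictAnti (lt_of_le_of_ne ((normalCore_le _).trans (map_subtype_le L)) fun h => ?_))⟩
      refine hL (top_le_iff.1 fun k _ => ?_)
      obtain ⟨l, hl, hlk⟩ := (normalCore_le _) (h.symm ▸ k.2 : (k : G) ∈ (L.map K.subtype).normalCore)
      exact Subtype.ext hlk ▸ hl
  obtain ⟨K, hK, hKi, hn⟩ := claim (Nat.card X + 1)
  have hKX : ¬ K ≤ X := fun h => hfin ((finite_iff_finite_and_finiteIndex K).2
    ⟨Finite.of_injective _ (inclusion_injective h), hKi⟩)
  have htop := hmax (K ⊔ X) (lt_of_le_of_ne le_sup_right fun h => hKX (h ▸ le_sup_left))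
  have h1 := relIndex_sup_left X K
  rw [htop, relIndex_top_right] at h1
  have h2 := Nat.le_of_dvd Nat.card_pos (relIndex_dvd_card K X)
  omega

section

variable {Y : Subgroup G}

theorem normal_of_minimalNonNilpotent_lt (hpara : ∀ H : Subgroup G, ¬ H.Normal → NilOrMinimal H)
    (hY : MinimalNonNilpotent Y) {H : Subgroup G} (h : Y < H) : H.Normal := by
  by_contra hn
  exact h.ne ((hpara H hn).eq_of_le hY h.le)

theorem isSolvable_quotient (hpara : ∀ H : Subgroup G, ¬ H.Normal → NilOrMinimal H)
    (hY : MinimalNonNilpotent Y) {W : Subgroup G} [hW : W.Normal] (h : Y ≤ W) :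
    Group.IsSolvable (G ⧸ W) := by
  refine isSolvable_of_forall_normal fun H => ?_
  have hsurj := QuotientGroup.mk'_surjective W
  have hWK : W ≤ H.comap (QuotientGroup.mk' W) := QuotientGroup.le_comap_mk' W H
  have hK : (H.comap (QuotientGroup.mk' W)).Normal := by
    rcases (h.trans hWK).lt_or_eq with h1 | h1
    · exact normal_of_minimalNonNilpotent_lt hpara hY h1
    · rwa [← le_antisymm hWK (h1 ▸ h)]
  exact map_comap_eq_self_of_surjective hsurj H ▸ hK.map _ hsurj

theorem normalizer_eq_of_minimalNonNilpotent [Finite Y]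
    (hpara : ∀ H : Subgroup G, ¬ H.Normal → NilOrMinimal H)
    (hY : MinimalNonNilpotent Y) (hG : ¬ Group.IsSolvable G) :
    normalizer (Y : Set G) = Y := by
  by_contra hne
  have hlt : Y < normalizer (Y : Set G) := lt_of_le_of_ne le_normalizer (Ne.symm hne)
  set N := normalizer (Y : Set G)
  have hN : N.Normal := normal_of_minimalNonNilpotent_lt hpara hY hlt
  have hYN : (Y.subgroupOf N).Normal := normal_in_normalizer
  refine hG ((Group.isSolvable_iff_subgroup_quotient N).2
    ⟨(Group.isSolvable_iff_subgroup_quotient (Y.subgroupOf N)).2 ⟨?_, ?_⟩,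
      isSolvable_quotient hpara hY hlt.le⟩)
  · have h1 : Group.IsSolvable Y := isSolvable_of_forall_isNilpotent _ Y rfl hY.2
    exact Group.isSolvable_of_isSolvable_injective (f := (subgroupOfEquivOfLe hlt.le).toMonoidHom)
      (subgroupOfEquivOfLe hlt.le).injective
  · refine isSolvable_of_forall_normal fun H => ?_
    have hsurj := QuotientGroup.mk'_surjective (Y.subgroupOf N)
    set K := H.comap (QuotientGroup.mk' (Y.subgroupOf N))
    have hWK : Y.subgroupOf N ≤ K := QuotientGroup.le_comap_mk' _ H
    have hWK' : Y ≤ K.map N.subtype := by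
      rw [← map_subgroupOf_eq_of_le hlt.le]
      exact map_mono hWK
    have hK : K.Normal := by
      rw [← comap_map_eq_self_of_injective N.subtype_injective K]
      rcases hWK'.lt_or_eq with h1 | h1
      · exact (normal_of_minimalNonNilpotent_lt hpara hY h1).comap _
      · rwa [← h1]
    exact map_comap_eq_self_of_surjective hsurj H ▸ hK.map _ hsurj

theorem finite_of_finite_minimalNonNilpotent [Finite Y]
    (hpara : ∀ H : Subgroup G, ¬ H.Normal → NilOrMinimal H)
    (hY : MinimalNonNilpotent Y) (hG : ¬ Group.IsSolvable G)
    (hgr : LocallyGraded (normalClosure (Y : Set G))) : Finite G := by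
  have hnorm := normalizer_eq_of_minimalNonNilpotent hpara hY hG
  set N := normalClosure (Y : Set G)
  have hYN : Y ≤ N := subset_normalClosure
  have hNmin : ∀ H : Subgroup G, Y < H → N ≤ H := fun H hH =>
    have := normal_of_minimalNonNilpotent_lt hpara hY hH
    normalClosure_le_normal hH.le
  have hNfin : Finite N := by
    by_cases hn : Y.Normal
    · exact Finite.of_injective _ (inclusion_injective (normalClosure_le_normal (le_refl (Y : Set G))))
    · obtain ⟨g, y, hy, hgy⟩ : ∃ g, ∃ y ∈ Y, g * y * g⁻¹ ∉ Y := by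
        by_contra! h
        exact hn ⟨fun y hy g => h g y hy⟩
      have hfg : Group.FG N := by
        have h1 : N = Y ⊔ Y.map (MulAut.conj g).toMonoidHom := by
          refine le_antisymm (hNmin _ (lt_of_le_of_ne le_sup_left fun h => hgy ?_))
            (sup_le hYN (map_le_iff_le_comap.2 fun z hz =>
              Normal.conj_mem inferInstance z (hYN hz) g))
          rw [h]
          exact (le_sup_right : _ ≤ Y ⊔ _) (mem_map_of_mem (MulAut.conj g).toMonoidHom hy)
        have h2 : Y.FG := (Group.fg_iff_subgroup_fg Y).1 inferInstance
        have h3 : (Y.map (MulAut.conj g).toMonoidHom).FG := (Group.fg_iff_subgroup_fg _).1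
          (Group.fg_of_surjective ((MulAut.conj g).toMonoidHom.subgroupMap_surjective Y))
        rw [h1]
        exact (Group.fg_iff_subgroup_fg _).2 (h2.sup h3)
      refine finite_of_maximal hgr (X := Y.subgroupOf N)
        (Finite.of_equiv _ (subgroupOfEquivOfLe hYN).symm.toEquiv) fun H hH => ?_
      have h1 : Y < H.map N.subtype := by
        rw [← map_subgroupOf_eq_of_le hYN]
        exact map_subtype_lt_map_subtype.2 hH
      exact top_le_iff.1 fun n _ => by
        obtain ⟨h, hh, hhn⟩ := hNmin _ h1 n.2
        exact Subtype.ext hhn ▸ hh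
  have hker : (MulAut.conjNormal : G →* MulAut N).ker ≤ Y := by
    intro g hg
    rw [← hnorm, mem_normalizer_iff]
    have h1 : ∀ y ∈ N, g * y * g⁻¹ = y := fun y hy => by
      have := DFunLike.congr_fun (MonoidHom.mem_ker.1 hg) (⟨y, hy⟩ : N)
      exact (MulAut.conjNormal_apply g ⟨y, hy⟩).symm.trans (congrArg Subtype.val this)
    refine fun y => ⟨fun hy => (h1 y (hYN hy)).symm ▸ hy, fun hy => ?_⟩
    have h2 : y ∈ N := by
      have := Normal.conj_mem inferInstance _ (hYN hy) g⁻¹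
      simpa [mul_assoc] using this
    rwa [h1 y h2] at hy
  have : Finite (MulAut N) := Finite.of_injective _ (DFunLike.coe_injective (F := MulAut N))
  exact (finite_iff_finite_and_finiteIndex (MulAut.conjNormal : G →* MulAut N).ker).2
    ⟨Finite.of_injective _ (inclusion_injective hker), finiteIndex_ker _⟩

end

end ParaNil

namespace ParaNil

open Subgroup

variable {G : Type*} [Group G]

theorem derivedSeries_le_of_isSolvable_quotient {W : Subgroup G} [W.Normal]
    (hW : Group.IsSolvable (G ⧸ W)) : ∃ n, derivedSeries G n ≤ W := by
  obtain ⟨n, hn⟩ := (Group.isSolvable_def _).1 hW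
  refine ⟨n, fun x hx => ?_⟩
  have h := map_derivedSeries_le_derivedSeries (QuotientGroup.mk' W) n (mem_map_of_mem _ hx)
  rw [hn, mem_bot] at h
  exact (QuotientGroup.eq_one_iff x).1 h

/-- A finite group has a least term of its derived series, which is perfect. -/
theorem exists_perfect_residual [Finite G] : ∃ D : Subgroup G, D.Normal ∧
    (∃ n, D = derivedSeries G n) ∧ _root_.commutator D = ⊤ ∧
    ∀ W : Subgroup G, ∀ _ : W.Normal, Group.IsSolvable (G ⧸ W) → D ≤ W := by
  obtain ⟨n, hn⟩ := exists_minimalFor_of_wellFoundedLT (fun _ : ℕ => True) (derivedSeries G)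
    ⟨0, trivial⟩
  have hmin : ∀ m, derivedSeries G n ≤ derivedSeries G m := fun m =>
    (hn.2 trivial (derivedSeries_antitone G (le_max_left n m))).trans
      (derivedSeries_antitone G (le_max_right n m))
  refine ⟨derivedSeries G n, inferInstance, ⟨n, rfl⟩, ?_, fun W _ hW => ?_⟩
  · rw [← map_subtype_inj, map_subtype_commutator, ← MonoidHom.range_eq_map, range_subtype]
    exact le_antisymm (commutator_le_self _) (hmin (n + 1))
  · obtain ⟨m, hm⟩ := derivedSeries_le_of_isSolvable_quotient hW
    exact (hmin m).trans hm

theorem nonempty_mulEquiv_of_finite [Finite G] (hG : ¬ Group.IsSolvable G)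
    (hpara : ∀ H : Subgroup G, ¬ H.Normal → NilOrMinimal H) :
    Nonempty (G ≃* alternatingGroup (Fin 5)) ∨
      Nonempty (G ≃* Matrix.SpecialLinearGroup (Fin 2) (ZMod 5)) := by
  obtain ⟨D, hD, ⟨n, hn⟩, hperf, hres⟩ := exists_perfect_residual (G := G)
  have hDnt : Nontrivial D := (nontrivial_iff_ne_bot D).2 fun h =>
    hG ((Group.isSolvable_def _).2 ⟨n, hn ▸ h⟩)
  have hmap : ∀ H : Subgroup D, H.map D.subtype = D → H = ⊤ := fun H h => by
    rw [← map_subtype_inj, h, ← MonoidHom.range_eq_map, range_subtype]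
  have hDP : ProperNilOrMinimal D := by
    intro H hH
    refine NilOrMinimal.congr (H.equivMapOfInjective D.subtype D.subtype_injective).symm ?_
    by_cases hn : (H.map D.subtype).Normal
    · refine Or.inl (by_contra fun hnil => hH (hmap H (le_antisymm (map_subtype_le H) ?_)))
      obtain ⟨Y, hYH, hY⟩ := exists_minimalNonNilpotent_le hnil
      exact hres _ hn (isSolvable_quotient hpara hY hYH)
    · exact hpara _ hn
  obtain ⟨T, hT, hTnil⟩ := exists_sylow_normalizer hperf hDP
  set H := normalizer ((T : Subgroup D) : Set D)
  have hH : MinimalNonNilpotent H := (hDP H hT).resolve_left hTnil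
  have hH1 : MinimalNonNilpotent (H.map D.subtype) := by
    have h1 : NilOrMinimal (H.map D.subtype) :=
      NilOrMinimal.congr (H.equivMapOfInjective D.subtype D.subtype_injective) (Or.inr hH)
    refine h1.resolve_left fun h2 => hTnil (isNilpotent_of_injective
      (H.equivMapOfInjective D.subtype D.subtype_injective).toMonoidHom
      (H.equivMapOfInjective D.subtype D.subtype_injective).injective h2)
  have hle : normalizer (((T : Subgroup D).map D.subtype : Subgroup G) : Set G) ≤ D := by
    refine le_trans ?_ (map_subtype_le H)
    have h1 : H.map D.subtype =
        normalizer (((T : Subgroup D).map D.subtype : Subgroup G) : Set G) ⊓ D := by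
      rw [← subgroupOf_map_subtype, subgroupOf_normalizer_eq (map_subtype_le _), subgroupOf,
        comap_map_eq_self_of_injective D.subtype_injective]
    rw [← normalizer_eq_of_minimalNonNilpotent hpara hH1 hG, h1]
    exact (le_inf le_normalizer le_normalizer_of_normal).trans inf_normalizer_le_normalizer_inf
  have hDtop : D = ⊤ := by
    have := Fact.mk Nat.prime_two
    rw [← Sylow.normalizer_sup_eq_top T, sup_eq_right.2 hle]
  rw [hDtop] at hperf hDP hDnt
  exact (nonempty_mulEquiv_of_commutator_eq_top hperf hDP).imp
    (fun h => h.map topEquiv.symm.trans) (fun h => h.map topEquiv.symm.trans)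

end ParaNil

/-- An insoluble para-Nil-Hamiltonian group having a finitely generated minimal
non-nilpotent subgroup with locally graded normal closure is isomorphic to $A_5$
or to $\mathrm{SL}(2,5)$. -/
theorem stmt_13 {G : Type*} [Group G] (hinsol : ¬ IsSolvable G)
    (hpara : ParaNilHamiltonian G)
    (hX : ∃ X : Subgroup G, Group.FG X ∧ MinimalNonNilpotent X ∧
      LocallyGraded (Subgroup.normalClosure (X : Set G))) :
    Nonempty (G ≃* ↥(alternatingGroup (Fin 5))) ∨
      Nonempty (G ≃* Matrix.SpecialLinearGroup (Fin 2) (ZMod 5)) := by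
  obtain ⟨X, hfg, hX, hgr⟩ := hX
  have hXN : X ≤ Subgroup.normalClosure (X : Set G) := Subgroup.subset_normalClosure
  let e := Subgroup.subgroupOfEquivOfLe hXN
  have hX1 : X ≠ ⊥ := by
    rintro rfl
    exact hX.1 inferInstance
  obtain ⟨K, hK, hKi⟩ := hgr (X.subgroupOf _)
    (fun h => hX1 ((Subgroup.subgroupOf_eq_bot.1 h).eq_bot_of_le hXN))
    (Group.fg_of_surjective (f := e.symm.toMonoidHom) e.symm.surjective)
  have hfin : Finite X := by
    refine hX.finite (K := K.map e.toMonoidHom) (fun h => hK ?_)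
      (ParaNil.finiteIndex_map e.surjective hKi)
    rw [← Subgroup.comap_map_eq_self_of_injective (f := e.toMonoidHom) e.injective K, ← Subgroup.comap_top e.toMonoidHom]
    exact congrArg _ h
  have := ParaNil.finite_of_finite_minimalNonNilpotent hpara.2 hX hinsol hgr
  exact ParaNil.nonempty_mulEquiv_of_finite hinsol hpara.2
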